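/- Let $K$ be an algebraic number field of degree $n \geq 2$, and set $\lambda_n := 3/4 - 3/(2n)$ if $2 \leq n \leq 6$ and $\lambda_n := 1 - 3/n$ if $n \geq 6$. Then for every $\varepsilon \in (0, 1/2)$ there exists a constant $C > 0$ (depending on $K$ and $\varepsilon$) such that for all sufficiently large real $x$, $\left| \sum_{m \leq x} r_K(m) \log\frac{x}{m} - \kappa_K x \right| \leq C\, x^{\lambda_n + \varepsilon}$. -/

import Mathlib

open NumberField Filter Asymptotics Set MeasureTheory

/-- `rK K m` is the number of nonzero integral ideals of the ring of integers of `K`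
with absolute norm equal to `m` (for `m ≥ 1` the nonzero condition is automatic). -/
noncomputable def rK (K : Type*) [Field K] [NumberField K] (m : ℕ) : ℕ :=
  Nat.card {I : Ideal (𝓞 K) // Ideal.absNorm I = m}

/-- The exponential integral `E₁(X) = ∫_X^∞ e^{-t}/t dt`. -/
noncomputable def E1 (X : ℝ) : ℝ := ∫ t in Set.Ioi X, Real.exp (-t) / t

lemma one_add_div_sq_le_rpow_mul_rpow {t a b l : ℝ} (ha : 0 < a) (hb : 0 < b)
    (hl : 0 ≤ l) (hl' : l ≤ 1) :
    1 + t ^ 2 / (l * a + (1 - l) * b) ^ 2 ≤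
      (1 + t ^ 2 / a ^ 2) ^ l * (1 + t ^ 2 / b ^ 2) ^ (1 - l) := by
  have h1l : 0 ≤ 1 - l := by linarith
  set A := t ^ 2 / a ^ 2 with hA
  set B := t ^ 2 / b ^ 2 with hB
  have hA0 : 0 ≤ A := by positivity
  have hB0 : 0 ≤ B := by positivity
  have hm : a ^ l * b ^ (1 - l) ≤ l * a + (1 - l) * b :=
    Real.geom_mean_le_arith_mean2_weighted hl h1l ha.le hb.le (by ring)
  have hm0 : 0 < a ^ l * b ^ (1 - l) := by positivity
  have key : A ^ l * B ^ (1 - l) = t ^ 2 / (a ^ l * b ^ (1 - l)) ^ 2 := by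
    rw [hA, hB, Real.div_rpow (by positivity) (by positivity),
      Real.div_rpow (by positivity) (by positivity), div_mul_div_comm,
      ← Real.rpow_add' (by positivity) (by simp)]
    simp only [add_sub_cancel, Real.rpow_one]
    congr 1
    rw [mul_pow, ← Real.rpow_natCast, ← Real.rpow_natCast, ← Real.rpow_mul ha.le,
      ← Real.rpow_mul hb.le, ← Real.rpow_natCast, ← Real.rpow_natCast, ← Real.rpow_mul ha.le,
      ← Real.rpow_mul hb.le, mul_comm l, mul_comm (1 - l)]
  have h1 : t ^ 2 / (l * a + (1 - l) * b) ^ 2 ≤ A ^ l * B ^ (1 - l) := by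
    rw [key]; gcongr
  clear_value A B
  have e1 := Real.geom_mean_le_arith_mean2_weighted hl h1l
    (show 0 ≤ 1 / (1 + A) by positivity) (show 0 ≤ 1 / (1 + B) by positivity) (by ring)
  have e2 := Real.geom_mean_le_arith_mean2_weighted hl h1l
    (show 0 ≤ A / (1 + A) by positivity) (show 0 ≤ B / (1 + B) by positivity) (by ring)
  rw [Real.div_rpow (by positivity) (by positivity), Real.div_rpow (by positivity) (by positivity),
    div_mul_div_comm] at e1 e2
  have hs : l * (1 / (1 + A)) + (1 - l) * (1 / (1 + B)) +
      (l * (A / (1 + A)) + (1 - l) * (B / (1 + B))) = 1 := by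
    field_simp; ring
  have hD : 0 < (1 + A) ^ l * (1 + B) ^ (1 - l) := by positivity
  have : (1 + A ^ l * B ^ (1 - l)) / ((1 + A) ^ l * (1 + B) ^ (1 - l)) ≤ 1 := by
    rw [add_div]; simp only [Real.one_rpow, mul_one] at e1; linarith
  rw [div_le_one hD] at this
  linarith

/-- The quotient of absolute values `|Γ_n(σ + it)| / Γ_n(σ)`, as a product. -/
lemma norm_GammaSeq_eq {σ : ℝ} (hσ : 0 < σ) (t : ℝ) (n : ℕ) (hn : n ≠ 0) :
    ‖Complex.GammaSeq (σ + t * Complex.I) n‖ = ‖Complex.GammaSeq σ n‖ *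
      ∏ j ∈ Finset.range (n + 1), (1 + t ^ 2 / (σ + j) ^ 2) ^ (-(1 / 2) : ℝ) := by
  unfold Complex.GammaSeq
  have hn' : (0 : ℝ) < n := by positivity
  have e1 : ∀ s : ℂ, s.re = σ → ‖(n : ℂ) ^ s‖ = (n : ℝ) ^ σ := by
    intro s hs
    rw [show (n : ℂ) = ((n : ℝ) : ℂ) by simp, Complex.norm_cpow_eq_rpow_re_of_pos hn', hs]
  simp only [norm_div, norm_mul, norm_prod]
  rw [e1 _ (by simp), e1 _ (by simp), div_mul_eq_mul_div, div_eq_div_iff, mul_assoc, mul_assoc,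
    ← Finset.prod_mul_distrib]
  · rw [← mul_assoc]
    congr 1
    refine Finset.prod_congr rfl fun j _ => ?_
    have hp : 0 < σ + j := by positivity
    have h2 : ‖(σ : ℂ) + j‖ = σ + j := by
      rw [show (σ : ℂ) + j = ((σ + j : ℝ) : ℂ) by simp, Complex.norm_real, Real.norm_of_nonneg hp.le]
    have h3 : ‖(σ : ℂ) + t * Complex.I + j‖ = (σ + j) * (1 + t ^ 2 / (σ + j) ^ 2) ^ (1 / 2 : ℝ) := by
      rw [show (σ : ℂ) + t * Complex.I + j = ((σ + j : ℝ) : ℂ) + t * Complex.I by push_cast; ring,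
        Complex.norm_add_mul_I, ← Real.sqrt_eq_rpow]
      rw [show (σ + j) ^ 2 + t ^ 2 = (σ + j) ^ 2 * (1 + t ^ 2 / (σ + j) ^ 2) by field_simp,
        Real.sqrt_mul (by positivity), Real.sqrt_sq hp.le]
    rw [h2, h3, mul_left_comm, mul_comm (_ ^ (-(1/2) : ℝ)), ← Real.rpow_add (by positivity)]
    norm_num
  · rw [Finset.prod_ne_zero_iff]
    intro j _ h
    rw [norm_eq_zero] at h
    have := congrArg Complex.re h
    simp at this
    have : 0 < σ + j := by positivity
    linarith
  · rw [Finset.prod_ne_zero_iff]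
    intro j _ h
    rw [norm_eq_zero] at h
    have := congrArg Complex.re h
    simp at this
    have : 0 < σ + j := by positivity
    linarith

lemma norm_Gamma_one_half_add (t : ℝ) :
    ‖Complex.Gamma ((1 / 2 : ℝ) + t * Complex.I)‖ ^ 2 = Real.pi / Real.cosh (Real.pi * t) := by
  have h := Complex.Gamma_mul_Gamma_one_sub ((1 / 2 : ℝ) + t * Complex.I)
  have hc : (1 : ℂ) - ((1 / 2 : ℝ) + t * Complex.I) =
      (starRingEnd ℂ) (((1 / 2 : ℝ) : ℂ) + t * Complex.I) := by
    simp [Complex.ext_iff]; norm_num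
  rw [hc, Complex.Gamma_conj, Complex.mul_conj] at h
  have h2 := congrArg norm h
  rw [Complex.norm_real, Complex.normSq_eq_norm_sq, Real.norm_of_nonneg (by positivity)] at h2
  rw [h2, norm_div, Complex.norm_real, Real.norm_of_nonneg Real.pi_pos.le]
  congr 1
  rw [show (Real.pi : ℂ) * ((1 / 2 : ℝ) + t * Complex.I) =
      (Real.pi * t : ℝ) * Complex.I + Real.pi / 2 by push_cast; ring, Complex.sin_add_pi_div_two,
    Complex.cos_mul_I, ← Complex.ofReal_cosh, Complex.norm_real,
    Real.norm_of_nonneg (Real.cosh_pos _).le]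

lemma norm_Gamma_one_add (t : ℝ) (ht : t ≠ 0) :
    ‖Complex.Gamma ((1 : ℝ) + t * Complex.I)‖ ^ 2 =
      Real.pi * |t| / |Real.sinh (Real.pi * t)| := by
  have h := Complex.Gamma_mul_Gamma_one_sub (t * Complex.I)
  have hc : (1 : ℂ) - t * Complex.I = (starRingEnd ℂ) (1 + t * Complex.I) := by
    simp [Complex.ext_iff]
  have ht' : (t : ℂ) * Complex.I ≠ 0 := by simp [ht]
  have hs := Complex.Gamma_add_one _ ht'
  rw [hc, Complex.Gamma_conj] at h
  have h1 : Complex.Gamma (1 + t * Complex.I) * (starRingEnd ℂ) (Complex.Gamma (1 + t * Complex.I))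
      = t * Complex.I * (Real.pi / Complex.sin (Real.pi * (t * Complex.I))) := by
    rw [← h]; nth_rewrite 1 [add_comm 1]; rw [hs]; ring
  rw [Complex.mul_conj] at h1
  have h2 := congrArg norm h1
  rw [Complex.norm_real, Complex.normSq_eq_norm_sq, Real.norm_of_nonneg (by positivity)] at h2
  rw [Complex.ofReal_one, h2, ← mul_assoc, ← Complex.ofReal_mul, Complex.sin_mul_I, norm_mul, norm_mul,
    norm_div, norm_mul, ← Complex.ofReal_sinh, Complex.norm_real, Complex.norm_real, Complex.norm_real,
    Complex.norm_I, Real.norm_of_nonneg Real.pi_pos.le]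
  simp only [Real.norm_eq_abs]
  ring

/-- Log-concavity of `σ ↦ |Γ(σ + it)| / Γ(σ)`. -/
lemma norm_Gamma_concave {a b l : ℝ} (ha : 0 < a) (hb : 0 < b)
    (hl : 0 ≤ l) (hl' : l ≤ 1) (t : ℝ) :
    (‖Complex.Gamma (a + t * Complex.I)‖ / Real.Gamma a) ^ l *
      (‖Complex.Gamma (b + t * Complex.I)‖ / Real.Gamma b) ^ (1 - l) ≤
    ‖Complex.Gamma ((l * a + (1 - l) * b : ℝ) + t * Complex.I)‖ / Real.Gamma (l * a + (1 - l) * b) := by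
  have hm : 0 < l * a + (1 - l) * b := by
    rcases hl.eq_or_lt with h | h
    · subst h; simpa using hb
    · have := mul_pos h ha; have := mul_nonneg (by linarith : 0 ≤ 1 - l) hb.le; linarith
  have h1l : 0 ≤ 1 - l := by linarith
  have hlim : ∀ σ : ℝ, 0 < σ → Tendsto (fun n : ℕ => ∏ j ∈ Finset.range (n + 1),
      (1 + t ^ 2 / (σ + j) ^ 2) ^ (-(1 / 2) : ℝ)) atTop
      (nhds (‖Complex.Gamma (σ + t * Complex.I)‖ / Real.Gamma σ)) := by
    intro σ hσ
    have h1 := (Complex.GammaSeq_tendsto_Gamma (σ + t * Complex.I)).norm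
    have h2 := (Complex.GammaSeq_tendsto_Gamma σ).norm
    have hG : ‖Complex.Gamma σ‖ = Real.Gamma σ := by
      rw [Complex.Gamma_ofReal, Complex.norm_real, Real.norm_of_nonneg (Real.Gamma_pos_of_pos hσ).le]
    rw [hG] at h2
    refine (h1.div h2 (Real.Gamma_pos_of_pos hσ).ne').congr' ?_
    filter_upwards [eventually_ne_atTop 0, h2.eventually_ne (Real.Gamma_pos_of_pos hσ).ne']
      with n hn hn2
    simp only [Pi.div_apply]
    rw [norm_GammaSeq_eq hσ t n hn, mul_div_cancel_left₀ _ hn2]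
  have hl1 := ((hlim a ha).rpow_const (p := l) (Or.inr hl)).mul
    ((hlim b hb).rpow_const (p := 1 - l) (Or.inr h1l))
  refine le_of_tendsto_of_tendsto' hl1 (hlim _ hm) fun n => ?_
  rw [← Real.finsetProd_rpow _ _ (fun i _ => by positivity),
    ← Real.finsetProd_rpow _ _ (fun i _ => by positivity), ← Finset.prod_mul_distrib]
  refine Finset.prod_le_prod (fun i _ => by positivity) fun j _ => ?_
  have h := one_add_div_sq_le_rpow_mul_rpow (t := t) (a := a + j) (b := b + j)
    (by positivity) (by positivity) hl hl'
  rw [show l * (a + j) + (1 - l) * (b + j) = l * a + (1 - l) * b + j by ring] at h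
  rw [← Real.rpow_mul (by positivity), ← Real.rpow_mul (by positivity), mul_comm _ l,
    mul_comm _ (1 - l), Real.rpow_mul (by positivity), Real.rpow_mul (by positivity),
    ← Real.mul_rpow (by positivity) (by positivity)]
  exact Real.rpow_le_rpow_of_nonpos (by positivity) h (by norm_num)

lemma norm_Gamma_le_Gamma_re {s : ℂ} (hs : 0 < s.re) :
    ‖Complex.Gamma s‖ ≤ Real.Gamma s.re := by
  rw [Complex.Gamma_eq_integral hs, Real.Gamma_eq_integral hs, Complex.GammaIntegral]
  refine (norm_integral_le_integral_norm _).trans_eq ?_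
  refine setIntegral_congr_fun measurableSet_Ioi fun x hx => ?_
  simp only [norm_mul, Complex.norm_real, Real.norm_of_nonneg (Real.exp_pos _).le]
  rw [Complex.norm_cpow_eq_rpow_re_of_pos hx]
  simp

/-- Sharp exponential decay of `Γ` on the vertical line `Re s = 1 + δ`. -/
lemma exists_norm_Gamma_le {δ : ℝ} (hδ : 0 < δ) :
    ∃ C > 0, ∀ t : ℝ, ‖Complex.Gamma ((1 + δ : ℝ) + t * Complex.I)‖ ≤
      C * (1 + |t|) ^ (1 / 2 + δ) * Real.exp (-(Real.pi / 2 * |t|)) := by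
  have hpi := Real.pi_pos
  have hG : 0 < Real.Gamma (1 + δ) := Real.Gamma_pos_of_pos (by linarith)
  refine ⟨Real.Gamma (1 + δ) * ((4 * Real.pi) ^ ((1 + 2 * δ) / 2) + Real.exp (Real.pi / 2)),
    by positivity, fun t => ?_⟩
  rcases lt_or_ge |t| 1 with ht | ht
  · have h1 : ‖Complex.Gamma ((1 + δ : ℝ) + t * Complex.I)‖ ≤ Real.Gamma (1 + δ) := by
      have := norm_Gamma_le_Gamma_re (s := (1 + δ : ℝ) + t * Complex.I) (by simp; linarith)
      simpa using this
    have h2 : 1 ≤ (1 + |t|) ^ (1 / 2 + δ) := Real.one_le_rpow (by simp) (by linarith)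
    have h3 : 1 ≤ Real.exp (Real.pi / 2) * Real.exp (-(Real.pi / 2 * |t|)) := by
      rw [← Real.exp_add]; apply Real.one_le_exp; nlinarith
    calc _ ≤ Real.Gamma (1 + δ) * (1 * 1) := by simpa using h1
      _ ≤ Real.Gamma (1 + δ) * ((1 + |t|) ^ (1 / 2 + δ) *
          (Real.exp (Real.pi / 2) * Real.exp (-(Real.pi / 2 * |t|)))) := by gcongr
      _ ≤ Real.Gamma (1 + δ) * ((1 + |t|) ^ (1 / 2 + δ) *
          (((4 * Real.pi) ^ ((1 + 2 * δ) / 2) + Real.exp (Real.pi / 2)) *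
            Real.exp (-(Real.pi / 2 * |t|)))) := by
        gcongr; simp; positivity
      _ = _ := by ring
  · have ht0 : t ≠ 0 := by rintro rfl; simp at ht; linarith
    set l : ℝ := 2 * δ / (1 + 2 * δ) with hl
    have hd : 0 < 1 + 2 * δ := by linarith
    have hl0 : 0 < l := by positivity
    have hl1 : 1 - l = 1 / (1 + 2 * δ) := by rw [hl]; field_simp; ring
    have hl1' : 0 < 1 - l := by rw [hl1]; positivity
    have h := norm_Gamma_concave (a := 1 / 2) (b := 1 + δ) (l := l) (by norm_num) (by linarith)
      hl0.le (by linarith) t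
    have hmid : l * (1 / 2) + (1 - l) * (1 + δ) = 1 := by rw [hl1, hl]; field_simp; ring
    rw [hmid, Real.Gamma_one, div_one] at h
    set X := ‖Complex.Gamma ((1 + δ : ℝ) + t * Complex.I)‖ / Real.Gamma (1 + δ) with hX
    set Y := ‖Complex.Gamma ((1 / 2 : ℝ) + t * Complex.I)‖ / Real.Gamma (1 / 2) with hY
    set Z := ‖Complex.Gamma ((1 : ℝ) + t * Complex.I)‖ with hZ
    have hX0 : 0 ≤ X := by positivity
    have hZ0 : 0 ≤ Z := by positivity
    have hY2 : Y ^ 2 = 1 / Real.cosh (Real.pi * t) := by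
      rw [hY, div_pow, norm_Gamma_one_half_add, Real.Gamma_one_half_eq, Real.sq_sqrt hpi.le]
      field_simp
    have hc := Real.cosh_pos (Real.pi * t)
    have hY0 : 0 < Y := by
      have h0 : 0 ≤ Y := by
        rw [hY]; exact div_nonneg (norm_nonneg _) (Real.Gamma_pos_of_pos (by norm_num)).le
      refine h0.lt_of_ne fun h => ?_
      rw [← h] at hY2
      have : 0 < 1 / Real.cosh (Real.pi * t) := by positivity
      simp at hY2; linarith
    have hXle : X ≤ (Z / Y ^ l) ^ (1 + 2 * δ) := by
      have : X ^ (1 - l) ≤ Z / Y ^ l := by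
        rw [le_div_iff₀ (by positivity), mul_comm]; exact h
      have h2 := Real.rpow_le_rpow (by positivity) this hd.le
      rwa [← Real.rpow_mul hX0, hl1, one_div_mul_cancel hd.ne', Real.rpow_one] at h2
    have hX2 : X ^ 2 ≤ (Z ^ 2) ^ (1 + 2 * δ) * ((Y ^ 2)⁻¹) ^ (2 * δ) := by
      have h3 : (Z / Y ^ l) ^ (1 + 2 * δ) = Z ^ (1 + 2 * δ) * (Y⁻¹) ^ (2 * δ) := by
        rw [Real.div_rpow hZ0 (by positivity), ← Real.rpow_mul hY0.le, hl,
          div_mul_cancel₀ _ hd.ne', div_eq_mul_inv, Real.inv_rpow hY0.le]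
      rw [h3] at hXle
      calc X ^ 2 ≤ (Z ^ (1 + 2 * δ) * (Y⁻¹) ^ (2 * δ)) ^ 2 := by gcongr
        _ = _ := by
          rw [mul_pow, ← inv_pow]
          simp only [← Real.rpow_natCast]
          rw [← Real.rpow_mul hZ0, ← Real.rpow_mul hZ0, ← Real.rpow_mul (by positivity),
            ← Real.rpow_mul (by positivity), mul_comm (1 + 2 * δ), mul_comm (2 * δ)]
    have hE := Real.exp_pos (Real.pi * |t|)
    have hch : Real.cosh (Real.pi * t) ≤ Real.exp (Real.pi * |t|) := by
      rw [← Real.cosh_abs, abs_mul, abs_of_pos hpi, Real.cosh_eq]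
      have : Real.exp (-(Real.pi * |t|)) ≤ Real.exp (Real.pi * |t|) :=
        Real.exp_le_exp.mpr (by have : 0 ≤ Real.pi * |t| := by positivity
                                linarith)
      linarith
    have hsh : Real.exp (Real.pi * |t|) / 4 ≤ |Real.sinh (Real.pi * t)| := by
      rw [Real.abs_sinh, abs_mul, abs_of_pos hpi, Real.sinh_eq]
      have h1 : 1 ≤ Real.pi * |t| := by nlinarith [Real.pi_gt_three]
      have h2 : Real.exp (-(Real.pi * |t|)) ≤ 1 := Real.exp_le_one_iff.mpr (by linarith)
      have h3 := Real.add_one_le_exp (Real.pi * |t|)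
      linarith
    have hZ2 : Z ^ 2 ≤ 4 * Real.pi * (1 + |t|) * Real.exp (-(Real.pi * |t|)) := by
      rw [hZ, norm_Gamma_one_add t ht0, Real.exp_neg]
      calc Real.pi * |t| / |Real.sinh (Real.pi * t)|
          ≤ Real.pi * (1 + |t|) / (Real.exp (Real.pi * |t|) / 4) := by gcongr; linarith
        _ = _ := by field_simp
    have hX3 : X ^ 2 ≤ ((4 * Real.pi) ^ ((1 + 2 * δ) / 2) * (1 + |t|) ^ (1 / 2 + δ) *
        Real.exp (-(Real.pi / 2 * |t|))) ^ 2 := by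
      calc X ^ 2 ≤ (Z ^ 2) ^ (1 + 2 * δ) * ((Y ^ 2)⁻¹) ^ (2 * δ) := hX2
        _ ≤ (4 * Real.pi * (1 + |t|) * Real.exp (-(Real.pi * |t|))) ^ (1 + 2 * δ) *
            (Real.exp (Real.pi * |t|)) ^ (2 * δ) := by
          rw [hY2, one_div, inv_inv]; gcongr
        _ = _ := by
          rw [Real.mul_rpow (by positivity) (by positivity),
            Real.mul_rpow (by positivity) (by positivity), ← Real.exp_mul, ← Real.exp_mul,
            mul_assoc, ← Real.exp_add, mul_pow, mul_pow, ← Real.exp_nat_mul]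
          simp only [← Real.rpow_natCast]
          rw [← Real.rpow_mul (by positivity), ← Real.rpow_mul (by positivity)]
          congr 3 <;> push_cast <;> ring
    have hX4 := abs_le_of_sq_le_sq hX3 (by positivity)
    have hX5 : ‖Complex.Gamma ((1 + δ : ℝ) + t * Complex.I)‖ = Real.Gamma (1 + δ) * X := by
      rw [hX]; field_simp
    rw [hX5]
    calc Real.Gamma (1 + δ) * X ≤ Real.Gamma (1 + δ) * ((4 * Real.pi) ^ ((1 + 2 * δ) / 2) *
          (1 + |t|) ^ (1 / 2 + δ) * Real.exp (-(Real.pi / 2 * |t|))) := by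
            gcongr; exact (le_abs_self X).trans hX4
      _ ≤ Real.Gamma (1 + δ) * (((4 * Real.pi) ^ ((1 + 2 * δ) / 2) + Real.exp (Real.pi / 2)) *
          (1 + |t|) ^ (1 / 2 + δ) * Real.exp (-(Real.pi / 2 * |t|))) := by
        gcongr; simp; positivity
      _ = _ := by ring

/-- The archimedean Euler factor at a place of local degree `m`. -/
noncomputable def archFactor (m : ℕ) (s : ℂ) : ℂ :=
  (Real.pi * m : ℂ) ^ (-(m * s / 2)) * Complex.Gamma (m * s / 2)

lemma pi_mul_ne_zero {m : ℕ} (hm : m ≠ 0) : (Real.pi * m : ℂ) ≠ 0 := by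
  simp [hm, Real.pi_ne_zero]

lemma archFactor_ne_zero {m : ℕ} (hm : m ≠ 0) {s : ℂ} (hs : 0 < s.re) : archFactor m s ≠ 0 := by
  have h : (0 : ℝ) < m := by positivity
  refine mul_ne_zero (by simp [Complex.cpow_eq_zero_iff, pi_mul_ne_zero hm, hm]) ?_
  refine Complex.Gamma_ne_zero_of_re_pos ?_
  rw [show (m : ℂ) * s / 2 = ((m / 2 : ℝ) : ℂ) * s by push_cast; ring, Complex.re_ofReal_mul]
  positivity

lemma differentiable_archFactor_inv {m : ℕ} (hm : m ≠ 0) :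
    Differentiable ℂ fun s => (archFactor m s)⁻¹ := by
  have h1 : Differentiable ℂ fun s : ℂ => (Complex.Gamma (m * s / 2))⁻¹ :=
    Complex.differentiable_one_div_Gamma.comp (f := fun s : ℂ => m * s / 2) (by fun_prop)
  have h2 : Differentiable ℂ fun s : ℂ => ((Real.pi * m : ℂ) ^ (-(m * s / 2)))⁻¹ := by
    simp_rw [← Complex.cpow_neg]
    exact fun s => (DifferentiableAt.const_cpow (by fun_prop) (Or.inl (pi_mul_ne_zero hm)))
  simp only [archFactor, mul_inv]
  exact h2.fun_mul h1

lemma archFactor_zero (m : ℕ) : archFactor m 0 = 0 := by simp [archFactor]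

lemma norm_sin_le_exp (z : ℂ) : ‖Complex.sin z‖ ≤ Real.exp |z.im| := by
  have h1 : ‖Complex.exp (-z * Complex.I)‖ ≤ Real.exp |z.im| := by
    rw [Complex.norm_exp]; simp [le_abs_self]
  have h2 : ‖Complex.exp (z * Complex.I)‖ ≤ Real.exp |z.im| := by
    rw [Complex.norm_exp]; simp [neg_le_abs]
  rw [Complex.sin, norm_div, norm_mul, Complex.norm_I, mul_one, Complex.norm_ofNat]
  have := norm_sub_le (Complex.exp (-z * Complex.I)) (Complex.exp (z * Complex.I))
  linarith

lemma norm_cos_le_exp (z : ℂ) : ‖Complex.cos z‖ ≤ Real.exp |z.im| := by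
  rw [← Complex.sin_add_pi_div_two]
  refine (norm_sin_le_exp _).trans_eq ?_
  rw [Complex.add_im, show (Real.pi / 2 : ℂ) = ((Real.pi / 2 : ℝ) : ℂ) by push_cast; ring]
  simp only [Complex.ofReal_im, add_zero]

lemma Gamma_inv_eq {z : ℂ} (hz : Complex.sin (Real.pi * z) ≠ 0) :
    (Complex.Gamma z)⁻¹ = Complex.Gamma (1 - z) * (Complex.sin (Real.pi * z) / Real.pi) := by
  have hpi : (Real.pi : ℂ) ≠ 0 := by exact_mod_cast Real.pi_ne_zero
  have h := Complex.Gamma_mul_Gamma_one_sub z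
  have hg : Complex.Gamma z ≠ 0 := by
    intro h0
    rw [h0, zero_mul] at h
    exact div_ne_zero hpi hz h.symm
  rw [inv_eq_iff_eq_inv, eq_comm, inv_eq_iff_eq_inv, ← mul_right_inj' hg, mul_inv_cancel₀ hg,
    ← mul_assoc, h, div_mul_div_cancel₀ hz, div_self hpi]

/-- `Γ(s)⁻¹` grows at most exponentially in vertical strips. -/
lemma exists_norm_Gamma_inv_le :
    ∃ C > 0, ∀ s : ℂ, s.re ∈ Icc (-1 : ℝ) 2 → 1 ≤ |s.im| →
      ‖(Complex.Gamma s)⁻¹‖ ≤ C * Real.exp (Real.pi * |s.im|) := by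
  obtain ⟨B, hB⟩ := (isCompact_Icc (a := (1 : ℝ)) (b := 4)).exists_bound_of_continuousOn
    (f := Real.Gamma) (fun x hx => (Real.differentiableAt_Gamma fun n => by
      have := hx.1; have : (0 : ℝ) ≤ n := by positivity
      linarith).continuousAt.continuousWithinAt)
  refine ⟨|B| + 1, by positivity, fun s hs ht => ?_⟩
  have hpi := Real.pi_pos
  have him : s.im ≠ 0 := by intro h; rw [h] at ht; simp at ht; linarith
  have hne : ∀ z : ℂ, z.im ≠ 0 → z ≠ 0 := by rintro z hz rfl; simp at hz
  have e1 : Complex.Gamma s = (s - 1) * ((s - 2) * Complex.Gamma (s - 2)) := by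
    have h1 := Complex.Gamma_add_one (s - 1) (hne _ (by simpa using him))
    have h2 := Complex.Gamma_add_one (s - 2) (hne _ (by simpa using him))
    rw [show s - 1 + 1 = s by ring] at h1
    rw [show s - 2 + 1 = s - 1 by ring] at h2
    rw [h1, h2]
  have hsin : Complex.sin (Real.pi * (s - 2)) ≠ 0 := by
    intro h
    rw [Complex.sin_eq_zero_iff] at h
    obtain ⟨k, hk⟩ := h
    have := congrArg Complex.im hk
    simp [Complex.mul_im, hpi.ne'] at this
    exact him this
  have e3 := Gamma_inv_eq hsin
  rw [show 1 - (s - 2) = 3 - s by ring] at e3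
  have hG : ‖Complex.Gamma (3 - s)‖ ≤ |B| + 1 := by
    have h1 := norm_Gamma_le_Gamma_re (s := 3 - s) (by simp; linarith [hs.2])
    have h2 := hB (3 - s).re ⟨by simp; linarith [hs.2], by simp; linarith [hs.1]⟩
    rw [Real.norm_eq_abs] at h2
    linarith [le_abs_self (Real.Gamma (3 - s).re), le_abs_self B]
  have hS : ‖Complex.sin (Real.pi * (s - 2)) / Real.pi‖ ≤ Real.exp (Real.pi * |s.im|) := by
    rw [norm_div, Complex.norm_real, Real.norm_of_nonneg hpi.le, div_le_iff₀ hpi]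
    have h := norm_sin_le_exp (Real.pi * (s - 2))
    have h2 : (Real.pi * (s - 2) : ℂ).im = Real.pi * s.im := by simp
    rw [h2, abs_mul, abs_of_pos hpi] at h
    have : Real.exp (Real.pi * |s.im|) * 1 ≤ Real.exp (Real.pi * |s.im|) * Real.pi := by
      gcongr; linarith [Real.pi_gt_three]
    linarith
  have hd : ∀ a : ℝ, 1 ≤ ‖s - a‖ := fun a => by
    have := Complex.abs_im_le_norm (s - a)
    simp at this; linarith
  have hd1 := hd 1
  have hd2 := hd 2
  push_cast at hd1 hd2
  rw [e1, mul_inv, mul_inv, e3, norm_mul, norm_mul, norm_inv, norm_inv, norm_mul]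
  calc _ ≤ 1 * (1 * ((|B| + 1) * Real.exp (Real.pi * |s.im|))) := by
        gcongr
        · exact inv_le_one_of_one_le₀ hd1
        · exact inv_le_one_of_one_le₀ hd2
    _ = _ := by ring

lemma norm_pi_mul_cpow {m : ℕ} (hm : m ≠ 0) (s : ℂ) :
    ‖(Real.pi * m : ℂ) ^ s‖ = (Real.pi * m) ^ s.re := by
  have : (0 : ℝ) < Real.pi * m := by have := Real.pi_pos; positivity
  rw [show (Real.pi * m : ℂ) = ((Real.pi * m : ℝ) : ℂ) by push_cast; ring,
    Complex.norm_cpow_eq_rpow_re_of_pos this]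

lemma one_le_pi_mul {m : ℕ} (hm : m ≠ 0) : 1 ≤ Real.pi * m := by
  have : (1 : ℝ) ≤ m := by exact_mod_cast Nat.one_le_iff_ne_zero.mpr hm
  nlinarith [Real.pi_gt_three]

lemma exists_norm_archFactor_inv_le {m : ℕ} (hm : m = 1 ∨ m = 2) :
    ∃ C > 0, ∀ s : ℂ, s.re ∈ Icc (-1 : ℝ) 2 → 2 ≤ |s.im| →
      ‖(archFactor m s)⁻¹‖ ≤ C * Real.exp (Real.pi * |s.im|) := by
  have hm0 : m ≠ 0 := by omega
  have hm1 : (1 : ℝ) ≤ m := by rcases hm with rfl | rfl <;> norm_num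
  have hm2 : (m : ℝ) ≤ 2 := by rcases hm with rfl | rfl <;> norm_num
  obtain ⟨C, hC, h⟩ := exists_norm_Gamma_inv_le
  refine ⟨(Real.pi * m) ^ (2 : ℝ) * C, by have := Real.pi_pos; positivity, fun s hs ht => ?_⟩
  have hre : (m * s / 2 : ℂ).re = m / 2 * s.re := by
    rw [show (m : ℂ) * s / 2 = ((m / 2 : ℝ) : ℂ) * s by push_cast; ring, Complex.re_ofReal_mul]
  have him : (m * s / 2 : ℂ).im = m / 2 * s.im := by
    rw [show (m : ℂ) * s / 2 = ((m / 2 : ℝ) : ℂ) * s by push_cast; ring, Complex.im_ofReal_mul]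
  have habs : |(m * s / 2 : ℂ).im| = m / 2 * |s.im| := by
    rw [him, abs_mul, abs_of_nonneg (by positivity)]
  have h1 := h (m * s / 2) (by rw [hre]; constructor <;> nlinarith [hs.1, hs.2])
    (by rw [habs]; nlinarith)
  rw [archFactor, mul_inv, norm_mul, mul_assoc, norm_inv, norm_pi_mul_cpow hm0, Complex.neg_re, hre,
    Real.rpow_neg (by have := one_le_pi_mul hm0; linarith), inv_inv]
  gcongr
  · exact one_le_pi_mul hm0
  · nlinarith [hs.1, hs.2]
  · refine h1.trans ?_
    rw [habs]
    gcongr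
    nlinarith [abs_nonneg s.im]

/-- Growth of the archimedean factor of the functional equation on `Re s = -δ`. -/
lemma exists_norm_archFactor_ratio_le {m : ℕ} (hm : m = 1 ∨ m = 2) {δ : ℝ} (hδ : 0 < δ)
    (hδ' : δ < 1) :
    ∃ C > 0, ∀ t : ℝ, ‖(archFactor m ((-δ : ℝ) + t * Complex.I))⁻¹ *
      archFactor m (1 - ((-δ : ℝ) + t * Complex.I))‖ ≤ C * (1 + |t|) ^ (m * (1 / 2 + δ)) := by
  have hpi := Real.pi_pos
  obtain ⟨C, hC, hG⟩ := exists_norm_Gamma_le hδ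
  have hGn : ∀ t : ℝ, ‖Complex.Gamma (1 - ((-δ : ℝ) + t * Complex.I))‖ ≤
      C * (1 + |t|) ^ (1 / 2 + δ) * Real.exp (-(Real.pi / 2 * |t|)) := fun t => by
    have := hG (-t)
    rw [abs_neg] at this
    convert this using 3
    push_cast; ring
  rcases hm with rfl | rfl
  · have e : ∀ s, archFactor 1 s = Complex.Gammaℝ s := fun s => by
      simp [archFactor, Complex.Gammaℝ_def, neg_div]
    refine ⟨2 * C, by positivity, fun t => ?_⟩
    set s : ℂ := (-δ : ℝ) + t * Complex.I with hs
    have hre : (1 - s).re = 1 + δ := by simp [hs]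
    have h := Complex.Gammaℝ_div_Gammaℝ_one_sub (s := 1 - s) (fun n hn => by
      have := congrArg Complex.re hn
      rw [hre] at this; simp at this
      have : (0 : ℝ) ≤ n := by positivity
      linarith)
    rw [sub_sub_cancel] at h
    rw [e, e, mul_comm, ← div_eq_mul_inv, h, Complex.Gammaℂ_def, norm_mul, norm_mul, norm_mul]
    have h1 : ‖(2 * Real.pi : ℂ) ^ (-(1 - s))‖ ≤ 1 := by
      have := norm_pi_mul_cpow (m := 2) (by norm_num) (-(1 - s))
      push_cast at this
      rw [mul_comm, this, Complex.neg_re, hre]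
      exact Real.rpow_le_one_of_one_le_of_nonpos (by linarith [Real.pi_gt_three]) (by linarith)
    have h2 : ‖Complex.cos (Real.pi * (1 - s) / 2)‖ ≤ Real.exp (Real.pi / 2 * |t|) := by
      refine (norm_cos_le_exp _).trans_eq ?_
      rw [show (Real.pi * (1 - s) / 2 : ℂ) = ((Real.pi / 2 : ℝ) : ℂ) * (1 - s) by push_cast; ring,
        Complex.im_ofReal_mul, abs_mul, abs_of_pos (by positivity)]
      simp [hs]
    calc _ ≤ 2 * 1 * (C * (1 + |t|) ^ (1 / 2 + δ) * Real.exp (-(Real.pi / 2 * |t|))) *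
          Real.exp (Real.pi / 2 * |t|) := by gcongr; simp; exact hGn t
      _ = _ := by rw [Real.exp_neg]; field_simp; norm_num
  · have e : ∀ s, archFactor 2 s = (Real.pi * 2) ^ (-s) * Complex.Gamma s := fun s => by
      simp [archFactor, mul_div_cancel_left₀]
    refine ⟨(Real.pi * 2) ^ (-δ) * C ^ 2, by positivity, fun t => ?_⟩
    set s : ℂ := (-δ : ℝ) + t * Complex.I with hs
    have hre : (1 - s).re = 1 + δ := by simp [hs]
    have hsre : s.re = -δ := by simp [hs]
    have hsin : Complex.sin (Real.pi * s) ≠ 0 := by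
      intro h
      rw [Complex.sin_eq_zero_iff] at h
      obtain ⟨k, hk⟩ := h
      have h1 : s = k := by
        have : (Real.pi : ℂ) ≠ 0 := by exact_mod_cast hpi.ne'
        rw [mul_comm] at hk
        exact mul_right_cancel₀ this hk
      have h2 := congrArg Complex.re h1
      rw [hsre] at h2
      simp at h2
      have h3 : (-1 : ℝ) < k := by linarith
      have h4 : (k : ℝ) < 0 := by linarith
      norm_cast at h3 h4
      omega
    have e3 := Gamma_inv_eq hsin
    have h2 : ‖Complex.sin (Real.pi * s) / Real.pi‖ ≤ Real.exp (Real.pi * |t|) := by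
      rw [norm_div, Complex.norm_real, Real.norm_of_nonneg hpi.le, div_le_iff₀ hpi]
      have h1 := norm_sin_le_exp (Real.pi * s)
      rw [Complex.im_ofReal_mul, abs_mul, abs_of_pos hpi, show s.im = t by simp [hs]] at h1
      have : Real.exp (Real.pi * |t|) * 1 ≤ Real.exp (Real.pi * |t|) * Real.pi := by
        gcongr; linarith [Real.pi_gt_three]
      linarith
    have hn := norm_pi_mul_cpow (m := 2) (by norm_num)
    push_cast at hn
    rw [e, e, mul_inv, e3]
    simp only [norm_mul, norm_inv]
    rw [hn, hn, Complex.neg_re, Complex.neg_re, hre, hsre]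
    have h5 : ((Real.pi * 2) ^ (-(-δ)) : ℝ)⁻¹ * (Real.pi * 2) ^ (-(1 + δ)) ≤ (Real.pi * 2) ^ (-δ) := by
      rw [neg_neg, ← Real.rpow_neg (by positivity)]
      have : (Real.pi * 2) ^ (-(1 + δ)) ≤ (1 : ℝ) :=
        Real.rpow_le_one_of_one_le_of_nonpos (by linarith [Real.pi_gt_three]) (by linarith)
      have h6 : 0 < (Real.pi * 2) ^ (-δ) := by positivity
      nlinarith
    calc _ = (((Real.pi * 2) ^ (-(-δ)) : ℝ)⁻¹ * (Real.pi * 2) ^ (-(1 + δ))) *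
          (‖Complex.Gamma (1 - s)‖ * ‖Complex.sin (Real.pi * s) / Real.pi‖ *
            ‖Complex.Gamma (1 - s)‖) := by ring
      _ ≤ (Real.pi * 2) ^ (-δ) *
          ((C * (1 + |t|) ^ (1 / 2 + δ) * Real.exp (-(Real.pi / 2 * |t|))) * Real.exp (Real.pi * |t|) *
          (C * (1 + |t|) ^ (1 / 2 + δ) * Real.exp (-(Real.pi / 2 * |t|)))) := by
        gcongr
        · exact hGn t
        · exact hGn t
      _ = _ := by
        have hx : Real.exp (Real.pi * |t|) = Real.exp (Real.pi / 2 * |t|) ^ 2 := by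
          rw [← Real.exp_nat_mul]; congr 1; push_cast; ring
        have hy : (1 + |t|) ^ ((2 : ℕ) * (1 / 2 + δ)) = ((1 + |t|) ^ (1 / 2 + δ)) ^ 2 := by
          rw [← Real.rpow_natCast, ← Real.rpow_mul (by positivity), mul_comm]
        rw [hx, hy, Real.exp_neg]
        field_simp

section PoissonPi

variable {ι : Type*}

theorem iUnion_unitBox :
    (⋃ m : ι → ℤ, {x : ι → ℝ | ∀ i, x i ∈ Ioc (m i : ℝ) (m i + 1)}) = univ := by
  refine eq_univ_of_forall fun x => mem_iUnion.2 ⟨fun i => ⌈x i⌉ - 1, fun i => ?_⟩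
  push_cast
  exact ⟨by linarith [Int.ceil_lt_add_one (x i)], by linarith [Int.le_ceil (x i)]⟩

theorem pairwise_disjoint_unitBox :
    Pairwise (Function.onFun Disjoint
      fun m : ι → ℤ => {x : ι → ℝ | ∀ i, x i ∈ Ioc (m i : ℝ) (m i + 1)}) := by
  intro m m' hne
  refine Set.disjoint_left.2 fun x hx hx' => hne (funext fun i => ?_)
  have h1 := hx i
  have h2 := hx' i
  have h3 : (m i : ℝ) < m' i + 1 := h1.1.trans_le h2.2
  have h4 : (m' i : ℝ) < m i + 1 := h2.1.trans_le h1.2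
  norm_cast at h3 h4
  omega

variable [Fintype ι]

theorem measurableSet_unitBox (a : ι → ℝ) :
    MeasurableSet {x : ι → ℝ | ∀ i, x i ∈ Ioc (a i) (a i + 1)} := by
  have : {x : ι → ℝ | ∀ i, x i ∈ Ioc (a i) (a i + 1)} = univ.pi fun i => Ioc (a i) (a i + 1) := by
    ext; simp
  rw [this]
  exact MeasurableSet.univ_pi fun i => measurableSet_Ioc

theorem setIntegral_unitBox_add {E : Type*} [NormedAddCommGroup E] [NormedSpace ℝ E]
    (f : (ι → ℝ) → E) (m : ι → ℤ) :
    ∫ x in {x : ι → ℝ | ∀ i, x i ∈ Ioc (0 : ℝ) (0 + 1)}, f (x + fun i => (m i : ℝ)) =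
      ∫ x in {x : ι → ℝ | ∀ i, x i ∈ Ioc (m i : ℝ) (m i + 1)}, f x := by
  rw [← (measurePreserving_add_right volume (fun i => (m i : ℝ))).setIntegral_preimage_emb
    (MeasurableEquiv.addRight _).measurableEmbedding f]
  congr 2
  ext x
  simp only [mem_ofPred_eq, mem_preimage, Pi.add_apply, mem_Ioc]
  exact forall_congr' fun i => ⟨fun h => ⟨by linarith [h.1], by linarith [h.2]⟩,
    fun h => ⟨by linarith [h.1], by linarith [h.2]⟩⟩

theorem hasSum_setIntegral_unitBox {E : Type*} [NormedAddCommGroup E] [NormedSpace ℝ E]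
    {f : (ι → ℝ) → E} (hf : Integrable f) :
    HasSum (fun m : ι → ℤ => ∫ x in {x : ι → ℝ | ∀ i, x i ∈ Ioc (0 : ℝ) (0 + 1)},
      f (x + fun i => (m i : ℝ))) (∫ x, f x) := by
  simp_rw [setIntegral_unitBox_add]
  rw [← setIntegral_univ, ← iUnion_unitBox (ι := ι)]
  exact hasSum_integral_iUnion (fun m => measurableSet_unitBox _) pairwise_disjoint_unitBox
    hf.integrableOn

theorem integral_unitBox_tsum {f : (ι → ℝ) → ℂ} (hf : Integrable f) :
    ∫ x in {x : ι → ℝ | ∀ i, x i ∈ Ioc (0 : ℝ) (0 + 1)}, ∑' m : ι → ℤ,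
      f (x + fun i => (m i : ℝ)) = ∫ x, f x := by
  rw [← (hasSum_setIntegral_unitBox hf).tsum_eq]
  refine (integral_tsum_of_summable_integral_norm (fun m => ?_) ?_).symm
  · exact (hf.comp_add_right _).integrableOn
  · exact (hasSum_setIntegral_unitBox hf.norm).summable

theorem mFourier_coe (n : ι → ℤ) (x : ι → ℝ) :
    UnitAddTorus.mFourier n (fun i => (x i : UnitAddCircle)) =
      Complex.exp (2 * Real.pi * Complex.I * ∑ i, n i * x i) := by
  rw [Complex.ofReal_sum, Finset.mul_sum, Complex.exp_sum]
  simp only [UnitAddTorus.mFourier, ContinuousMap.coe_mk, fourier_coe_apply]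
  refine Finset.prod_congr rfl fun i _ => ?_
  congr 1
  simp
  ring

theorem poisson_summation_pi {g : (ι → ℝ) → ℂ} (hgi : Integrable g)
    (hcont : Continuous fun x : ι → ℝ => ∑' m : ι → ℤ, g (x + fun i => (m i : ℝ)))
    (hsum : Summable fun n : ι → ℤ =>
      ∫ x : ι → ℝ, Complex.exp (-(2 * Real.pi * Complex.I * ∑ i, n i * x i)) * g x) :
    ∑' m : ι → ℤ, g (fun i => (m i : ℝ)) =
      ∑' n : ι → ℤ, ∫ x : ι → ℝ, Complex.exp (-(2 * Real.pi * Complex.I * ∑ i, n i * x i)) * g x := by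
  set G : (ι → ℝ) → ℂ := fun x => ∑' m : ι → ℤ, g (x + fun i => (m i : ℝ)) with hG
  set q : (ι → ℝ) → UnitAddTorus ι := fun x i => (x i : UnitAddCircle) with hq
  have hquot : IsOpenQuotientMap q :=
    IsOpenQuotientMap.piMap (f := fun (_ : ι) (x : ℝ) => (x : UnitAddCircle)) fun _ =>
      QuotientAddGroup.isOpenQuotientMap_mk
  have hper : ∀ x y, q x = q y → G x = G y := by
    intro x y hxy
    have : ∀ i, ∃ k : ℤ, x i = y i + k := by
      intro i
      have := congrFun hxy i
      simp only [hq] at this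
      rw [← sub_eq_zero, ← AddCircle.coe_sub, AddCircle.coe_eq_zero_iff] at this
      obtain ⟨k, hk⟩ := this
      exact ⟨k, by simp at hk; linarith⟩
    choose k hk using this
    have hx : x = y + fun i => (k i : ℝ) := funext hk
    simp only [hG, hx]
    rw [← (Equiv.addLeft k).tsum_eq (fun m : ι → ℤ => g (y + fun i => (m i : ℝ)))]
    refine tsum_congr fun m => ?_
    congr 1
    ext i
    simp
    ring
  obtain ⟨f, hf⟩ : ∃ f : UnitAddTorus ι → ℂ, ∀ x, f (q x) = G x := by
    refine ⟨fun t => G (Function.surjInv hquot.surjective t), fun x => hper _ _ ?_⟩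
    exact Function.surjInv_eq hquot.surjective _
  have hfc : Continuous f := by
    rw [hquot.isQuotientMap.continuous_iff]
    exact hcont.congr fun x => (hf x).symm
  have hcoef : ∀ n : ι → ℤ, UnitAddTorus.mFourierCoeff f n =
      ∫ x : ι → ℝ, Complex.exp (-(2 * Real.pi * Complex.I * ∑ i, n i * x i)) * g x := by
    intro n
    rw [UnitAddTorus.mFourierCoeff_eq_integral f n 0]
    have hint : Integrable fun x : ι → ℝ =>
        Complex.exp (-(2 * Real.pi * Complex.I * ∑ i, n i * x i)) * g x := by
      refine hgi.bdd_mul (c := 1)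
        (Continuous.aestronglyMeasurable (by fun_prop)) (Eventually.of_forall fun x => ?_)
      rw [Complex.norm_exp]
      simp
    rw [← integral_unitBox_tsum hint]
    refine setIntegral_congr_fun (measurableSet_unitBox _) fun x _ => ?_
    simp only [smul_eq_mul]
    rw [show (fun i => (x i : UnitAddCircle)) = q x from rfl, hf x, hG]
    simp only
    rw [← tsum_mul_left]
    refine tsum_congr fun m => ?_
    congr 1
    rw [hq, mFourier_coe]
    rw [show ∑ i, (n i : ℝ) * (x + fun i => (m i : ℝ)) i =
      ∑ i, (n i : ℝ) * x i + (∑ i, n i * m i : ℤ) by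
        push_cast [Pi.add_apply]; simp only [mul_add, Finset.sum_add_distrib]]
    rw [Complex.ofReal_add, Complex.ofReal_intCast, mul_add, neg_add, Complex.exp_add]
    rw [show -(2 * (Real.pi : ℂ) * Complex.I * ((∑ i, n i * m i : ℤ) : ℂ)) =
      ((-∑ i, n i * m i : ℤ) : ℂ) * (2 * Real.pi * Complex.I) by push_cast; ring,
      Complex.exp_int_mul_two_pi_mul_I, mul_one]
    congr 1
    simp
  have key := UnitAddTorus.hasSum_mFourier_series_apply_of_summable (f := ⟨f, hfc⟩)
    (by simpa only [funext hcoef, ContinuousMap.coe_mk] using hsum) (q 0)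
  rw [ContinuousMap.coe_mk, hf] at key
  have h0 : G 0 = ∑' m : ι → ℤ, g (fun i => (m i : ℝ)) := by simp [hG]
  rw [← h0, ← key.tsum_eq]
  refine tsum_congr fun n => ?_
  rw [hcoef, hq, mFourier_coe]
  simp

end PoissonPi

theorem summable_exp_neg_mul_int_sq {a : ℝ} (ha : 0 < a) :
    Summable fun n : ℤ => Real.exp (-a * (n : ℝ) ^ 2) := by
  have h : Summable fun n : ℕ => Real.exp (-a * (n : ℝ) ^ 2) := by
    refine Summable.of_nonneg_of_le (fun _ => (Real.exp_pos _).le) (fun n => ?_)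
      (Real.summable_exp_nat_mul_iff.2 (neg_lt_zero.2 ha))
    have : (n : ℝ) ≤ (n : ℝ) ^ 2 := by exact_mod_cast Nat.le_self_pow two_ne_zero n
    exact Real.exp_le_exp.2 (by nlinarith)
  exact Summable.of_nat_of_neg (by simpa using h) (by simpa using h)

section GaussPi

variable {ι : Type*} [Fintype ι]

theorem summable_exp_neg_mul_sum_sq {a : ℝ} (ha : 0 < a) :
    Summable fun m : ι → ℤ => Real.exp (-a * ∑ i, (m i : ℝ) ^ 2) := by
  classical
  refine summable_of_sum_le (c := ∏ _i : ι, ∑' n : ℤ, Real.exp (-a * (n : ℝ) ^ 2))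
    (fun _ => (Real.exp_pos _).le) fun u => ?_
  have hsub : u ⊆ Fintype.piFinset fun i => u.image fun m => m i := by
    intro m hm
    exact Fintype.mem_piFinset.2 fun i => Finset.mem_image_of_mem _ hm
  refine (Finset.sum_le_sum_of_subset_of_nonneg hsub fun _ _ _ => (Real.exp_pos _).le).trans ?_
  simp_rw [Finset.mul_sum, Real.exp_sum]
  rw [← Finset.prod_univ_sum (fun i : ι => u.image fun m => m i)
    (fun _ (n : ℤ) => Real.exp (-a * (n : ℝ) ^ 2))]
  refine Finset.prod_le_prod (fun i _ => Finset.sum_nonneg fun _ _ => (Real.exp_pos _).le) ?_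
  intro i _
  exact (summable_exp_neg_mul_int_sq ha).sum_le_tsum _ fun _ _ => (Real.exp_pos _).le

theorem integrable_cexp_neg_pi_sum_sq :
    Integrable fun x : ι → ℝ => Complex.exp (-Real.pi * ∑ i, (x i : ℂ) ^ 2) := by
  simpa using GaussianFourier.integrable_cexp_neg_mul_sum_add (ι := ι) (b := (Real.pi : ℂ))
    (by simpa using Real.pi_pos) 0

theorem dotProduct_transpose_mul_self_mulVec (L : Matrix ι ι ℝ) (x : ι → ℝ) :
    x ⬝ᵥ (L.transpose * L).mulVec x = ∑ i, L.mulVec x i ^ 2 := by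
  rw [← Matrix.mulVec_mulVec, Matrix.mulVec_transpose, dotProduct_comm,
    ← Matrix.dotProduct_mulVec]
  simp [dotProduct, sq]

variable [DecidableEq ι] {L : Matrix ι ι ℝ}

theorem exists_sum_sq_le_sum_sq_mulVec (hL : L.det ≠ 0) :
    ∃ c > 0, ∀ x : ι → ℝ, c * ∑ i, x i ^ 2 ≤ ∑ i, (L.mulVec x) i ^ 2 := by
  set S : ℝ := ∑ i, ∑ j, L⁻¹ i j ^ 2 with hS
  have hS0 : 0 ≤ S := Finset.sum_nonneg fun _ _ => Finset.sum_nonneg fun _ _ => sq_nonneg _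
  refine ⟨(S + 1)⁻¹, by positivity, fun x => ?_⟩
  rw [inv_mul_le_iff₀ (by positivity)]
  have hx : x = L⁻¹.mulVec (L.mulVec x) := by
    rw [Matrix.mulVec_mulVec, Matrix.nonsing_inv_mul _ (isUnit_iff_ne_zero.2 hL), Matrix.one_mulVec]
  set z := L.mulVec x
  have hz : 0 ≤ ∑ i, z i ^ 2 := Finset.sum_nonneg fun _ _ => sq_nonneg _
  have : ∑ i, x i ^ 2 ≤ S * ∑ i, z i ^ 2 := by
    rw [hS, Finset.sum_mul]
    refine Finset.sum_le_sum fun i _ => ?_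
    rw [hx]
    exact Finset.sum_mul_sq_le_sq_mul_sq _ _ _
  nlinarith

theorem summable_exp_neg_sum_sq_mulVec (hL : L.det ≠ 0) {a : ℝ} (ha : 0 < a) :
    Summable fun m : ι → ℤ => Real.exp (-a * ∑ i, (L.mulVec fun i => (m i : ℝ)) i ^ 2) := by
  obtain ⟨c, hc, h⟩ := exists_sum_sq_le_sum_sq_mulVec hL
  refine Summable.of_nonneg_of_le (fun _ => (Real.exp_pos _).le) (fun m => ?_)
    (summable_exp_neg_mul_sum_sq (mul_pos ha hc))
  refine Real.exp_le_exp.2 ?_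
  nlinarith [h fun i => (m i : ℝ)]

theorem measurableEmbedding_mulVec (hL : L.det ≠ 0) : MeasurableEmbedding L.mulVec := by
  refine Continuous.measurableEmbedding (by fun_prop) ?_
  exact Matrix.mulVec_injective_of_isUnit ((Matrix.isUnit_iff_isUnit_det _).2 (isUnit_iff_ne_zero.2 hL))

theorem map_mulVec_volume (hL : L.det ≠ 0) :
    Measure.map L.mulVec volume = ENNReal.ofReal |L.det⁻¹| • (volume : Measure (ι → ℝ)) := by
  rw [← Real.map_matrix_volume_pi_eq_smul_volume_pi hL]
  rfl

theorem integrable_comp_mulVec {E : Type*} [NormedAddCommGroup E]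
    (hL : L.det ≠ 0) {f : (ι → ℝ) → E} (hf : Integrable f) :
    Integrable fun x => f (L.mulVec x) := by
  have := hf.smul_measure (c := ENNReal.ofReal |L.det⁻¹|) ENNReal.ofReal_ne_top
  rw [← map_mulVec_volume hL, (measurableEmbedding_mulVec hL).integrable_map_iff] at this
  exact this

theorem integral_comp_mulVec {E : Type*} [NormedAddCommGroup E] [NormedSpace ℝ E]
    (hL : L.det ≠ 0) (f : (ι → ℝ) → E) :
    ∫ x, f (L.mulVec x) = |L.det|⁻¹ • ∫ x, f x := by
  rw [← (measurableEmbedding_mulVec hL).integral_map, map_mulVec_volume hL, integral_smul_measure,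
    ENNReal.toReal_ofReal (abs_nonneg _), abs_inv]

theorem integral_fourier_gauss_mulVec (hL : L.det ≠ 0) (n : ι → ℤ) :
    ∫ x : ι → ℝ, Complex.exp (-(2 * Real.pi * Complex.I * ∑ i, n i * x i)) *
      Complex.exp (-Real.pi * ∑ i, (L.mulVec x i : ℂ) ^ 2) =
    ((|L.det|⁻¹ * Real.exp (-Real.pi * ∑ i, (L⁻¹.transpose.mulVec fun i => (n i : ℝ)) i ^ 2) : ℝ)
      : ℂ) := by
  set k : ι → ℝ := L⁻¹.transpose.mulVec fun i => (n i : ℝ) with hk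
  have h1 : ∀ x : ι → ℝ, ∑ i, (n i : ℝ) * x i = ∑ i, k i * L.mulVec x i := by
    intro x
    change (fun i => (n i : ℝ)) ⬝ᵥ x = k ⬝ᵥ L.mulVec x
    rw [hk, Matrix.mulVec_transpose, ← Matrix.dotProduct_mulVec, Matrix.mulVec_mulVec,
      Matrix.nonsing_inv_mul _ (isUnit_iff_ne_zero.2 hL), Matrix.one_mulVec]
  simp_rw [h1]
  rw [integral_comp_mulVec hL (fun x : ι → ℝ => Complex.exp
    (-(2 * Real.pi * Complex.I * (∑ i, k i * x i : ℝ))) *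
      Complex.exp (-Real.pi * ∑ i, (x i : ℂ) ^ 2))]
  have h2 := GaussianFourier.integral_cexp_neg_mul_sum_add (ι := ι) (b := (Real.pi : ℂ))
    (by simpa using Real.pi_pos) fun i => -(2 * Real.pi * Complex.I * k i)
  have h3 : ∀ x : ι → ℝ, Complex.exp
    (-(2 * Real.pi * Complex.I * (∑ i, k i * x i : ℝ))) *
      Complex.exp (-Real.pi * ∑ i, (x i : ℂ) ^ 2) = Complex.exp (-Real.pi * ∑ i, (x i : ℂ) ^ 2 +
        ∑ i, -(2 * Real.pi * Complex.I * k i) * x i) := by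
    intro x
    rw [← Complex.exp_add, add_comm]
    congr 2
    push_cast
    rw [Finset.mul_sum, ← Finset.sum_neg_distrib]
    exact Finset.sum_congr rfl fun i _ => by ring
  have hpi : (Real.pi : ℂ) ≠ 0 := by exact_mod_cast Real.pi_ne_zero
  simp_rw [h3, h2]
  rw [div_self hpi, Complex.one_cpow, one_mul]
  push_cast
  rw [Complex.real_smul]
  push_cast
  congr 2
  rw [div_eq_iff (by simp), Finset.mul_sum, Finset.sum_mul]
  refine Finset.sum_congr rfl fun i _ => ?_
  ring_nf
  rw [Complex.I_sq]
  ring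

theorem continuous_tsum_gauss_mulVec (hL : L.det ≠ 0) :
    Continuous fun x : ι → ℝ => ∑' m : ι → ℤ,
      Complex.exp (-Real.pi * ∑ i, (L.mulVec (x + fun i => (m i : ℝ)) i : ℂ) ^ 2) := by
  have hcs : Continuous fun x : ι → ℝ => ∑ i, L.mulVec x i ^ 2 := by fun_prop
  refine continuous_iff_continuousAt.2 fun x₀ => ?_
  set M := ∑ i, L.mulVec x₀ i ^ 2 + 1 with hM
  set U : Set (ι → ℝ) := {x | ∑ i, L.mulVec x i ^ 2 < M} with hU
  have hUo : IsOpen U := isOpen_lt hcs continuous_const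
  have hx₀ : x₀ ∈ U := by simp [hU, hM]
  refine ContinuousOn.continuousAt (s := U) ?_ (hUo.mem_nhds hx₀)
  refine continuousOn_tsum (u := fun m : ι → ℤ => Real.exp (Real.pi * M) *
    Real.exp (-(Real.pi / 2) * ∑ i, (L.mulVec fun i => (m i : ℝ)) i ^ 2))
    (fun m => Continuous.continuousOn ?_)
    ((summable_exp_neg_sum_sq_mulVec hL (by positivity)).mul_left _) fun m x hx => ?_
  · fun_prop
  · rw [Complex.norm_exp, ← Real.exp_add]
    refine Real.exp_le_exp.2 ?_
    rw [show (-(Real.pi : ℂ) * ∑ i, (L.mulVec (x + fun i => (m i : ℝ)) i : ℂ) ^ 2) =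
      ((-Real.pi * ∑ i, L.mulVec (x + fun i => (m i : ℝ)) i ^ 2 : ℝ) : ℂ) by push_cast; rfl,
      Complex.ofReal_re]
    have h1 : ∑ i, (L.mulVec fun i => (m i : ℝ)) i ^ 2 ≤
        2 * ∑ i, L.mulVec (x + fun i => (m i : ℝ)) i ^ 2 + 2 * ∑ i, L.mulVec x i ^ 2 := by
      rw [Finset.mul_sum, Finset.mul_sum, ← Finset.sum_add_distrib]
      refine Finset.sum_le_sum fun i _ => ?_
      rw [Matrix.mulVec_add, Pi.add_apply]
      nlinarith [sq_nonneg ((L.mulVec fun i => (m i : ℝ)) i + 2 * L.mulVec x i)]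
    have h2 : ∑ i, L.mulVec x i ^ 2 < M := hx
    nlinarith [Real.pi_pos]

theorem tsum_exp_neg_pi_sum_sq_mulVec (hL : L.det ≠ 0) :
    ∑' m : ι → ℤ, Real.exp (-Real.pi * ∑ i, (L.mulVec fun i => (m i : ℝ)) i ^ 2) =
      |L.det|⁻¹ * ∑' m : ι → ℤ,
        Real.exp (-Real.pi * ∑ i, (L⁻¹.transpose.mulVec fun i => (m i : ℝ)) i ^ 2) := by
  have hL' : (L⁻¹.transpose).det ≠ 0 := by
    rw [Matrix.det_transpose, Matrix.det_nonsing_inv, Ring.inverse_eq_inv']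
    exact inv_ne_zero hL
  have hs := (summable_exp_neg_sum_sq_mulVec hL' Real.pi_pos).mul_left |L.det|⁻¹
  have := poisson_summation_pi
    (g := fun x : ι → ℝ => Complex.exp (-Real.pi * ∑ i, (L.mulVec x i : ℂ) ^ 2))
    (integrable_comp_mulVec hL integrable_cexp_neg_pi_sum_sq)
    (continuous_tsum_gauss_mulVec hL) (by
      simp_rw [integral_fourier_gauss_mulVec hL]
      exact Complex.ofRealCLM.summable hs)
  simp_rw [integral_fourier_gauss_mulVec hL] at this
  rw [← Complex.ofReal_tsum, tsum_mul_left] at this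
  rw [← Complex.ofReal_inj, ← this, Complex.ofReal_tsum]
  refine tsum_congr fun m => ?_
  push_cast
  rfl

open scoped MatrixOrder Matrix.Norms.L2Operator in
theorem Matrix.PosDef.exists_transpose_mul_self {A : Matrix ι ι ℝ} (hA : A.PosDef) :
    ∃ L : Matrix ι ι ℝ, L.det ≠ 0 ∧ A = L.transpose * L := by
  obtain ⟨L, hL⟩ := CStarAlgebra.nonneg_iff_eq_star_mul_self.1 hA.posSemidef.nonneg
  rw [Matrix.star_eq_conjTranspose, Matrix.conjTranspose_eq_transpose_of_trivial] at hL
  refine ⟨L, fun h => ?_, hL⟩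
  have := hA.det_pos
  rw [hL, Matrix.det_mul, h] at this
  simp at this

theorem summable_exp_neg_quadForm {A : Matrix ι ι ℝ} (hA : A.PosDef) {a : ℝ} (ha : 0 < a) :
    Summable fun m : ι → ℤ =>
      Real.exp (-a * ((fun i => (m i : ℝ)) ⬝ᵥ A.mulVec fun i => (m i : ℝ))) := by
  obtain ⟨L, hL, rfl⟩ := hA.exists_transpose_mul_self
  simp_rw [dotProduct_transpose_mul_self_mulVec]
  exact summable_exp_neg_sum_sq_mulVec hL ha

theorem tsum_exp_neg_pi_quadForm {A : Matrix ι ι ℝ} (hA : A.PosDef) :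
    ∑' m : ι → ℤ, Real.exp (-Real.pi * ((fun i => (m i : ℝ)) ⬝ᵥ A.mulVec fun i => (m i : ℝ))) =
      (√A.det)⁻¹ * ∑' m : ι → ℤ,
        Real.exp (-Real.pi * ((fun i => (m i : ℝ)) ⬝ᵥ A⁻¹.mulVec fun i => (m i : ℝ))) := by
  obtain ⟨L, hL, rfl⟩ := hA.exists_transpose_mul_self
  have h : (L.transpose * L)⁻¹ = (L⁻¹.transpose).transpose * L⁻¹.transpose := by
    rw [Matrix.mul_inv_rev, Matrix.transpose_transpose, Matrix.transpose_nonsing_inv]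
  rw [h]
  simp_rw [dotProduct_transpose_mul_self_mulVec]
  rw [tsum_exp_neg_pi_sum_sq_mulVec hL, Matrix.det_mul, Matrix.det_transpose, ← sq,
    Real.sqrt_sq_eq_abs]

end GaussPi

section Theta

variable {K : Type*} [Field K] [NumberField K]

open InfinitePlace ComplexEmbedding

/-- The weighted trace form `∑ σ, exp (y σ) * ‖σ α‖ ^ 2` over the complex embeddings of `K`. -/
noncomputable def embForm (y : InfinitePlace K → ℝ) (α : K) : ℝ :=
  ∑ σ : K →+* ℂ, Real.exp (y (.mk σ)) * ‖σ α‖ ^ 2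

noncomputable def embMatrix (c : Module.Basis (K →+* ℂ) ℚ K) : Matrix (K →+* ℂ) (K →+* ℂ) ℂ :=
  .of fun σ j => σ (c j)

noncomputable def embGram (c : Module.Basis (K →+* ℂ) ℚ K) (y : InfinitePlace K → ℝ) :
    Matrix (K →+* ℂ) (K →+* ℂ) ℝ :=
  .of fun i j => (∑ σ : K →+* ℂ, (Real.exp (y (.mk σ)) : ℂ) *
    (starRingEnd ℂ (σ (c i)) * σ (c j))).re

theorem sum_conjugate {E : Type*} [AddCommMonoid E] (f : (K →+* ℂ) → E) :
    ∑ σ, f (conjugate σ) = ∑ σ, f σ :=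
  Equiv.sum_comp (Function.Involutive.toPerm _ (involutive_conjugate K)) f

theorem ofReal_embGram (c : Module.Basis (K →+* ℂ) ℚ K) (y : InfinitePlace K → ℝ)
    (i j : K →+* ℂ) : (embGram c y i j : ℂ) =
      ∑ σ : K →+* ℂ, (Real.exp (y (.mk σ)) : ℂ) * (starRingEnd ℂ (σ (c i)) * σ (c j)) := by
  rw [embGram, Matrix.of_apply, ← Complex.conj_eq_iff_re, map_sum, ← sum_conjugate]
  refine Finset.sum_congr rfl fun σ _ => ?_
  rw [map_mul, Complex.conj_ofReal, mk_conjugate_eq]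
  simp

theorem embGram_symm (c : Module.Basis (K →+* ℂ) ℚ K) (y : InfinitePlace K → ℝ)
    (i j : K →+* ℂ) : embGram c y i j = embGram c y j i := by
  rw [← Complex.ofReal_inj, ofReal_embGram, ofReal_embGram, ← sum_conjugate]
  refine Finset.sum_congr rfl fun σ _ => ?_
  simp only [mk_conjugate_eq, conjugate_coe_eq, Complex.conj_conj]
  ring

theorem dotProduct_embGram_mulVec (c : Module.Basis (K →+* ℂ) ℚ K) (y : InfinitePlace K → ℝ)
    (x : (K →+* ℂ) → ℝ) : x ⬝ᵥ (embGram c y).mulVec x =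
      ∑ σ : K →+* ℂ, Real.exp (y (.mk σ)) * ‖∑ j, (x j : ℂ) * σ (c j)‖ ^ 2 := by
  rw [← Complex.ofReal_inj]
  simp only [dotProduct, Matrix.mulVec]
  push_cast
  have h : ∀ σ : K →+* ℂ, Complex.exp (y (.mk σ)) * (‖∑ j, (x j : ℂ) * σ (c j)‖ : ℂ) ^ 2 =
      ∑ i, ∑ j, x i * (Complex.exp (y (.mk σ)) *
        (starRingEnd ℂ (σ (c i)) * σ (c j)) * x j) := by
    intro σ
    rw [← Complex.conj_mul', map_sum, Finset.sum_mul_sum, Finset.mul_sum]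
    refine Finset.sum_congr rfl fun i _ => ?_
    rw [Finset.mul_sum]
    refine Finset.sum_congr rfl fun j _ => ?_
    rw [map_mul, Complex.conj_ofReal]
    ring
  rw [Finset.sum_congr rfl fun σ _ => h σ, Finset.sum_comm]
  refine Finset.sum_congr rfl fun i _ => ?_
  rw [Finset.sum_comm, Finset.mul_sum]
  refine Finset.sum_congr rfl fun j _ => ?_
  rw [ofReal_embGram, Finset.sum_mul, Finset.mul_sum]
  push_cast
  rfl

theorem embForm_sum (c : Module.Basis (K →+* ℂ) ℚ K) (y : InfinitePlace K → ℝ)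
    (m : (K →+* ℂ) → ℤ) : embForm y (∑ j, m j • c j) =
      (fun i => (m i : ℝ)) ⬝ᵥ (embGram c y).mulVec fun i => (m i : ℝ) := by
  rw [dotProduct_embGram_mulVec, embForm]
  simp

variable [DecidableEq (K →+* ℂ)]

theorem map_embGram (c : Module.Basis (K →+* ℂ) ℚ K) (y : InfinitePlace K → ℝ) :
    (embGram c y).map Complex.ofRealHom = (embMatrix c).conjTranspose *
      Matrix.diagonal (fun σ => (Real.exp (y (.mk σ)) : ℂ)) * embMatrix c := by
  ext i j
  rw [Matrix.mul_apply]
  simp only [Matrix.map_apply, Complex.ofRealHom_eq_coe, ofReal_embGram,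
    Matrix.mul_diagonal, Matrix.conjTranspose_apply, embMatrix, Matrix.of_apply]
  exact Finset.sum_congr rfl fun σ _ => by simp; ring

theorem transpose_embMatrix_mul_embMatrix_traceDual (c : Module.Basis (K →+* ℂ) ℚ K) :
    (embMatrix c).transpose * embMatrix c.traceDual = 1 := by
  ext i j
  simp only [Matrix.mul_apply, Matrix.transpose_apply, embMatrix, Matrix.of_apply, ← map_mul]
  rw [Fintype.sum_equiv (RingHom.equivRatAlgHom K ℂ) (fun σ => σ (c i * c.traceDual j))
    (fun σ => σ (c i * c.traceDual j)) fun σ => by simp [RingHom.equivRatAlgHom_apply],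
    ← trace_eq_sum_embeddings, Module.Basis.trace_mul_traceDual, Matrix.one_apply]
  split_ifs <;> simp

theorem det_embMatrix_ne_zero (c : Module.Basis (K →+* ℂ) ℚ K) : (embMatrix c).det ≠ 0 := by
  intro h
  have := congrArg Matrix.det (transpose_embMatrix_mul_embMatrix_traceDual c)
  rw [Matrix.det_mul, Matrix.det_transpose, h] at this
  simp at this

theorem embGram_mul_embGram_traceDual (c : Module.Basis (K →+* ℂ) ℚ K) (y : InfinitePlace K → ℝ) :
    embGram c y * embGram c.traceDual (-y) = 1 := by
  have h1 := transpose_embMatrix_mul_embMatrix_traceDual c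
  have hinj : Function.Injective
      fun M : Matrix (K →+* ℂ) (K →+* ℂ) ℝ => M.map Complex.ofRealHom :=
    Matrix.map_injective Complex.ofRealHom.injective
  have h2 : (embGram c.traceDual (-y)).map Complex.ofRealHom = (embMatrix c.traceDual).transpose *
      Matrix.diagonal (fun σ => (Real.exp (-y (.mk σ)) : ℂ)) *
        (embMatrix c.traceDual).map (starRingEnd ℂ) := by
    ext i j
    rw [Matrix.mul_apply]
    simp only [Matrix.map_apply, Complex.ofRealHom_eq_coe, embGram_symm _ _ i j, ofReal_embGram,
      Matrix.mul_diagonal, Matrix.transpose_apply, embMatrix, Matrix.of_apply, Pi.neg_apply]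
    exact Finset.sum_congr rfl fun σ _ => by ring
  have h3 : embMatrix c * (embMatrix c.traceDual).transpose = 1 := by
    have : embMatrix c.traceDual * (embMatrix c).transpose = 1 :=
      mul_eq_one_comm.1 h1
    rw [← Matrix.transpose_inj, Matrix.transpose_mul, Matrix.transpose_transpose,
      Matrix.transpose_one] at this
    exact this
  set D₁ := Matrix.diagonal fun σ : K →+* ℂ => (Real.exp (y (.mk σ)) : ℂ) with hD₁
  set D₂ := Matrix.diagonal fun σ : K →+* ℂ => (Real.exp (-y (.mk σ)) : ℂ) with hD₂
  have h4 : D₁ * D₂ = 1 := by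
    rw [hD₁, hD₂, Matrix.diagonal_mul_diagonal, ← Matrix.diagonal_one]
    congr 1
    ext σ
    rw [← Complex.ofReal_mul, ← Real.exp_add]
    simp
  apply hinj
  simp only [Matrix.map_mul]
  rw [map_embGram, ← hD₁, h2, Matrix.map_one _ (map_zero _) (map_one _)]
  calc _ = (embMatrix c).conjTranspose * (D₁ *
        (embMatrix c * (embMatrix c.traceDual).transpose) * D₂) *
        (embMatrix c.traceDual).map (starRingEnd ℂ) := by simp only [Matrix.mul_assoc]
    _ = ((embMatrix c).transpose * embMatrix c.traceDual).map (starRingEnd ℂ) := by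
        rw [h3, Matrix.mul_one, h4, Matrix.mul_one, Matrix.map_mul]
        rfl
    _ = 1 := by rw [h1, Matrix.map_one _ (map_zero _) (map_one _)]

theorem posDef_embGram (c : Module.Basis (K →+* ℂ) ℚ K) (y : InfinitePlace K → ℝ) :
    (embGram c y).PosDef := by
  refine Matrix.PosDef.of_dotProduct_mulVec_pos (Matrix.ext fun i j => ?_) fun x hx => ?_
  · exact embGram_symm c y j i
  · rw [star_trivial, dotProduct_embGram_mulVec]
    refine lt_of_le_of_ne (Finset.sum_nonneg fun σ _ => by positivity) fun h => hx ?_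
    have h0 := (Finset.sum_eq_zero_iff_of_nonneg fun σ _ => by positivity).1 h.symm
    have h1 : (embMatrix c).mulVec (fun j => (x j : ℂ)) = 0 := by
      ext σ
      have := h0 σ (Finset.mem_univ _)
      rw [mul_eq_zero, or_iff_right (Real.exp_pos _).ne', sq_eq_zero_iff, norm_eq_zero] at this
      rw [Pi.zero_apply, ← this]
      simp [Matrix.mulVec, dotProduct, embMatrix, mul_comm]
    have h2 := Matrix.eq_zero_of_mulVec_eq_zero (det_embMatrix_ne_zero c) h1
    ext j
    simpa using congrFun h2 j

theorem det_embGram (c : Module.Basis (K →+* ℂ) ℚ K) (y : InfinitePlace K → ℝ) :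
    (embGram c y).det = ‖(embMatrix c).det‖ ^ 2 * Real.exp (∑ σ : K →+* ℂ, y (.mk σ)) := by
  rw [← Complex.ofReal_inj, ← Complex.ofRealHom_eq_coe, RingHom.map_det, RingHom.mapMatrix_apply,
    map_embGram, Matrix.det_mul, Matrix.det_mul, Matrix.det_conjTranspose, Matrix.det_diagonal]
  push_cast
  rw [Complex.exp_sum, ← Complex.conj_mul']
  simp only [Complex.star_def]
  ring

end Theta

section Theta

variable {K : Type*} [Field K] [NumberField K]

open InfinitePlace ComplexEmbedding
open scoped nonZeroDivisors

/-- The theta series of a fractional ideal attached to the form `embForm y`. -/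
noncomputable def idealTheta (I : FractionalIdeal (𝓞 K)⁰ K) (y : InfinitePlace K → ℝ) : ℝ :=
  ∑' α : {α : K // α ∈ I}, Real.exp (-Real.pi * embForm y (α : K))

theorem exists_equiv_of_span {c : Module.Basis (K →+* ℂ) ℚ K} {I : FractionalIdeal (𝓞 K)⁰ K}
    (hc : ∀ α : K, α ∈ I ↔ α ∈ Submodule.span ℤ (Set.range c)) :
    ∃ e : ((K →+* ℂ) → ℤ) ≃ {α : K // α ∈ I}, ∀ m, (e m : K) = ∑ j, m j • c j := by
  have hmem : ∀ m : (K →+* ℂ) → ℤ, ∑ j, m j • c j ∈ I := fun m => by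
    rw [hc]
    exact Submodule.sum_mem _ fun j _ => Submodule.smul_mem _ _ (Submodule.subset_span ⟨j, rfl⟩)
  refine ⟨Equiv.ofBijective (fun m => ⟨∑ j, m j • c j, hmem m⟩) ⟨fun m m' h => ?_, fun α => ?_⟩,
    fun m => rfl⟩
  · have hli := c.linearIndependent.restrict_scalars' ℤ
    have h0 := Fintype.linearIndependent_iff.1 hli (fun j => m j - m' j) (by
      have := Subtype.ext_iff.1 h
      simpa [sub_smul, sub_eq_zero] using this)
    exact funext fun j => sub_eq_zero.1 (h0 j)
  · obtain ⟨m, hm⟩ := (Submodule.mem_span_range_iff_exists_fun ℤ).1 ((hc α).1 α.2)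
    exact ⟨m, Subtype.ext hm⟩

theorem exists_basis_span (I : (FractionalIdeal (𝓞 K)⁰ K)ˣ) :
    ∃ c : Module.Basis (K →+* ℂ) ℚ K,
      ∀ α : K, α ∈ (I : FractionalIdeal (𝓞 K)⁰ K) ↔ α ∈ Submodule.span ℤ (Set.range c) := by
  have h : Fintype.card (Module.Free.ChooseBasisIndex ℤ I) = Fintype.card (K →+* ℂ) := by
    rw [← Module.finrank_eq_card_basis (basisOfFractionalIdeal K I), Embeddings.card]
  refine ⟨(basisOfFractionalIdeal K I).reindex (Fintype.equivOfCardEq h), fun α => ?_⟩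
  rw [Module.Basis.range_reindex, mem_span_basisOfFractionalIdeal]
  rfl

theorem exists_basis_span_dual [DecidableEq (K →+* ℂ)] (I : (FractionalIdeal (𝓞 K)⁰ K)ˣ) :
    ∃ c : Module.Basis (K →+* ℂ) ℚ K,
      (∀ α : K, α ∈ (I : FractionalIdeal (𝓞 K)⁰ K) ↔ α ∈ Submodule.span ℤ (Set.range c)) ∧
      ∀ α : K, α ∈ FractionalIdeal.dual ℤ ℚ (I : FractionalIdeal (𝓞 K)⁰ K) ↔
        α ∈ Submodule.span ℤ (Set.range c.traceDual) := by
  obtain ⟨c, hc⟩ := exists_basis_span I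
  refine ⟨c, hc, fun α => ?_⟩
  have := Submodule.traceDual_span_of_basis ℤ (K := ℚ)
    ((I : FractionalIdeal (𝓞 K)⁰ K) : Submodule (𝓞 K) K) c (Submodule.ext fun β => hc β)
  rw [← this, ← FractionalIdeal.mem_coe, FractionalIdeal.coe_dual ℤ ℚ I.ne_zero]
  rfl

theorem summable_exp_neg_embForm (I : (FractionalIdeal (𝓞 K)⁰ K)ˣ) (y : InfinitePlace K → ℝ)
    {a : ℝ} (ha : 0 < a) :
    Summable fun α : {α : K // α ∈ (I : FractionalIdeal (𝓞 K)⁰ K)} =>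
      Real.exp (-a * embForm y (α : K)) := by
  classical
  obtain ⟨c, hc⟩ := exists_basis_span I
  obtain ⟨e, he⟩ := exists_equiv_of_span hc
  rw [← e.summable_iff]
  simp only [Function.comp_def, he, embForm_sum]
  exact summable_exp_neg_quadForm (posDef_embGram c y) ha

theorem idealTheta_eq {c : Module.Basis (K →+* ℂ) ℚ K} {I : FractionalIdeal (𝓞 K)⁰ K}
    (hc : ∀ α : K, α ∈ I ↔ α ∈ Submodule.span ℤ (Set.range c)) (y : InfinitePlace K → ℝ) :
    idealTheta I y = ∑' m : (K →+* ℂ) → ℤ, Real.exp (-Real.pi *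
      ((fun i => (m i : ℝ)) ⬝ᵥ (embGram c y).mulVec fun i => (m i : ℝ))) := by
  obtain ⟨e, he⟩ := exists_equiv_of_span hc
  rw [idealTheta, ← e.tsum_eq]
  simp only [he, embForm_sum]

theorem exists_idealTheta_eq (I : (FractionalIdeal (𝓞 K)⁰ K)ˣ) :
    ∃ C > 0, ∀ y : InfinitePlace K → ℝ, idealTheta (I : FractionalIdeal (𝓞 K)⁰ K) y =
      C * Real.exp (-(∑ σ : K →+* ℂ, y (.mk σ)) / 2) *
        idealTheta (FractionalIdeal.dual ℤ ℚ (I : FractionalIdeal (𝓞 K)⁰ K)) (-y) := by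
  classical
  obtain ⟨c, hc, hc'⟩ := exists_basis_span_dual I
  refine ⟨‖(embMatrix c).det‖⁻¹, inv_pos.2 (norm_pos_iff.2 (det_embMatrix_ne_zero c)), fun y => ?_⟩
  rw [idealTheta_eq hc, idealTheta_eq hc', tsum_exp_neg_pi_quadForm (posDef_embGram c y),
    Matrix.inv_eq_right_inv (embGram_mul_embGram_traceDual c y), det_embGram,
    Real.sqrt_mul (sq_nonneg _), Real.sqrt_sq (norm_nonneg _), mul_inv, neg_div, Real.exp_neg,
    Real.exp_half]

end Theta

section LogSpace

variable {K : Type*} [Field K] [NumberField K]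

open InfinitePlace Units Units.dirichletUnitTheorem
open scoped nonZeroDivisors Classical

theorem sum_embeddings_eq {E : Type*} [AddCommMonoid E] (f : InfinitePlace K → E) :
    ∑ σ : K →+* ℂ, f (.mk σ) = ∑ w, mult w • f w := by
  rw [← Finset.sum_fiberwise (s := Finset.univ) (g := fun σ : K →+* ℂ => InfinitePlace.mk σ)]
  refine Finset.sum_congr rfl fun w _ => ?_
  rw [Finset.sum_congr rfl fun σ hσ => by rw [(Finset.mem_filter.1 hσ).2], Finset.sum_const,
    card_filter_mk_eq]

/-- The point of the trace-zero hyperplane with logarithmic coordinates `ℓ`. -/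
noncomputable def logShift (ℓ : logSpace K) (w : InfinitePlace K) : ℝ :=
  2 / mult w * if h : w = w₀ then -∑ v, ℓ v else ℓ ⟨w, h⟩

theorem logShift_add (ℓ ℓ' : logSpace K) (w : InfinitePlace K) :
    logShift (ℓ + ℓ') w = logShift ℓ w + logShift ℓ' w := by
  unfold logShift
  split_ifs with h
  · simp only [Pi.add_apply, Finset.sum_add_distrib]; ring
  · simp only [Pi.add_apply]; ring

theorem logShift_smul (c : ℝ) (ℓ : logSpace K) (w : InfinitePlace K) :
    logShift (c • ℓ) w = c * logShift ℓ w := by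
  unfold logShift
  split_ifs with h
  · simp only [Pi.smul_apply, _root_.smul_eq_mul]; rw [← Finset.mul_sum]; ring
  · simp only [Pi.smul_apply, _root_.smul_eq_mul]; ring

theorem logShift_neg (ℓ : logSpace K) (w : InfinitePlace K) :
    logShift (-ℓ) w = -logShift ℓ w := by
  simpa using logShift_smul (-1) ℓ w

theorem sum_mult_mul_logShift (ℓ : logSpace K) : ∑ w, (mult w : ℝ) * logShift ℓ w = 0 := by
  have h : ∀ w : InfinitePlace K, (mult w : ℝ) * logShift ℓ w =
      2 * if h : w = w₀ then -∑ v, ℓ v else ℓ ⟨w, h⟩ := fun w => by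
    unfold logShift
    have : (mult w : ℝ) ≠ 0 := mult_coe_ne_zero
    field_simp
  simp_rw [h, ← Finset.mul_sum]
  rw [Fintype.sum_eq_add_sum_subtype_ne _ w₀]
  simp only [dite_true]
  have h' : ∀ v : {w : InfinitePlace K // w ≠ w₀},
      (if h : v.1 = w₀ then -∑ v, ℓ v else ℓ ⟨v.1, h⟩) = ℓ v := fun v => dif_neg v.2
  simp_rw [h']
  simp

theorem continuous_logShift (w : InfinitePlace K) : Continuous fun ℓ : logSpace K => logShift ℓ w := by
  unfold logShift
  split_ifs with h <;> fun_prop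

theorem logShift_eq_of_mul {a : InfinitePlace K → ℝ} (ha : ∑ w, (mult w : ℝ) * a w = 0)
    (w : InfinitePlace K) :
    logShift (fun v : {w : InfinitePlace K // w ≠ w₀} => (mult v.1 : ℝ) * a v.1) w = 2 * a w := by
  have hm : (mult w : ℝ) ≠ 0 := mult_coe_ne_zero
  unfold logShift
  split_ifs with h
  · rw [Fintype.sum_eq_add_sum_subtype_ne _ w₀] at ha
    have : -∑ v : {w : InfinitePlace K // w ≠ w₀}, (mult v.1 : ℝ) * a v.1 = mult w * a w := by
      subst h; linarith
    rw [this]; field_simp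
  · field_simp

/-- The quadratic form `embForm` in the coordinates given by `logShift`. -/
noncomputable def placeForm (t : ℝ) (ℓ : logSpace K) : ℝ :=
  ∑ w, (mult w : ℝ) * Real.exp (t + logShift ℓ w)

/-- The logarithmic coordinates of `α`. -/
noncomputable def logVec (α : K) : logSpace K := fun w =>
  (mult w.1 : ℝ) * (Real.log (w.1 α) - Real.log |(Algebra.norm ℚ α : ℝ)| / Module.finrank ℚ K)

theorem two_mul_log_eq {α : K} (hα : α ≠ 0) (w : InfinitePlace K) :
    2 * Real.log (w α) =
      2 / Module.finrank ℚ K * Real.log |(Algebra.norm ℚ α : ℝ)| + logShift (logVec α) w := by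
  have hn : (Module.finrank ℚ K : ℝ) ≠ 0 := by exact_mod_cast Module.finrank_pos.ne'
  have h := logShift_eq_of_mul (a := fun w => Real.log (w α) -
    Real.log |(Algebra.norm ℚ α : ℝ)| / Module.finrank ℚ K) (by
      simp only [mul_sub, Finset.sum_sub_distrib, ← Finset.sum_mul]
      have h1 : ∑ w : InfinitePlace K, (mult w : ℝ) * Real.log (w α) =
          Real.log |(Algebra.norm ℚ α : ℝ)| := by
        have := prod_eq_abs_norm α
        rw [← Rat.cast_abs, ← this, Real.log_prod fun w _ => pow_ne_zero _ (by simpa using hα)]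
        exact Finset.sum_congr rfl fun w _ => by rw [Real.log_pow]
      have h2 : ∑ w : InfinitePlace K, (mult w : ℝ) = Module.finrank ℚ K := by
        exact_mod_cast sum_mult_eq
      rw [h1, h2]; field_simp; ring) w
  have h' : logShift (logVec α) w = _ := h
  rw [h']
  ring

theorem embForm_eq_placeForm {α : K} (hα : α ≠ 0) (t : ℝ) (ℓ : logSpace K) :
    embForm (fun w => t + logShift ℓ w) α =
      placeForm (t + 2 / Module.finrank ℚ K * Real.log |(Algebra.norm ℚ α : ℝ)|)
        (ℓ + logVec α) := by
  unfold embForm placeForm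
  have : ∀ σ : K →+* ℂ, ‖σ α‖ = InfinitePlace.mk σ α := fun σ => rfl
  simp_rw [this]
  rw [sum_embeddings_eq fun w : InfinitePlace K => Real.exp (t + logShift ℓ w) * w α ^ 2]
  refine Finset.sum_congr rfl fun w _ => ?_
  have hw : 0 < w α := w.pos_iff.2 hα
  have h2 : w α ^ 2 = Real.exp (2 * Real.log (w α)) := by
    rw [two_mul, Real.exp_add, Real.exp_log hw]; ring
  rw [h2, ← Real.exp_add, two_mul_log_eq hα, nsmul_eq_mul, logShift_add]
  congr 2; ring

theorem abs_norm_units_mul (u : (𝓞 K)ˣ) (α : K) :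
    |(Algebra.norm ℚ ((u : K) * α) : ℝ)| = |(Algebra.norm ℚ α : ℝ)| := by
  have := NumberField.isUnit_iff_norm.1 u.isUnit
  rw [map_mul, Rat.cast_mul, abs_mul]
  have h1 : |((Algebra.norm ℚ (u : K) : ℚ) : ℝ)| = 1 := by
    rw [RingOfIntegers.coe_norm] at this
    exact_mod_cast this
  rw [h1, one_mul]

theorem logVec_units_mul (u : (𝓞 K)ˣ) {α : K} (hα : α ≠ 0) :
    logVec ((u : K) * α) = logVec α + logEmbedding K (Additive.ofMul u) := by
  have hN := abs_norm_units_mul u α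
  funext w
  have hu : w.1 (u : K) ≠ 0 := (Units.pos_at_place u w.1).ne'
  have hw : w.1 α ≠ 0 := (w.1.pos_iff.2 hα).ne'
  simp only [Pi.add_apply, logVec, hN]
  simp only [logEmbedding_component, map_mul, Real.log_mul hu hw]
  ring

theorem le_placeForm (t : ℝ) (ℓ : logSpace K) :
    Module.finrank ℚ K * Real.exp t ≤ placeForm t ℓ := by
  have h2 : ∑ w : InfinitePlace K, (mult w : ℝ) = Module.finrank ℚ K := by
    exact_mod_cast sum_mult_eq
  have h3 := sum_mult_mul_logShift ℓ
  unfold placeForm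
  calc Module.finrank ℚ K * Real.exp t
      = ∑ w, (mult w : ℝ) * (Real.exp t * (logShift ℓ w + 1)) := by
        rw [← h2, Finset.sum_mul]
        have : ∑ w, (mult w : ℝ) * (Real.exp t * (logShift ℓ w + 1)) =
          Real.exp t * ∑ w, (mult w : ℝ) * logShift ℓ w + ∑ w : InfinitePlace K, (mult w : ℝ) * Real.exp t := by
          rw [Finset.mul_sum, ← Finset.sum_add_distrib]
          exact Finset.sum_congr rfl fun w _ => by ring
        rw [this, h3, mul_zero, zero_add]
    _ ≤ _ := Finset.sum_le_sum fun w _ => by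
        rw [Real.exp_add]
        have := Real.add_one_le_exp (logShift ℓ w)
        gcongr

theorem continuous_placeForm : Continuous fun p : ℝ × logSpace K => placeForm p.1 p.2 := by
  unfold placeForm
  have h := fun w : InfinitePlace K => (continuous_logShift (K := K) w).comp continuous_snd (X := ℝ × logSpace K)
  simp only [Function.comp_def] at h
  fun_prop

theorem placeForm_add (t s : ℝ) (ℓ : logSpace K) :
    placeForm (s + t) ℓ = Real.exp s * placeForm t ℓ := by
  unfold placeForm
  rw [Finset.mul_sum]
  exact Finset.sum_congr rfl fun w _ => by rw [add_assoc, Real.exp_add s]; ring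

open scoped ENNReal

theorem tsum_units_logEmbedding (f : logSpace K → ℝ≥0∞) :
    ∑' u : (𝓞 K)ˣ, f (logEmbedding K (Additive.ofMul u)) =
      torsionOrder K * ∑' v : unitLattice K, f v := by
  let e : (𝓞 K)ˣ ≃ unitLattice K × torsion K :=
    Subgroup.groupEquivQuotientProdSubgroup.trans
      (Equiv.prodCongr (Additive.ofMul.trans (logEmbeddingEquiv K).toEquiv) (Equiv.refl _))
  have he : ∀ u, ((e u).1 : logSpace K) = logEmbedding K (Additive.ofMul u) := fun u => by
    have h1 : (Subgroup.groupEquivQuotientProdSubgroup (s := torsion K) u).1 =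
      (QuotientGroup.mk u : (𝓞 K)ˣ ⧸ torsion K) := rfl
    rw [← logEmbeddingEquiv_apply, ← h1]
    rfl
  rw [← e.symm.tsum_eq]
  have : ∀ p : unitLattice K × torsion K,
      f (logEmbedding K (Additive.ofMul (e.symm p))) = f p.1 := fun p => by
    rw [← he, Equiv.apply_symm_apply]
  simp_rw [this]
  rw [ENNReal.tsum_prod']
  rw [← ENNReal.tsum_mul_left]
  refine tsum_congr fun a => ?_
  dsimp only
  rw [ENNReal.tsum_const, torsionOrder, ENat.card_eq_coe_natCard, ENat.toENNReal_coe]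

theorem tsum_units_setLIntegral {D : Set (logSpace K)} (hD : IsAddFundamentalDomain (unitLattice K) D)
    (g : logSpace K → ℝ≥0∞) :
    ∑' u : (𝓞 K)ˣ, ∫⁻ ℓ in D, g (ℓ + logEmbedding K (Additive.ofMul u)) =
      torsionOrder K * ∫⁻ ℓ, g ℓ := by
  have : VAddInvariantMeasure (unitLattice K) (logSpace K) volume :=
    ⟨fun v s _ => measure_preimage_add volume (v : logSpace K) s⟩
  rw [tsum_units_logEmbedding fun v => ∫⁻ ℓ in D, g (ℓ + v), hD.lintegral_eq_tsum'']
  congr 2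
  funext v
  congr 1
  funext ℓ
  rw [add_comm]
  rfl

theorem exists_isAddFundamentalDomain (K : Type*) [Field K] [NumberField K] :
    ∃ D : Set (logSpace K), Bornology.IsBounded D ∧ MeasurableSet D ∧
      IsAddFundamentalDomain (unitLattice K) D := by
  exact ⟨_, ZSpan.fundamentalDomain_isBounded _,
    ZSpan.fundamentalDomain_measurableSet _,
    ZLattice.isAddFundamentalDomain (basisUnitLattice K) volume⟩

theorem IsAddFundamentalDomain.neg_logSpace {D : Set (logSpace K)}
    (hD : IsAddFundamentalDomain (unitLattice K) D) :
    IsAddFundamentalDomain (unitLattice K) (-D) := by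
  have := hD.preimage_of_equiv (H := unitLattice K) (f := Neg.neg) (ν := volume)
    (Measure.measurePreserving_neg (volume : Measure (logSpace K))).quasiMeasurePreserving (e := fun v => -v)
    (neg_involutive).bijective (fun v x => by
      change -((-v : unitLattice K) +ᵥ x) = v +ᵥ (-x)
      simp only [Submodule.vadd_def, vadd_eq_add, Submodule.coe_neg]
      abel)
  exact this

end LogSpace

section Unfolding

variable {K : Type*} [Field K] [NumberField K]

open InfinitePlace Units Units.dirichletUnitTheorem
open scoped nonZeroDivisors Classical ENNReal

/-- The nonzero integral ideals in the ideal class inverse to that of `I`. -/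
abbrev IdealsInClass (I : (FractionalIdeal (𝓞 K)⁰ K)ˣ) :=
  {J : Ideal (𝓞 K) // J ≠ 0 ∧ ∃ α : K, FractionalIdeal.spanSingleton (𝓞 K)⁰ α =
    (J : FractionalIdeal (𝓞 K)⁰ K) * I}

/-- The norm of the ideal `J` times that of `I`. -/
noncomputable def classNorm (I : (FractionalIdeal (𝓞 K)⁰ K)ˣ) (J : IdealsInClass I) : ℝ :=
  (Ideal.absNorm J.1 : ℝ) * (FractionalIdeal.absNorm (I : FractionalIdeal (𝓞 K)⁰ K) : ℝ)

theorem exists_equiv_option (I : (FractionalIdeal (𝓞 K)⁰ K)ˣ) :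
    ∃ (e : Option (IdealsInClass I × (𝓞 K)ˣ) ≃ {α : K // α ∈ (I : FractionalIdeal (𝓞 K)⁰ K)})
      (a : IdealsInClass I → K), (e none : K) = 0 ∧ (∀ J, a J ≠ 0) ∧
      (∀ J, |(Algebra.norm ℚ (a J) : ℝ)| = classNorm I J) ∧
      ∀ J u, (e (some (J, u)) : K) = (u : K) * a J := by
  choose a ha using fun J : IdealsInClass I => J.2.2
  have ha0 : ∀ J, a J ≠ 0 := fun J h => by
    have := ha J
    rw [h, FractionalIdeal.spanSingleton_zero] at this
    exact mul_ne_zero (FractionalIdeal.coeIdeal_ne_zero.2 J.2.1) I.ne_zero this.symm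
  have hspan : ∀ J (u : (𝓞 K)ˣ), FractionalIdeal.spanSingleton (𝓞 K)⁰ ((u : K) * a J) =
      (J.1 : FractionalIdeal (𝓞 K)⁰ K) * I := fun J u => by
    rw [← ha J, ← FractionalIdeal.coeToSubmodule_inj, FractionalIdeal.coe_spanSingleton,
      FractionalIdeal.coe_spanSingleton, Submodule.span_singleton_eq_span_singleton]
    refine ⟨u⁻¹, ?_⟩
    rw [Units.smul_def, Algebra.smul_def, ← mul_assoc, ← map_mul, Units.inv_mul, map_one, one_mul]
  have hmem : ∀ J (u : (𝓞 K)ˣ), (u : K) * a J ∈ (I : FractionalIdeal (𝓞 K)⁰ K) := fun J u => by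
    rw [← FractionalIdeal.spanSingleton_le_iff_mem, hspan]
    exact (mul_le_mul_left (FractionalIdeal.coeIdeal_le_one (I := J.1)) _).trans_eq (one_mul _)
  have hinjU : Function.Injective fun u : (𝓞 K)ˣ => (u : K) := fun u v h =>
    Units.ext (RingOfIntegers.coe_injective h)
  let f : Option (IdealsInClass I × (𝓞 K)ˣ) → {α : K // α ∈ (I : FractionalIdeal (𝓞 K)⁰ K)}
    | none => ⟨0, FractionalIdeal.zero_mem _⟩
    | some p => ⟨(p.2 : K) * a p.1, hmem _ _⟩
  have hu0 : ∀ u : (𝓞 K)ˣ, (u : K) ≠ 0 := fun u => by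
    simp
  have hf : Function.Bijective f := by
    constructor
    · rintro (_ | ⟨J, u⟩) (_ | ⟨J', u'⟩) h
      · rfl
      · exact absurd (Subtype.ext_iff.1 h).symm (mul_ne_zero (hu0 u') (ha0 J'))
      · exact absurd (Subtype.ext_iff.1 h) (mul_ne_zero (hu0 u) (ha0 J))
      · have h1 : (u : K) * a J = (u' : K) * a J' := Subtype.ext_iff.1 h
        have h2 := hspan J u
        rw [h1, hspan J' u', Units.mul_left_inj] at h2
        have h3 : J = J' := Subtype.ext (FractionalIdeal.coeIdeal_injective h2.symm)
        subst h3
        rw [hinjU (mul_right_cancel₀ (ha0 J) h1)]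
    · rintro ⟨α, hα⟩
      by_cases h0 : α = 0
      · exact ⟨none, Subtype.ext h0.symm⟩
      · have h1 : FractionalIdeal.spanSingleton (𝓞 K)⁰ α * ((I⁻¹ : (FractionalIdeal (𝓞 K)⁰ K)ˣ) : FractionalIdeal (𝓞 K)⁰ K) ≤ 1 := by
          rw [← Units.mul_inv I]
          exact mul_le_mul_left (FractionalIdeal.spanSingleton_le_iff_mem.2 hα) _
        obtain ⟨J, hJ⟩ := FractionalIdeal.le_one_iff_exists_coeIdeal.1 h1
        have h2 : FractionalIdeal.spanSingleton (𝓞 K)⁰ α = (J : FractionalIdeal (𝓞 K)⁰ K) * I := by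
          rw [hJ, mul_assoc, Units.inv_mul, mul_one]
        have hJ0 : J ≠ 0 := fun h => by
          rw [h] at h2
          refine h0 (FractionalIdeal.spanSingleton_eq_zero_iff.1 (h2.trans ?_))
          simp
        have h3 := h2.symm.trans rfl
        rw [← ha ⟨J, hJ0, α, h2⟩, ← FractionalIdeal.coeToSubmodule_inj,
          FractionalIdeal.coe_spanSingleton, FractionalIdeal.coe_spanSingleton,
          Submodule.span_singleton_eq_span_singleton] at h3
        obtain ⟨u, hu⟩ := h3
        refine ⟨some (⟨J, hJ0, α, h2⟩, u), Subtype.ext ?_⟩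
        exact (Algebra.smul_def _ _).symm.trans hu
  refine ⟨Equiv.ofBijective f hf, a, rfl, ha0, fun J => ?_, fun J u => rfl⟩
  have := congrArg FractionalIdeal.absNorm (ha J)
  rw [FractionalIdeal.absNorm_span_singleton, map_mul, FractionalIdeal.coeIdeal_absNorm] at this
  rw [classNorm, ← Rat.cast_abs, this]
  simp

theorem classNorm_pos (I : (FractionalIdeal (𝓞 K)⁰ K)ˣ) (J : IdealsInClass I) :
    0 < classNorm I J := by
  obtain ⟨e, a, -, h1, h2, -⟩ := exists_equiv_option I
  rw [← h2]
  simpa using h1 J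

instance countable_fractionalIdeal (I : (FractionalIdeal (𝓞 K)⁰ K)ˣ) :
    Countable {α : K // α ∈ (I : FractionalIdeal (𝓞 K)⁰ K)} := by
  obtain ⟨c, hc⟩ := exists_basis_span I
  obtain ⟨e, -⟩ := exists_equiv_of_span hc
  exact e.symm.injective.countable

theorem ennreal_tsum_option {α : Type*} (f : Option α → ℝ≥0∞) :
    ∑' o, f o = f none + ∑' a, f (some a) := by
  rw [← (Equiv.optionEquivSumPUnit.{0} α).symm.tsum_eq,
    Summable.tsum_sum ENNReal.summable ENNReal.summable, add_comm]
  simp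

/-- The integral of the theta series over a subset of the logarithmic space. -/
noncomputable def thetaInt (I : FractionalIdeal (𝓞 K)⁰ K) (D : Set (logSpace K)) (τ : ℝ) : ℝ≥0∞ :=
  ∫⁻ ℓ in D, ENNReal.ofReal (idealTheta I fun w => Real.log τ + logShift ℓ w)

variable (K) in
/-- The kernel whose Mellin transform is the archimedean factor. -/
noncomputable def placeKernel (τ : ℝ) : ℝ≥0∞ :=
  ∫⁻ ℓ : logSpace K, ENNReal.ofReal (Real.exp (-Real.pi * placeForm (Real.log τ) ℓ))

/-- The nonconstant part of the integrated theta series, up to the number of roots of unity. -/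
noncomputable def classKernel (I : (FractionalIdeal (𝓞 K)⁰ K)ˣ) (τ : ℝ) : ℝ≥0∞ :=
  ∑' J : IdealsInClass I, placeKernel K (τ * classNorm I J ^ (2 / Module.finrank ℚ K : ℝ))

theorem continuous_embForm (α : K) : Continuous fun y : InfinitePlace K → ℝ => embForm y α := by
  unfold embForm
  fun_prop

theorem embForm_zero (y : InfinitePlace K → ℝ) : embForm y (0 : K) = 0 := by
  simp [embForm]

theorem thetaInt_eq (I : (FractionalIdeal (𝓞 K)⁰ K)ˣ) {D : Set (logSpace K)}
    (hD : IsAddFundamentalDomain (unitLattice K) D) {τ : ℝ} (hτ : 0 < τ) :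
    thetaInt (I : FractionalIdeal (𝓞 K)⁰ K) D τ = volume D + torsionOrder K * classKernel I τ := by
  obtain ⟨e, a, he0, ha0, haN, he⟩ := exists_equiv_option I
  have h1 : ∀ ℓ : logSpace K, ENNReal.ofReal
      (idealTheta (I : FractionalIdeal (𝓞 K)⁰ K) fun w => Real.log τ + logShift ℓ w) =
      ∑' α : {α : K // α ∈ (I : FractionalIdeal (𝓞 K)⁰ K)},
        ENNReal.ofReal (Real.exp (-Real.pi * embForm (fun w => Real.log τ + logShift ℓ w) (α : K))) :=
    fun ℓ => ENNReal.ofReal_tsum_of_nonneg (fun _ => (Real.exp_pos _).le)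
      (summable_exp_neg_embForm I _ Real.pi_pos)
  unfold thetaInt
  simp_rw [h1]
  rw [lintegral_tsum fun α => by
    have h2 : Continuous fun ℓ : logSpace K => fun w => Real.log τ + logShift ℓ w :=
      continuous_pi fun w => continuous_const.add (continuous_logShift w)
    have h3 := (continuous_embForm (α : K)).comp h2
    exact (ENNReal.continuous_ofReal.comp (Real.continuous_exp.comp
      (continuous_const.mul h3))).aemeasurable]
  rw [← e.tsum_eq, ennreal_tsum_option, ENNReal.tsum_prod']
  congr 1
  · rw [he0]
    simp [embForm_zero]
  · rw [classKernel, ← ENNReal.tsum_mul_left]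
    refine tsum_congr fun J => ?_
    have hu0 : ∀ u : (𝓞 K)ˣ, (u : K) ≠ 0 := fun u => by simp
    have h4 : Real.log (τ * classNorm I J ^ (2 / Module.finrank ℚ K : ℝ)) =
        Real.log τ + 2 / Module.finrank ℚ K * Real.log (classNorm I J) := by
      rw [Real.log_mul hτ.ne' (Real.rpow_pos_of_pos (classNorm_pos I J) _).ne',
        Real.log_rpow (classNorm_pos I J)]
    rw [placeKernel, h4, ← lintegral_add_right_eq_self _ (logVec (a J)),
      ← tsum_units_setLIntegral hD fun ℓ => ENNReal.ofReal (Real.exp (-Real.pi *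
      placeForm (Real.log τ + 2 / Module.finrank ℚ K * Real.log (classNorm I J)) (ℓ + logVec (a J))))]
    refine tsum_congr fun u => ?_
    congr 1
    funext ℓ
    rw [he, embForm_eq_placeForm (mul_ne_zero (hu0 u) (ha0 J)), logVec_units_mul u (ha0 J)]
    have h5 : |(Algebra.norm ℚ ((u : K) * a J) : ℝ)| = classNorm I J := by
      rw [← haN, abs_norm_units_mul]
    rw [h5]
    congr 4
    abel

end Unfolding

section ThetaInt

variable {K : Type*} [Field K] [NumberField K]

open InfinitePlace Units Units.dirichletUnitTheorem
open scoped nonZeroDivisors Classical ENNReal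

theorem exists_thetaInt_inv_eq (I : (FractionalIdeal (𝓞 K)⁰ K)ˣ) :
    ∃ C > 0, ∀ (D : Set (logSpace K)) (τ : ℝ), 0 < τ →
      thetaInt (I : FractionalIdeal (𝓞 K)⁰ K) D (1 / τ) =
        ENNReal.ofReal (C * τ ^ (Module.finrank ℚ K / 2 : ℝ)) *
          thetaInt (FractionalIdeal.dual ℤ ℚ (I : FractionalIdeal (𝓞 K)⁰ K)) (-D) τ := by
  obtain ⟨C, hC, h⟩ := exists_idealTheta_eq I
  refine ⟨C, hC, fun D τ hτ => ?_⟩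
  unfold thetaInt
  have h2 : ∑ w : InfinitePlace K, (mult w : ℝ) = Module.finrank ℚ K := by
    exact_mod_cast sum_mult_eq
  have h1 : ∀ ℓ : logSpace K, ENNReal.ofReal (idealTheta (I : FractionalIdeal (𝓞 K)⁰ K)
      fun w => Real.log (1 / τ) + logShift ℓ w) =
      ENNReal.ofReal (C * τ ^ (Module.finrank ℚ K / 2 : ℝ)) * ENNReal.ofReal (idealTheta
        (FractionalIdeal.dual ℤ ℚ (I : FractionalIdeal (𝓞 K)⁰ K))
        fun w => Real.log τ + logShift (-ℓ) w) := fun ℓ => by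
    rw [h, ← ENNReal.ofReal_mul (by positivity)]
    congr 3
    · rw [sum_embeddings_eq fun w => Real.log (1 / τ) + logShift ℓ w, Real.rpow_def_of_pos hτ]
      simp only [nsmul_eq_mul, mul_add, Finset.sum_add_distrib, sum_mult_mul_logShift,
        ← Finset.sum_mul, h2, add_zero]
      rw [one_div, Real.log_inv]
      congr 2; ring
    · funext w
      rw [Pi.neg_apply, logShift_neg, one_div, Real.log_inv]
      ring
  simp_rw [h1]
  rw [lintegral_const_mul' _ _ ENNReal.ofReal_ne_top]
  congr 1
  have := (Measure.measurePreserving_neg (volume : Measure (logSpace K))).setLIntegral_comp_preimage_emb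
    (MeasurableEquiv.neg _).measurableEmbedding (fun ℓ => ENNReal.ofReal (idealTheta
        (FractionalIdeal.dual ℤ ℚ (I : FractionalIdeal (𝓞 K)⁰ K))
        fun w => Real.log τ + logShift ℓ w)) (-D)
  rw [← this]
  congr 2
  ext x; simp

theorem exists_abs_logShift_le {D : Set (logSpace K)} (hD : Bornology.IsBounded D) :
    ∃ M, ∀ ℓ ∈ D, ∀ w, |logShift ℓ w| ≤ M := by
  have h : ∀ w : InfinitePlace K, ∃ M, ∀ ℓ ∈ D, |logShift ℓ w| ≤ M := fun w => by
    obtain ⟨M, hM⟩ := hD.isCompact_closure.exists_bound_of_continuousOn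
      (continuous_logShift w).continuousOn
    exact ⟨M, fun ℓ hℓ => hM ℓ (subset_closure hℓ)⟩
  choose M hM using h
  refine ⟨∑ w, |M w|, fun ℓ hℓ w => (hM w ℓ hℓ).trans ((le_abs_self _).trans ?_)⟩
  exact Finset.single_le_sum (f := fun w => |M w|) (fun _ _ => abs_nonneg _) (Finset.mem_univ w)

theorem thetaInt_lt_top (I : (FractionalIdeal (𝓞 K)⁰ K)ˣ) {D : Set (logSpace K)}
    (hD : Bornology.IsBounded D) (τ : ℝ) :
    thetaInt (I : FractionalIdeal (𝓞 K)⁰ K) D τ < ∞ := by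
  obtain ⟨M, hM⟩ := exists_abs_logShift_le hD
  have hs := summable_exp_neg_embForm I (fun _ => Real.log τ) (a := Real.pi * Real.exp (-M))
    (by positivity)
  have h1 : ∀ ℓ ∈ closure D, ENNReal.ofReal (idealTheta (I : FractionalIdeal (𝓞 K)⁰ K)
      fun w => Real.log τ + logShift ℓ w) ≤ ENNReal.ofReal
      (∑' α : {α : K // α ∈ (I : FractionalIdeal (𝓞 K)⁰ K)},
        Real.exp (-(Real.pi * Real.exp (-M)) * embForm (fun _ => Real.log τ) (α : K))) := by
    intro ℓ hℓ
    have hM' : ∀ w, |logShift ℓ w| ≤ M := fun w =>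
      closure_minimal (t := {ℓ | |logShift ℓ w| ≤ M}) (fun ℓ hℓ => hM ℓ hℓ w)
        (isClosed_le (continuous_logShift w).abs continuous_const) hℓ
    refine ENNReal.ofReal_le_ofReal ((summable_exp_neg_embForm I _ Real.pi_pos).tsum_le_tsum
      (fun α => ?_) hs)
    rw [Real.exp_le_exp, neg_mul, neg_mul, neg_le_neg_iff, mul_assoc]
    refine mul_le_mul_of_nonneg_left ?_ Real.pi_pos.le
    unfold embForm
    rw [Finset.mul_sum]
    refine Finset.sum_le_sum fun σ _ => ?_
    rw [← mul_assoc, ← Real.exp_add]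
    gcongr
    linarith [(abs_le.1 (hM' (.mk σ))).1]
  unfold thetaInt
  calc _ ≤ ∫⁻ ℓ in closure D, ENNReal.ofReal (idealTheta (I : FractionalIdeal (𝓞 K)⁰ K)
      fun w => Real.log τ + logShift ℓ w) := lintegral_mono_set subset_closure
    _ ≤ ∫⁻ ℓ in closure D, ENNReal.ofReal
      (∑' α : {α : K // α ∈ (I : FractionalIdeal (𝓞 K)⁰ K)},
        Real.exp (-(Real.pi * Real.exp (-M)) * embForm (fun _ => Real.log τ) (α : K))) :=
        setLIntegral_mono_ae' isClosed_closure.measurableSet (.of_forall h1)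
    _ < ∞ := by
        rw [setLIntegral_const]
        exact ENNReal.mul_lt_top ENNReal.ofReal_lt_top hD.isCompact_closure.measure_lt_top

theorem placeKernel_mul_le {τ x : ℝ} (hτ : 1 ≤ τ) (hx : 0 < x) :
    placeKernel K (τ * x) ≤ ENNReal.ofReal (Real.exp (-Real.pi * (τ - 1) * Module.finrank ℚ K * x)) *
      placeKernel K x := by
  unfold placeKernel
  rw [← lintegral_const_mul' _ _ ENNReal.ofReal_ne_top]
  refine lintegral_mono fun ℓ => ?_
  rw [← ENNReal.ofReal_mul (Real.exp_pos _).le, ← Real.exp_add]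
  refine ENNReal.ofReal_le_ofReal (Real.exp_le_exp.2 ?_)
  rw [Real.log_mul (by positivity) hx.ne', placeForm_add, Real.exp_log (by positivity)]
  have h := le_placeForm (Real.log x) ℓ
  rw [Real.exp_log hx] at h
  have := mul_le_mul_of_nonneg_left h (mul_nonneg Real.pi_pos.le (sub_nonneg.2 hτ))
  linarith

theorem le_classNorm (I : (FractionalIdeal (𝓞 K)⁰ K)ˣ) (J : IdealsInClass I) :
    (FractionalIdeal.absNorm (I : FractionalIdeal (𝓞 K)⁰ K) : ℝ) ≤ classNorm I J := by
  have h : (1 : ℝ) ≤ Ideal.absNorm J.1 := by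
    exact_mod_cast Nat.one_le_iff_ne_zero.2 fun h => J.2.1 (Ideal.absNorm_eq_zero_iff.1 h)
  exact le_mul_of_one_le_left (by exact_mod_cast FractionalIdeal.absNorm_nonneg _) h

theorem absNorm_units_pos (I : (FractionalIdeal (𝓞 K)⁰ K)ˣ) :
    (0 : ℝ) < FractionalIdeal.absNorm (I : FractionalIdeal (𝓞 K)⁰ K) := by
  have h : FractionalIdeal.absNorm (I : FractionalIdeal (𝓞 K)⁰ K) ≠ 0 := by
    rw [Ne, FractionalIdeal.absNorm_eq_zero_iff]
    exact I.ne_zero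
  exact_mod_cast lt_of_le_of_ne (FractionalIdeal.absNorm_nonneg _) h.symm

theorem classKernel_lt_top (I : (FractionalIdeal (𝓞 K)⁰ K)ˣ) {τ : ℝ} (hτ : 0 < τ) :
    classKernel I τ < ∞ := by
  obtain ⟨D, hD, -, hD'⟩ := exists_isAddFundamentalDomain K
  have h := thetaInt_lt_top I hD τ
  rw [thetaInt_eq I hD' hτ] at h
  have h1 : (1 : ℝ≥0∞) ≤ torsionOrder K := by exact_mod_cast torsionOrder_pos K
  exact ((le_mul_of_one_le_left zero_le h1).trans le_add_self).trans_lt h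

theorem classKernel_mul_le (I : (FractionalIdeal (𝓞 K)⁰ K)ˣ) {τ x : ℝ} (hτ : 1 ≤ τ) (hx : 0 < x) :
    classKernel I (τ * x) ≤ ENNReal.ofReal (Real.exp (-Real.pi * (τ - 1) * Module.finrank ℚ K *
      (x * (FractionalIdeal.absNorm (I : FractionalIdeal (𝓞 K)⁰ K) : ℝ) ^ (2 / Module.finrank ℚ K : ℝ)))) *
        classKernel I x := by
  unfold classKernel
  rw [← ENNReal.tsum_mul_left]
  refine ENNReal.tsum_le_tsum fun J => ?_
  have hJ := classNorm_pos I J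
  rw [mul_assoc]
  refine (placeKernel_mul_le hτ (by positivity)).trans ?_
  refine mul_le_mul_left (ENNReal.ofReal_le_ofReal (Real.exp_le_exp.2 ?_)) _
  have h1 := mul_nonneg (mul_nonneg Real.pi_pos.le (sub_nonneg.2 hτ))
    (Nat.cast_nonneg (α := ℝ) (Module.finrank ℚ K))
  have h2 : x * (FractionalIdeal.absNorm (I : FractionalIdeal (𝓞 K)⁰ K) : ℝ) ^
      (2 / Module.finrank ℚ K : ℝ) ≤ x * classNorm I J ^ (2 / Module.finrank ℚ K : ℝ) :=
    mul_le_mul_of_nonneg_left (Real.rpow_le_rpow (absNorm_units_pos I).le (le_classNorm I J)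
      (by positivity)) hx.le
  have := mul_le_mul_of_nonneg_left h2 h1
  linarith

theorem classKernel_antitoneOn (I : (FractionalIdeal (𝓞 K)⁰ K)ˣ) :
    AntitoneOn (classKernel I) (Ioi 0) := by
  intro x hx y hy hxy
  have hx' : 0 < x := hx
  have h1 : 1 ≤ y / x := (one_le_div hx').2 hxy
  have h := classKernel_mul_le I h1 hx'
  rw [div_mul_cancel₀ _ hx'.ne'] at h
  refine h.trans (mul_le_of_le_one_left (zero_le) ?_)
  rw [ENNReal.ofReal_le_one, Real.exp_le_one_iff]
  have h0 := absNorm_units_pos I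
  have : 0 ≤ Real.pi * (y / x - 1) * Module.finrank ℚ K *
    (x * (FractionalIdeal.absNorm (I : FractionalIdeal (𝓞 K)⁰ K) : ℝ) ^ (2 / Module.finrank ℚ K : ℝ)) := by
    have := sub_nonneg.2 h1
    positivity
  linarith

theorem toReal_thetaInt (I : (FractionalIdeal (𝓞 K)⁰ K)ˣ) {D : Set (logSpace K)}
    (hD : Bornology.IsBounded D) (hD' : IsAddFundamentalDomain (unitLattice K) D) {τ : ℝ}
    (hτ : 0 < τ) :
    (thetaInt (I : FractionalIdeal (𝓞 K)⁰ K) D τ).toReal =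
      volume.real D + torsionOrder K * (classKernel I τ).toReal := by
  rw [thetaInt_eq I hD' hτ, ENNReal.toReal_add hD.measure_lt_top.ne
    (ENNReal.mul_ne_top (ENNReal.natCast_ne_top _) (classKernel_lt_top I hτ).ne),
    ENNReal.toReal_mul]
  rfl

end ThetaInt

section FEPair

variable {K : Type*} [Field K] [NumberField K]

open InfinitePlace Units Units.dirichletUnitTheorem
open scoped nonZeroDivisors Classical ENNReal

theorem isBigO_classKernel (I : (FractionalIdeal (𝓞 K)⁰ K)ˣ) (r : ℝ) :
    (fun τ => (classKernel I τ).toReal) =O[atTop] (· ^ r) := by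
  set c : ℝ := Module.finrank ℚ K * (FractionalIdeal.absNorm (I : FractionalIdeal (𝓞 K)⁰ K) : ℝ) ^
    (2 / Module.finrank ℚ K : ℝ) with hc
  have hc0 : 0 < Real.pi * c := by
    have h0 := absNorm_units_pos I
    have h1 : (0 : ℝ) < Module.finrank ℚ K := by exact_mod_cast Module.finrank_pos
    positivity
  have h : (fun τ => (classKernel I τ).toReal) =O[atTop] fun τ => Real.exp (-(Real.pi * c) * τ) := by
    refine IsBigO.of_bound (Real.exp (Real.pi * c) * (classKernel I 1).toReal) ?_
    filter_upwards [eventually_ge_atTop 1] with τ hτ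
    have h1 := classKernel_mul_le I hτ one_pos
    rw [mul_one, one_mul] at h1
    have h2 := ENNReal.toReal_mono (ENNReal.mul_ne_top ENNReal.ofReal_ne_top
      (classKernel_lt_top I one_pos).ne) h1
    rw [ENNReal.toReal_mul, ENNReal.toReal_ofReal (Real.exp_pos _).le] at h2
    rw [Real.norm_of_nonneg ENNReal.toReal_nonneg, Real.norm_of_nonneg (Real.exp_pos _).le]
    refine h2.trans_eq ?_
    rw [mul_right_comm (Real.exp _), ← Real.exp_add]
    congr 2
    rw [hc]; ring
  exact h.trans (isLittleO_exp_neg_mul_rpow_atTop hc0 r).isBigO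

theorem locallyIntegrableOn_classKernel (I : (FractionalIdeal (𝓞 K)⁰ K)ˣ) :
    LocallyIntegrableOn (fun τ => (classKernel I τ).toReal) (Ioi 0) := by
  rw [locallyIntegrableOn_iff isOpen_Ioi.isLocallyClosed]
  intro k hk hk'
  have h : AntitoneOn (fun τ => (classKernel I τ).toReal) (Ioi 0) := fun x hx y hy hxy =>
    ENNReal.toReal_mono (classKernel_lt_top I hx).ne (classKernel_antitoneOn I hx hy hxy)
  exact (h.mono hk).integrableOn_isCompact hk'

theorem exists_weakFEPair (I : (FractionalIdeal (𝓞 K)⁰ K)ˣ) :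
    ∃ (P : WeakFEPair ℂ) (I' : (FractionalIdeal (𝓞 K)⁰ K)ˣ), P.k = Module.finrank ℚ K / 2 ∧
      (∀ τ ∈ Ioi (0 : ℝ), P.f τ - P.f₀ = ((torsionOrder K * (classKernel I τ).toReal : ℝ) : ℂ)) ∧
      (∀ τ ∈ Ioi (0 : ℝ), P.g τ - P.g₀ = ((torsionOrder K * (classKernel I' τ).toReal : ℝ) : ℂ)) := by
  obtain ⟨D, hD, -, hD'⟩ := exists_isAddFundamentalDomain K
  obtain ⟨C, hC, hfe⟩ := exists_thetaInt_inv_eq I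
  set I' : (FractionalIdeal (𝓞 K)⁰ K)ˣ := Units.mk0 _
    (FractionalIdeal.dual_ne_zero ℤ ℚ I.ne_zero) with hI'
  have hI'' : (I' : FractionalIdeal (𝓞 K)⁰ K) = FractionalIdeal.dual ℤ ℚ I := rfl
  rw [← hI''] at hfe
  have hDn : Bornology.IsBounded (-D) := hD.neg
  have hDn' := IsAddFundamentalDomain.neg_logSpace hD'
  have key : ∀ {I : (FractionalIdeal (𝓞 K)⁰ K)ˣ} {D : Set (logSpace K)}
      (hD : Bornology.IsBounded D) (hD' : IsAddFundamentalDomain (unitLattice K) D) (τ : ℝ)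
      (hτ : 0 < τ), (((thetaInt (I : FractionalIdeal (𝓞 K)⁰ K) D τ).toReal : ℝ) : ℂ) -
        ((volume.real D : ℝ) : ℂ) = ((torsionOrder K * (classKernel I τ).toReal : ℝ) : ℂ) :=
    fun {I D} hD hD' τ hτ => by
      rw [toReal_thetaInt I hD hD' hτ]
      push_cast; ring
  have hint : ∀ {I : (FractionalIdeal (𝓞 K)⁰ K)ˣ} {D : Set (logSpace K)}
      (hD : Bornology.IsBounded D) (hD' : IsAddFundamentalDomain (unitLattice K) D),
      LocallyIntegrableOn (fun τ => (((thetaInt (I : FractionalIdeal (𝓞 K)⁰ K) D τ).toReal : ℝ) : ℂ))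
        (Ioi 0) := fun {I D} hD hD' => by
    have h1 : LocallyIntegrableOn (fun τ => volume.real D + torsionOrder K *
        (classKernel I τ).toReal) (Ioi 0) :=
      (locallyIntegrableOn_const _).add ((locallyIntegrableOn_classKernel I).smul (torsionOrder K : ℝ))
    rw [locallyIntegrableOn_iff isOpen_Ioi.isLocallyClosed] at h1 ⊢
    intro k hk hk'
    have h2 : IntegrableOn (fun τ => ((volume.real D + torsionOrder K *
        (classKernel I τ).toReal : ℝ) : ℂ)) k := (h1 k hk hk').ofReal
    refine h2.congr_fun (fun τ hτ => ?_) hk'.measurableSet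
    rw [toReal_thetaInt I hD hD' (hk hτ)]
  have htop : ∀ {I : (FractionalIdeal (𝓞 K)⁰ K)ˣ} {D : Set (logSpace K)}
      (hD : Bornology.IsBounded D) (hD' : IsAddFundamentalDomain (unitLattice K) D) (r : ℝ),
      (fun τ => (((thetaInt (I : FractionalIdeal (𝓞 K)⁰ K) D τ).toReal : ℝ) : ℂ) -
        ((volume.real D : ℝ) : ℂ)) =O[atTop] fun τ : ℝ => τ ^ r := fun {I D} hD hD' r => by
    refine (((isBigO_classKernel I r).const_mul_left (torsionOrder K : ℝ)).norm_left.congr' ?_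
      EventuallyEq.rfl).of_norm_left
    filter_upwards [eventually_gt_atTop 0] with τ hτ
    rw [key hD hD' τ hτ, Complex.norm_real]
  refine ⟨{ f := fun τ => (((thetaInt (I : FractionalIdeal (𝓞 K)⁰ K) D τ).toReal : ℝ) : ℂ)
            g := fun τ => (((thetaInt (I' : FractionalIdeal (𝓞 K)⁰ K) (-D) τ).toReal : ℝ) : ℂ)
            k := Module.finrank ℚ K / 2
            ε := (C : ℂ)
            f₀ := ((volume.real D : ℝ) : ℂ)
            g₀ := ((volume.real (-D) : ℝ) : ℂ)
            hf_int := hint hD hD'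
            hg_int := hint hDn hDn'
            hk := by
              have h1 : (0 : ℝ) < Module.finrank ℚ K := by exact_mod_cast Module.finrank_pos
              positivity
            hε := by exact_mod_cast hC.ne'
            h_feq := fun τ hτ => ?_
            hf_top := htop hD hD'
            hg_top := htop hDn hDn' }, I', rfl, key hD hD', key hDn hDn'⟩
  have hτ' : (0 : ℝ) < τ := hτ
  rw [hfe D τ hτ, ENNReal.toReal_mul, ENNReal.toReal_ofReal (by positivity)]
  simp

end FEPair

section ArchIntegral

theorem integral_Ioi_eq_integral_exp {E : Type*} [NormedAddCommGroup E] [NormedSpace ℝ E]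
    (f : ℝ → E) : ∫ x in Ioi (0 : ℝ), f x = ∫ t : ℝ, Real.exp t • f (Real.exp t) := by
  have h := integral_image_eq_integral_abs_deriv_smul (s := univ) (f := Real.exp) (f' := Real.exp)
    MeasurableSet.univ (fun x _ => (Real.hasDerivAt_exp x).hasDerivWithinAt)
    Real.exp_injective.injOn f
  rw [image_univ, Real.range_exp] at h
  simpa [abs_of_pos (Real.exp_pos _)] using h

theorem integrableOn_Ioi_iff_exp {E : Type*} [NormedAddCommGroup E] [NormedSpace ℝ E]
    (f : ℝ → E) : IntegrableOn f (Ioi (0 : ℝ)) ↔ Integrable fun t : ℝ => Real.exp t • f (Real.exp t) := by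
  have h := integrableOn_image_iff_integrableOn_abs_deriv_smul (s := univ) (f := Real.exp)
    (f' := Real.exp)
    MeasurableSet.univ (fun x _ => (Real.hasDerivAt_exp x).hasDerivWithinAt)
    Real.exp_injective.injOn f
  rw [image_univ, Real.range_exp] at h
  simpa [abs_of_pos (Real.exp_pos _)] using h

theorem exp_smul_cpow_eq (a : ℂ) (t : ℝ) (w : ℂ) :
    Real.exp t • (((Real.exp t : ℝ) : ℂ) ^ (a - 1) * w) = Complex.exp (a * t) * w := by
  rw [Complex.real_smul, ← mul_assoc, Complex.ofReal_exp,
    Complex.cpow_def_of_ne_zero (Complex.exp_ne_zero _), ← Complex.ofReal_exp,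
    ← Complex.ofReal_log (Real.exp_pos _).le, Real.log_exp, Complex.ofReal_exp, ← Complex.exp_add]
  congr 2; ring

theorem integrable_archFactor {m : ℕ} (hm : m ≠ 0) {s : ℂ} (hs : 0 < s.re) :
    Integrable fun t : ℝ => Complex.exp (m * s / 2 * t) *
      (Real.exp (-Real.pi * (m * Real.exp t)) : ℂ) := by
  have hm' : (0 : ℝ) < m := by exact_mod_cast Nat.pos_of_ne_zero hm
  have h := integrableOn_Ioi_iff_exp fun x : ℝ => (x : ℂ) ^ (m * s / 2 - 1 : ℂ) *
    (Real.exp (-Real.pi * (m * x)) : ℂ)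
  simp only [exp_smul_cpow_eq] at h
  refine h.1 ?_
  have hre : (m * s / 2 : ℂ).re = m * s.re / 2 := by
    rw [show (m * s / 2 : ℂ) = ((m / 2 : ℝ) : ℂ) * s by push_cast; ring, Complex.re_ofReal_mul]
    ring
  have h1 : 0 < (m * s / 2 : ℂ).re := by rw [hre]; positivity
  have h2 : 0 < Real.pi * m := by positivity
  have h3 := (Complex.GammaIntegral_convergent (s := (m * s / 2 : ℂ)) h1)
  have h4 := (integrableOn_Ioi_comp_mul_left_iff _ (0 : ℝ) h2).2 (by rwa [mul_zero])
  have h5 : IntegrableOn _ (Ioi (0 : ℝ)) :=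
    h4.const_mul (((Real.pi * m : ℝ) : ℂ) ^ (m * s / 2 - 1 : ℂ))⁻¹
  refine h5.congr_fun
    (fun x hx => ?_) measurableSet_Ioi
  have hx : 0 < x := hx
  have hne : ((Real.pi * m : ℝ) : ℂ) ^ (m * s / 2 - 1 : ℂ) ≠ 0 := by
    rw [Ne, Complex.cpow_eq_zero_iff, not_and_or]
    exact .inl (by exact_mod_cast h2.ne')
  simp only
  rw [Complex.ofReal_mul (Real.pi * m) x, Complex.mul_cpow_ofReal_nonneg h2.le hx.le]
  field_simp

theorem integral_archFactor {m : ℕ} (hm : m ≠ 0) {s : ℂ} (hs : 0 < s.re) :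
    ∫ t : ℝ, Complex.exp (m * s / 2 * t) *
      (Real.exp (-Real.pi * (m * Real.exp t)) : ℂ) = archFactor m s := by
  have hm' : (0 : ℝ) < m := by exact_mod_cast Nat.pos_of_ne_zero hm
  have h := integral_Ioi_eq_integral_exp fun x : ℝ => (x : ℂ) ^ (m * s / 2 - 1 : ℂ) *
    (Real.exp (-Real.pi * (m * x)) : ℂ)
  simp only [exp_smul_cpow_eq] at h
  rw [← h]
  have hre : (m * s / 2 : ℂ).re = m * s.re / 2 := by
    rw [show (m * s / 2 : ℂ) = ((m / 2 : ℝ) : ℂ) * s by push_cast; ring, Complex.re_ofReal_mul]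
    ring
  have h1 : 0 < (m * s / 2 : ℂ).re := by rw [hre]; positivity
  have h2 : 0 < Real.pi * m := by positivity
  have h3 := Complex.integral_cpow_mul_exp_neg_mul_Ioi h1 h2
  have h4 : (1 / ((Real.pi * m : ℝ) : ℂ)) ^ (m * s / 2 : ℂ) = (Real.pi * m : ℂ) ^ (-(m * s / 2)) := by
    rw [Complex.cpow_neg, one_div, Complex.inv_cpow _ _ (by
      rw [Complex.arg_ofReal_of_nonneg h2.le]; exact Real.pi_pos.ne)]
    push_cast; rfl
  rw [archFactor, ← h4, ← h3]
  refine setIntegral_congr_fun measurableSet_Ioi fun x hx => ?_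
  push_cast
  ring_nf

end ArchIntegral

section PlaceKernel

variable {K : Type*} [Field K] [NumberField K]

open InfinitePlace Units Units.dirichletUnitTheorem
open scoped nonZeroDivisors Classical ENNReal

theorem sum_mult_real : ∑ w : InfinitePlace K, (mult w : ℝ) = Module.finrank ℚ K := by
  exact_mod_cast sum_mult_eq

variable (K) in
/-- The coordinates on `ℝ × logSpace K` given by the infinite places. -/
noncomputable def placeCoord : (ℝ × logSpace K) ≃L[ℝ] (InfinitePlace K → ℝ) :=
  LinearEquiv.toContinuousLinearEquiv
  { toFun := fun p w => p.1 + logShift p.2 w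
    map_add' := fun p q => by
      funext w
      simp only [Prod.fst_add, Prod.snd_add, logShift_add, Pi.add_apply]
      ring
    map_smul' := fun c p => by
      funext w
      simp only [Prod.smul_fst, Prod.smul_snd, logShift_smul, Pi.smul_apply, _root_.smul_eq_mul,
        RingHom.id_apply]
      ring
    invFun := fun y => ((∑ v, (mult v : ℝ) * y v) / Module.finrank ℚ K,
      fun w => (mult w.1 : ℝ) * ((y w.1 - (∑ v, (mult v : ℝ) * y v) / Module.finrank ℚ K) / 2))
    left_inv := fun p => by
      have hn : (Module.finrank ℚ K : ℝ) ≠ 0 := by exact_mod_cast Module.finrank_pos.ne'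
      have h1 : (∑ v, (mult v : ℝ) * (p.1 + logShift p.2 v)) / Module.finrank ℚ K = p.1 := by
        simp only [mul_add, Finset.sum_add_distrib, sum_mult_mul_logShift, ← Finset.sum_mul,
          sum_mult_real]
        field_simp; ring
      refine Prod.ext h1 (funext fun w => ?_)
      simp only [h1]
      have hm : (mult w.1 : ℝ) ≠ 0 := mult_coe_ne_zero
      have h2 : logShift p.2 w.1 = 2 / mult w.1 * p.2 w := by
        unfold logShift; rw [dif_neg w.2]
      rw [h2]
      field_simp
      ring
    right_inv := fun y => by
      have hn : (Module.finrank ℚ K : ℝ) ≠ 0 := by exact_mod_cast Module.finrank_pos.ne'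
      funext w
      simp only
      rw [logShift_eq_of_mul (a := fun w => (y w - (∑ v, (mult v : ℝ) * y v) /
        Module.finrank ℚ K) / 2)]
      · ring
      · simp only [← mul_div_assoc, ← Finset.sum_div, mul_sub, Finset.sum_sub_distrib]
        rw [← Finset.sum_mul, sum_mult_real]
        field_simp
        ring }

theorem placeCoord_apply (p : ℝ × logSpace K) (w : InfinitePlace K) :
    placeCoord K p w = p.1 + logShift p.2 w := rfl

theorem exists_integral_comp_placeCoord : ∃ c : ℝ, 0 < c ∧
    ∀ g : (InfinitePlace K → ℝ) → ℂ, Integrable g →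
      Integrable (fun p : ℝ × logSpace K => g (placeCoord K p)) ∧
      ∫ p : ℝ × logSpace K, g (placeCoord K p) = c * ∫ y, g y := by
  have : (volume : Measure (ℝ × logSpace K)).IsAddHaarMeasure :=
    Measure.prod.instIsAddHaarMeasure _ _
  have : (volume.map (placeCoord K)).IsAddHaarMeasure :=
    (placeCoord K).isAddHaarMeasure_map volume
  have hc := Measure.isAddLeftInvariant_eq_smul (volume.map (placeCoord K))
    (volume : Measure (InfinitePlace K → ℝ))
  have hc0 := Measure.addHaarScalarFactor_pos_of_isAddHaarMeasure (volume.map (placeCoord K))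
    (volume : Measure (InfinitePlace K → ℝ))
  set c := Measure.addHaarScalarFactor (volume.map (placeCoord K))
    (volume : Measure (InfinitePlace K → ℝ))
  have hme : MeasurableEmbedding (placeCoord K) :=
    (placeCoord K).toHomeomorph.measurableEmbedding
  refine ⟨c, hc0, fun g hg => ⟨?_, ?_⟩⟩
  · have h1 := hme.integrable_map_iff (μ := volume) (g := g)
    rw [hc] at h1
    exact h1.1 (hg.smul_measure_nnreal)
  · have h1 := hme.integral_map (μ := volume) g
    rw [← h1, hc, integral_smul_nnreal_measure, NNReal.smul_def, Complex.real_smul]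

variable (K) in
/-- The product of the archimedean Euler factors. -/
noncomputable def archProd (s : ℂ) : ℂ := ∏ w : InfinitePlace K, archFactor (mult w) s

variable (K) in
theorem exists_integral_placeForm : ∃ c : ℝ, 0 < c ∧ ∀ s : ℂ, 0 < s.re →
    Integrable (fun p : ℝ × logSpace K => Complex.exp (Module.finrank ℚ K * s / 2 * p.1) *
      (Real.exp (-Real.pi * placeForm p.1 p.2) : ℂ)) ∧
    ∫ p : ℝ × logSpace K, Complex.exp (Module.finrank ℚ K * s / 2 * p.1) *
      (Real.exp (-Real.pi * placeForm p.1 p.2) : ℂ) = c * archProd K s := by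
  obtain ⟨c, hc, h⟩ := exists_integral_comp_placeCoord (K := K)
  refine ⟨c, hc, fun s hs => ?_⟩
  have hm : ∀ w : InfinitePlace K, mult w ≠ 0 := fun w => mult_ne_zero
  have h1 := h (fun y => ∏ w, (Complex.exp (mult w * s / 2 * y w) *
      (Real.exp (-Real.pi * (mult w * Real.exp (y w))) : ℂ)))
    (Integrable.fintype_prod fun w => integrable_archFactor (hm w) hs)
  have h2 : ∀ p : ℝ × logSpace K, ∏ w, (Complex.exp (mult w * s / 2 * placeCoord K p w) *
      (Real.exp (-Real.pi * (mult w * Real.exp (placeCoord K p w))) : ℂ)) =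
      Complex.exp (Module.finrank ℚ K * s / 2 * p.1) *
      (Real.exp (-Real.pi * placeForm p.1 p.2) : ℂ) := fun p => by
    rw [Finset.prod_mul_distrib, ← Complex.exp_sum, ← Complex.ofReal_prod, ← Real.exp_sum,
      ← Finset.mul_sum]
    congr 2
    have h3 : ∑ w : InfinitePlace K, (mult w : ℝ) * placeCoord K p w =
        Module.finrank ℚ K * p.1 := by
      simp only [placeCoord_apply, mul_add, Finset.sum_add_distrib, sum_mult_mul_logShift,
        ← Finset.sum_mul, sum_mult_real, add_zero]
    have h4 : ∑ w : InfinitePlace K, (mult w : ℂ) * (placeCoord K p w : ℂ) =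
        Module.finrank ℚ K * (p.1 : ℂ) := by exact_mod_cast h3
    have h5 : (Module.finrank ℚ K * s / 2 * p.1 : ℂ) = s / 2 * (Module.finrank ℚ K * (p.1 : ℂ)) := by
      ring
    rw [h5, ← h4, Finset.mul_sum]
    exact Finset.sum_congr rfl fun w _ => by ring
  simp only [h2] at h1
  refine ⟨h1.1, h1.2.trans ?_⟩
  rw [integral_fintype_prod_volume_eq_prod (fun w (t : ℝ) => Complex.exp (mult w * s / 2 * t) *
      (Real.exp (-Real.pi * (mult w * Real.exp t)) : ℂ)), archProd]
  congr 1
  exact Finset.prod_congr rfl fun w _ => integral_archFactor (hm w) hs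

theorem placeKernel_toReal (τ : ℝ) : (placeKernel K τ).toReal =
    ∫ ℓ : logSpace K, Real.exp (-Real.pi * placeForm (Real.log τ) ℓ) := by
  rw [placeKernel, integral_eq_lintegral_of_nonneg_ae]
  · exact ae_of_all _ fun _ => (Real.exp_pos _).le
  · have : Continuous fun ℓ : logSpace K => placeForm (Real.log τ) ℓ :=
      continuous_placeForm.comp (by fun_prop : Continuous fun ℓ : logSpace K => (Real.log τ, ℓ))
    exact (Real.continuous_exp.comp (continuous_const.mul this)).aestronglyMeasurable

variable (K) in
theorem exists_mellin_placeKernel : ∃ c : ℝ, 0 < c ∧ ∀ s : ℂ, 0 < s.re →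
    HasMellin (fun τ => ((placeKernel K τ).toReal : ℂ)) (Module.finrank ℚ K * s / 2)
      (c * archProd K s) := by
  obtain ⟨c, hc, h⟩ := exists_integral_placeForm K
  refine ⟨c, hc, fun s hs => ?_⟩
  obtain ⟨h1, h2⟩ := h s hs
  have h3 : ∀ t : ℝ, ∫ ℓ : logSpace K, Complex.exp (Module.finrank ℚ K * s / 2 * t) *
      (Real.exp (-Real.pi * placeForm t ℓ) : ℂ) =
      Complex.exp (Module.finrank ℚ K * s / 2 * t) * ((placeKernel K (Real.exp t)).toReal : ℂ) :=
    fun t => by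
    rw [integral_const_mul, placeKernel_toReal, Real.log_exp, ← integral_complex_ofReal]
  have h4 := h1.integral_prod_left
  simp only [h3] at h4
  rw [Measure.volume_eq_prod, integral_prod _ h1] at h2
  simp only [h3] at h2
  constructor
  · have := (integrableOn_Ioi_iff_exp fun τ : ℝ => (τ : ℂ) ^ (Module.finrank ℚ K * s / 2 - 1 : ℂ) *
      ((placeKernel K τ).toReal : ℂ))
    simp only [exp_smul_cpow_eq] at this
    exact this.2 h4
  · have := (integral_Ioi_eq_integral_exp fun τ : ℝ => (τ : ℂ) ^ (Module.finrank ℚ K * s / 2 - 1 : ℂ) *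
      ((placeKernel K τ).toReal : ℂ))
    simp only [exp_smul_cpow_eq] at this
    exact this.trans h2

end PlaceKernel

section MellinClassKernel

variable {K : Type*} [Field K] [NumberField K]

open InfinitePlace Units Units.dirichletUnitTheorem
open scoped nonZeroDivisors Classical ENNReal

instance countable_idealsInClass (I : (FractionalIdeal (𝓞 K)⁰ K)ˣ) : Countable (IdealsInClass I) := by
  obtain ⟨e, -⟩ := exists_equiv_option I
  exact Function.Injective.countable (f := fun J : IdealsInClass I => e (some (J, 1)))
    fun J J' h => by simpa using e.injective h

theorem hasSum_mellin_of_nonneg {ι : Type*} [Countable ι] {φ : ι → ℝ → ℝ} {f : ℝ → ℝ} {z : ℂ}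
    (hφ : ∀ i τ, 0 ≤ φ i τ) (hf : ∀ τ, 0 < τ → HasSum (fun i => φ i τ) (f τ))
    (hφm : ∀ i, MellinConvergent (fun τ => (φ i τ : ℂ)) z)
    (hfm : MellinConvergent (fun τ => (f τ : ℂ)) z) :
    HasSum (fun i => mellin (fun τ => (φ i τ : ℂ)) z) (mellin (fun τ => (f τ : ℂ)) z) := by
  have hnorm : ∀ i, ∀ τ : ℝ, ‖(τ : ℂ) ^ (z - 1) • (φ i τ : ℂ)‖ = ‖(τ : ℂ) ^ (z - 1)‖ * φ i τ :=
    fun i τ => by rw [norm_smul, Complex.norm_real, Real.norm_of_nonneg (hφ i τ)]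
  have h1 : Summable fun i => ∫ τ in Ioi (0 : ℝ), ‖(τ : ℂ) ^ (z - 1) • (φ i τ : ℂ)‖ := by
    refine summable_of_sum_le (c := ∫ τ in Ioi (0 : ℝ), ‖(τ : ℂ) ^ (z - 1) • (f τ : ℂ)‖)
      (fun i => integral_nonneg fun _ => norm_nonneg _) fun u => ?_
    rw [← integral_finsetSum _ fun i _ => (hφm i).norm]
    have h3 : ∀ τ ∈ Ioi (0 : ℝ), ∑ i ∈ u, ‖(τ : ℂ) ^ (z - 1) • (φ i τ : ℂ)‖ ≤
        ‖(τ : ℂ) ^ (z - 1) • (f τ : ℂ)‖ := fun τ hτ => by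
      simp only [hnorm, ← Finset.mul_sum]
      rw [norm_smul, Complex.norm_real]
      have h4 : ∑ i ∈ u, φ i τ ≤ f τ := sum_le_hasSum u (fun i _ => hφ i τ) (hf τ hτ)
      exact mul_le_mul_of_nonneg_left (h4.trans (Real.le_norm_self _)) (norm_nonneg _)
    exact setIntegral_mono_on (integrable_finsetSum _ fun i _ => (hφm i).norm) hfm.norm
      measurableSet_Ioi h3
  have h2 := hasSum_integral_of_summable_integral_norm (fun i => hφm i) h1
  have h3 : mellin (fun τ => (f τ : ℂ)) z =
      ∫ τ in Ioi (0 : ℝ), ∑' i, (τ : ℂ) ^ (z - 1) • (φ i τ : ℂ) := by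
    refine setIntegral_congr_fun measurableSet_Ioi fun τ hτ => ?_
    simp only
    rw [← (Complex.hasSum_ofReal.2 (hf τ hτ)).tsum_eq]
    exact (tsum_mul_left).symm
  rw [h3]
  exact h2

variable (K) in
theorem exists_hasSum_mellin_classKernel : ∃ c : ℝ, 0 < c ∧
    ∀ (I : (FractionalIdeal (𝓞 K)⁰ K)ˣ) (s : ℂ), 1 < s.re →
      HasSum (fun J : IdealsInClass I => (classNorm I J : ℂ) ^ (-s) * (c * archProd K s))
        (mellin (fun τ => ((classKernel I τ).toReal : ℂ)) (Module.finrank ℚ K * s / 2)) := by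
  obtain ⟨c, hc, h⟩ := exists_mellin_placeKernel K
  refine ⟨c, hc, fun I s hs => ?_⟩
  have hs0 : 0 < s.re := one_pos.trans hs
  have hn0 : (0 : ℝ) < Module.finrank ℚ K := by exact_mod_cast Module.finrank_pos
  have hconv : MellinConvergent (fun τ => ((classKernel I τ).toReal : ℂ))
      (Module.finrank ℚ K * s / 2) := by
    obtain ⟨P, I', hk, hf, -⟩ := exists_weakFEPair I
    have h1 := (P.hasMellin (s := Module.finrank ℚ K * s / 2) (by
      rw [hk, show (Module.finrank ℚ K * s / 2 : ℂ) = ((Module.finrank ℚ K / 2 : ℝ) : ℂ) * s by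
        push_cast; ring, Complex.re_ofReal_mul]
      exact lt_mul_of_one_lt_right (by positivity) hs)).1
    have hw : ((torsionOrder K : ℝ) : ℂ) ≠ 0 := by
      exact_mod_cast (torsionOrder_pos K).ne'
    have h2 : IntegrableOn _ (Ioi (0 : ℝ)) := h1.const_smul (((torsionOrder K : ℝ) : ℂ)⁻¹)
    refine h2.congr_fun (fun τ hτ => ?_) measurableSet_Ioi
    simp only [hf τ hτ]
    rw [Complex.ofReal_mul, _root_.smul_eq_mul, _root_.smul_eq_mul, _root_.smul_eq_mul,
      inv_mul_cancel_left₀ hw]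
  set a : IdealsInClass I → ℝ := fun J => classNorm I J ^ (2 / Module.finrank ℚ K : ℝ) with ha
  have ha0 : ∀ J, 0 < a J := fun J => Real.rpow_pos_of_pos (classNorm_pos I J) _
  have hpt : ∀ J τ, 0 < τ → placeKernel K (a J * τ) ≠ ⊤ := fun J τ hτ => by
    rw [mul_comm]
    exact ((ENNReal.le_tsum J).trans_lt (classKernel_lt_top I hτ)).ne
  have key := hasSum_mellin_of_nonneg (φ := fun J τ => (placeKernel K (a J * τ)).toReal)
    (f := fun τ => (classKernel I τ).toReal) (z := Module.finrank ℚ K * s / 2)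
    (fun J τ => ENNReal.toReal_nonneg) (fun τ hτ => by
      have h3 : classKernel I τ = ∑' J, placeKernel K (a J * τ) :=
        tsum_congr fun J => by rw [mul_comm]
      have h4 := classKernel_lt_top I hτ
      rw [h3] at h4 ⊢
      rw [ENNReal.tsum_toReal_eq fun J => hpt J τ hτ]
      exact (ENNReal.summable_toReal h4.ne).hasSum)
    (fun J => (MellinConvergent.comp_mul_left (f := fun τ => ((placeKernel K τ).toReal : ℂ))
      (ha0 J)).2 (h s hs0).1) hconv
  refine key.congr_fun fun J => ?_
  rw [mellin_comp_mul_left (fun τ => ((placeKernel K τ).toReal : ℂ)) _ (ha0 J), (h s hs0).2,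
    _root_.smul_eq_mul]
  congr 1
  have h5 : (classNorm I J : ℂ) ≠ 0 := by exact_mod_cast (classNorm_pos I J).ne'
  have h6 : ((a J : ℝ) : ℂ) ≠ 0 := by exact_mod_cast (ha0 J).ne'
  rw [Complex.cpow_def_of_ne_zero h5, Complex.cpow_def_of_ne_zero h6, ← Complex.ofReal_log
    (classNorm_pos I J).le, ← Complex.ofReal_log (ha0 J).le, ha,
    Real.log_rpow (classNorm_pos I J)]
  have hn1 : (Module.finrank ℚ K : ℂ) ≠ 0 := by exact_mod_cast hn0.ne'
  congr 1
  push_cast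
  field_simp

theorem archProd_ne_zero {s : ℂ} (hs : 0 < s.re) : archProd K s ≠ 0 :=
  Finset.prod_ne_zero_iff.2 fun _ _ => archFactor_ne_zero mult_ne_zero hs

variable (K) in
theorem exists_hasSum_classNorm : ∃ c : ℝ, 0 < c ∧ ∀ I : (FractionalIdeal (𝓞 K)⁰ K)ˣ,
    ∃ (P : WeakFEPair ℂ) (I' : (FractionalIdeal (𝓞 K)⁰ K)ˣ), P.k = Module.finrank ℚ K / 2 ∧
      (∀ s : ℂ, 1 < s.re → HasSum (fun J : IdealsInClass I => (classNorm I J : ℂ) ^ (-s))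
        ((archProd K s)⁻¹ * (c * P.Λ (Module.finrank ℚ K * s / 2)))) ∧
      (∀ s : ℂ, 1 < s.re → HasSum (fun J : IdealsInClass I' => (classNorm I' J : ℂ) ^ (-s))
        ((archProd K s)⁻¹ * (c * P.symm.Λ (Module.finrank ℚ K * s / 2)))) := by
  obtain ⟨c, hc, h⟩ := exists_hasSum_mellin_classKernel K
  have hw : (0 : ℝ) < torsionOrder K := by exact_mod_cast torsionOrder_pos K
  refine ⟨(c * torsionOrder K)⁻¹, by positivity, fun I => ?_⟩
  obtain ⟨P, I', hk, hf, hg⟩ := exists_weakFEPair I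
  have hn0 : (0 : ℝ) < Module.finrank ℚ K := by exact_mod_cast Module.finrank_pos
  have key : ∀ (Q : WeakFEPair ℂ) (I : (FractionalIdeal (𝓞 K)⁰ K)ˣ), Q.k = Module.finrank ℚ K / 2 →
      (∀ τ ∈ Ioi (0 : ℝ), Q.f τ - Q.f₀ = ((torsionOrder K * (classKernel I τ).toReal : ℝ) : ℂ)) →
      ∀ s : ℂ, 1 < s.re → HasSum (fun J : IdealsInClass I => (classNorm I J : ℂ) ^ (-s))
        ((archProd K s)⁻¹ * (((c * torsionOrder K)⁻¹ : ℝ) * Q.Λ (Module.finrank ℚ K * s / 2))) := by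
    intro Q I hk hf s hs
    have h1 := (Q.hasMellin (s := Module.finrank ℚ K * s / 2) (by
      rw [hk, show (Module.finrank ℚ K * s / 2 : ℂ) = ((Module.finrank ℚ K / 2 : ℝ) : ℂ) * s by
        push_cast; ring, Complex.re_ofReal_mul]
      exact lt_mul_of_one_lt_right (by positivity) hs)).2
    have h2 : mellin (fun τ => Q.f τ - Q.f₀) (Module.finrank ℚ K * s / 2) =
        mellin (fun τ => (torsionOrder K : ℂ) • ((classKernel I τ).toReal : ℂ))
          (Module.finrank ℚ K * s / 2) := by
      refine setIntegral_congr_fun measurableSet_Ioi fun τ hτ => ?_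
      simp only [hf τ hτ]
      push_cast
      rfl
    rw [← h1, h2, mellin_const_smul]
    have h3 := (h I s hs).mul_right (c * archProd K s)⁻¹
    have hc' : (c : ℂ) ≠ 0 := by exact_mod_cast hc.ne'
    have hw' : (torsionOrder K : ℂ) ≠ 0 := by exact_mod_cast hw.ne'
    have ha := archProd_ne_zero (K := K) (one_pos.trans hs)
    have h4 : mellin (fun τ => ((classKernel I τ).toReal : ℂ)) (Module.finrank ℚ K * s / 2) *
        (c * archProd K s)⁻¹ = (archProd K s)⁻¹ * (((c * torsionOrder K)⁻¹ : ℝ) *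
          ((torsionOrder K : ℂ) • mellin (fun τ => ((classKernel I τ).toReal : ℂ))
            (Module.finrank ℚ K * s / 2))) := by
      rw [_root_.smul_eq_mul]
      push_cast
      field_simp
    rw [← h4]
    refine h3.congr_fun fun J => ?_
    rw [mul_inv_cancel_right₀ (mul_ne_zero hc' ha)]
  exact ⟨P, I', hk, key P I hk hf, key P.symm I' hk hg⟩

end MellinClassKernel

section EntireClassZeta

theorem exists_norm_mellin_le {f : ℝ → ℂ} (hf : ∀ s : ℂ, MellinConvergent f s) (a b : ℝ) :
    ∃ C, 0 ≤ C ∧ ∀ s : ℂ, s.re ∈ Icc a b → ‖mellin f s‖ ≤ C := by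
  have hn : ∀ (s : ℂ) (τ : ℝ), τ ∈ Ioi (0 : ℝ) →
      ‖(τ : ℂ) ^ (s - 1) • f τ‖ = τ ^ (s.re - 1) * ‖f τ‖ := fun s τ hτ => by
    rw [norm_smul, Complex.norm_cpow_eq_rpow_re_of_pos hτ, Complex.sub_re, Complex.one_re]
  have hint : ∀ a : ℝ, IntegrableOn (fun τ : ℝ => τ ^ (a - 1) * ‖f τ‖) (Ioi 0) := fun a => by
    have h1 : IntegrableOn _ (Ioi (0 : ℝ)) := (hf a).norm
    refine h1.congr_fun (fun τ hτ => ?_) measurableSet_Ioi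
    simp only [hn _ τ hτ, Complex.ofReal_re]
  refine ⟨∫ τ in Ioi (0 : ℝ), (τ ^ (a - 1) * ‖f τ‖ + τ ^ (b - 1) * ‖f τ‖),
    setIntegral_nonneg measurableSet_Ioi fun τ (hτ : 0 < τ) => by positivity, fun s hs => ?_⟩
  refine (norm_integral_le_integral_norm _).trans
    (setIntegral_mono_on (hf s).norm ((hint a).add (hint b)) measurableSet_Ioi fun τ hτ => ?_)
  have hτ' : 0 < τ := hτ
  rw [hn _ τ hτ, ← add_mul]
  refine mul_le_mul_of_nonneg_right ?_ (norm_nonneg _)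
  rcases le_total 1 τ with h | h
  · exact (Real.rpow_le_rpow_of_exponent_le h (by linarith [hs.2])).trans
      (le_add_of_nonneg_left (by positivity))
  · exact (Real.rpow_le_rpow_of_exponent_ge hτ' h (by linarith [hs.1])).trans
      (le_add_of_nonneg_right (by positivity))

theorem differentiable_dslope {f : ℂ → ℂ} (hf : Differentiable ℂ f) (c : ℂ) :
    Differentiable ℂ (dslope f c) := by
  rw [← differentiableOn_univ] at hf ⊢
  exact (Complex.differentiableOn_dslope univ_mem).2 hf

variable {K : Type*} [Field K] [NumberField K]

open InfinitePlace
open scoped nonZeroDivisors Classical ENNReal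

theorem mult_eq_one_or_two {F : Type*} [Field F] (w : InfinitePlace F) : mult w = 1 ∨ mult w = 2 := by
  unfold mult; split_ifs <;> simp

theorem differentiable_archProd_inv : Differentiable ℂ fun s => (archProd K s)⁻¹ := by
  simp only [archProd, ← Finset.prod_inv_distrib]
  exact Differentiable.fun_finsetProd fun w _ => differentiable_archFactor_inv mult_ne_zero

theorem archProd_zero : archProd K 0 = 0 := by
  obtain ⟨w⟩ := (inferInstance : Nonempty (InfinitePlace K))
  exact Finset.prod_eq_zero (Finset.mem_univ w) (archFactor_zero _)

variable (K) in
theorem exists_norm_archProd_inv_le : ∃ C > 0, ∀ s : ℂ, s.re ∈ Icc (-1 : ℝ) 2 → 2 ≤ |s.im| →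
    ‖(archProd K s)⁻¹‖ ≤ C * Real.exp (C * |s.im|) := by
  choose C hC h using fun w : InfinitePlace K => exists_norm_archFactor_inv_le (mult_eq_one_or_two w)
  set m : ℝ := ((Fintype.card (InfinitePlace K) : ℕ) : ℝ) with hm
  have hm0 : 0 ≤ m := by positivity
  refine ⟨∏ w, C w + m * Real.pi, add_pos_of_pos_of_nonneg (Finset.prod_pos fun w _ => hC w)
    (by positivity), fun s hs hs' => ?_⟩
  have hp : 0 < ∏ w, C w := Finset.prod_pos fun w _ => hC w
  rw [archProd, ← Finset.prod_inv_distrib, norm_prod]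
  refine (Finset.prod_le_prod (fun w _ => norm_nonneg _) fun w _ => h w s hs hs').trans ?_
  rw [Finset.prod_mul_distrib, Finset.prod_const, ← Real.exp_nat_mul, Finset.card_univ, ← mul_assoc]
  refine mul_le_mul (le_add_of_nonneg_right (by positivity)) (Real.exp_le_exp.2 ?_)
    (Real.exp_pos _).le (by positivity)
  exact mul_le_mul_of_nonneg_right (le_add_of_nonneg_left hp.le) (abs_nonneg _)

variable (K) in
theorem exists_norm_archProd_ratio_le {δ : ℝ} (hδ : 0 < δ) (hδ' : δ < 1) :
    ∃ C > 0, ∀ t : ℝ, ‖(archProd K ((-δ : ℝ) + t * Complex.I))⁻¹ *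
      archProd K (1 - ((-δ : ℝ) + t * Complex.I))‖ ≤
        C * (1 + |t|) ^ (Module.finrank ℚ K * (1 / 2 + δ)) := by
  choose C hC h using fun w : InfinitePlace K =>
    exists_norm_archFactor_ratio_le (mult_eq_one_or_two w) hδ hδ'
  refine ⟨∏ w, C w, Finset.prod_pos fun w _ => hC w, fun t => ?_⟩
  rw [archProd, archProd, ← Finset.prod_inv_distrib, ← Finset.prod_mul_distrib, norm_prod]
  refine (Finset.prod_le_prod (fun w _ => norm_nonneg _) fun w _ => h w t).trans_eq ?_
  rw [Finset.prod_mul_distrib, ← Real.rpow_sum_of_pos (by positivity), ← Finset.sum_mul,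
    sum_mult_real]

variable (K) in
theorem exists_entire_classNorm (I : (FractionalIdeal (𝓞 K)⁰ K)ˣ) {δ : ℝ} (hδ : 0 < δ)
    (hδ' : δ < 1) : ∃ H : ℂ → ℂ, Differentiable ℂ H ∧
      (∀ s : ℂ, 1 < s.re → HasSum (fun J : IdealsInClass I => (classNorm I J : ℂ) ^ (-s))
        (H s / (s - 1))) ∧
      (∃ C, 0 ≤ C ∧ ∀ s : ℂ, s.re ∈ Icc (-δ) 2 → 2 ≤ |s.im| → ‖H s‖ ≤ C * Real.exp (C * |s.im|)) ∧
      ∃ C, 0 ≤ C ∧ ∀ t : ℝ, ‖H ((-δ : ℝ) + t * Complex.I)‖ ≤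
        C * (1 + |t|) ^ (Module.finrank ℚ K * (1 / 2 + δ)) *
          ‖((-δ : ℝ) + t * Complex.I : ℂ) - 1‖ := by
  obtain ⟨c, hc, h⟩ := exists_hasSum_classNorm K
  obtain ⟨P, I', hk, h1, h2⟩ := h I
  set n : ℂ := ((Module.finrank ℚ K : ℕ) : ℂ) with hn
  have hn0 : n ≠ 0 := by
    rw [hn]
    exact_mod_cast (Module.finrank_pos (R := ℚ) (M := K)).ne'
  set B : ℂ → ℂ := fun s => (archProd K s)⁻¹ with hB
  have hBd : Differentiable ℂ B := differentiable_archProd_inv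
  have hB0 : B 0 = 0 := by simp [hB, archProd_zero]
  have hkn : (P.k : ℂ) = n / 2 := by rw [hk, hn]; push_cast; rfl
  set H : ℂ → ℂ := fun s => c * (B s * ((s - 1) * P.Λ₀ (n * s / 2) + 2 / n * P.ε * P.g₀) -
    2 / n * P.f₀ * (s - 1) * dslope B 0 s) with hH
  have hslope : ∀ s : ℂ, s ≠ 0 → dslope B 0 s = B s / s := fun s hs => by
    rw [dslope_of_ne _ hs, slope_def_field, hB0, sub_zero, sub_zero]
  have hHZ : ∀ s : ℂ, s ≠ 0 → s ≠ 1 → H s = (s - 1) * (B s * (c * P.Λ (n * s / 2))) := by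
    intro s hs hs'
    have hs1 : s - 1 ≠ 0 := sub_ne_zero.2 hs'
    have hs2 : (P.k : ℂ) - n * s / 2 = -(n / 2 * (s - 1)) := by rw [hkn]; ring
    rw [hH, WeakFEPair.Λ, hs2]
    simp only [smul_eq_mul]
    rw [hslope s hs]
    field_simp
    ring
  refine ⟨H, ?_, fun s hs => ?_, ?_, ?_⟩
  · have h3 : Differentiable ℂ fun s : ℂ => P.Λ₀ (n * s / 2) :=
      P.differentiable_Λ₀.comp (f := fun s : ℂ => n * s / 2) (by fun_prop)
    have h4 := differentiable_dslope hBd 0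
    fun_prop
  · have hs0 : s ≠ 0 := fun h => by rw [h, Complex.zero_re] at hs; linarith
    have hs1 : s ≠ 1 := fun h => by rw [h, Complex.one_re] at hs; linarith
    rw [hHZ s hs0 hs1, mul_div_cancel_left₀ _ (sub_ne_zero.2 hs1)]
    exact h1 s hs
  · obtain ⟨C₁, hC₁, hb⟩ := exists_norm_archProd_inv_le K
    obtain ⟨C₂, hC₂, hm⟩ := exists_norm_mellin_le (f := P.f_modif) (fun s =>
      (P.isStrongFEPair_toStrongFEPair.hasMellin s).1) (Module.finrank ℚ K * (-δ) / 2)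
      (Module.finrank ℚ K * 2 / 2)
    have hn1 : (0 : ℝ) < Module.finrank ℚ K := by exact_mod_cast Module.finrank_pos
    set M : ℝ := c * C₁ * (C₂ + ‖2 / n * P.ε * P.g₀‖ + ‖2 / n * P.f₀‖) with hM
    refine ⟨max (3 * M) (C₁ + 1), by positivity, fun s hs hs' => ?_⟩
    have hs0 : s ≠ 0 := fun h => by simp [h] at hs'; linarith
    have him : |s.im| ≤ ‖s‖ := Complex.abs_im_le_norm s
    have hnorm : ‖s - 1‖ ≤ 3 * Real.exp |s.im| := by
      have h3 := Complex.norm_le_abs_re_add_abs_im (s - 1)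
      have h4 : |(s - 1).re| ≤ 2 := by
        rw [Complex.sub_re, Complex.one_re, abs_le]
        constructor <;> linarith [hs.1, hs.2]
      have h5 : |(s - 1).im| = |s.im| := by simp
      have h6 := Real.add_one_le_exp |s.im|
      linarith [abs_nonneg s.im]
    have h3 : ‖P.Λ₀ (n * s / 2)‖ ≤ C₂ := by
      refine hm _ ?_
      have : (n * s / 2).re = Module.finrank ℚ K * s.re / 2 := by
        rw [hn, show (Module.finrank ℚ K * s / 2 : ℂ) = ((Module.finrank ℚ K / 2 : ℝ) : ℂ) * s by
          push_cast; ring, Complex.re_ofReal_mul]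
        ring
      rw [this]
      constructor
      · have := mul_le_mul_of_nonneg_left hs.1 hn1.le; linarith
      · have := mul_le_mul_of_nonneg_left hs.2 hn1.le; linarith
    have h4 := hb s ⟨by linarith [hs.1], hs.2⟩ hs'
    have hE : 1 ≤ 3 * Real.exp |s.im| := by
      have := Real.add_one_le_exp |s.im|
      linarith [abs_nonneg s.im]
    have h5 : ‖dslope B 0 s‖ ≤ ‖B s‖ := by
      rw [hslope s hs0, norm_div]
      exact div_le_self (norm_nonneg _) (by linarith)
    have h6 : ‖H s‖ ≤ c * (‖B s‖ * (‖s - 1‖ * C₂ + ‖2 / n * P.ε * P.g₀‖) +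
        ‖2 / n * P.f₀‖ * ‖s - 1‖ * ‖B s‖) := by
      simp only [hH]
      rw [norm_mul (c : ℂ), Complex.norm_real, Real.norm_of_nonneg hc.le]
      refine mul_le_mul_of_nonneg_left ((norm_sub_le _ _).trans (add_le_add ?_ ?_)) hc.le
      · rw [norm_mul]
        refine mul_le_mul_of_nonneg_left ((norm_add_le _ _).trans (add_le_add_left ?_ _))
          (norm_nonneg _)
        rw [norm_mul]
        exact mul_le_mul_of_nonneg_left h3 (norm_nonneg _)
      · rw [norm_mul, norm_mul _ (s - 1)]
        exact mul_le_mul_of_nonneg_left h5 (by positivity)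
    set E := Real.exp |s.im| with hEd
    have hEp : 0 < E := Real.exp_pos _
    calc ‖H s‖ ≤ _ := h6
      _ ≤ c * ((C₁ * Real.exp (C₁ * |s.im|)) * ((3 * E) * C₂ + ‖2 / n * P.ε * P.g₀‖ * (3 * E)) +
        ‖2 / n * P.f₀‖ * (3 * E) * (C₁ * Real.exp (C₁ * |s.im|))) := by
          have := le_mul_of_one_le_right (norm_nonneg (2 / n * P.ε * P.g₀)) hE
          gcongr
      _ = 3 * M * Real.exp ((C₁ + 1) * |s.im|) := by
          rw [add_mul, one_mul, Real.exp_add, hM]; ring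
      _ ≤ _ := by
          gcongr
          · exact le_max_left _ _
          · exact le_max_right _ _
  · obtain ⟨C₁, hC₁, hb⟩ := exists_norm_archProd_ratio_le K hδ hδ'
    have hsum : Summable fun J : IdealsInClass I' => classNorm I' J ^ (-(1 + δ)) := by
      have h3 := (h2 ((1 + δ : ℝ) : ℂ) (by rw [Complex.ofReal_re]; linarith)).summable.norm
      refine h3.congr fun J => ?_
      rw [Complex.norm_cpow_eq_rpow_re_of_pos (classNorm_pos I' J), Complex.neg_re,
        Complex.ofReal_re]
    refine ⟨‖P.ε‖ * C₁ * ∑' J : IdealsInClass I', classNorm I' J ^ (-(1 + δ)),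
      mul_nonneg (by positivity) (tsum_nonneg fun J => Real.rpow_nonneg (classNorm_pos I' J).le _),
      fun t => ?_⟩
    set s : ℂ := (-δ : ℝ) + t * Complex.I with hs
    have hre : s.re = -δ := by simp [hs]
    have hs0 : s ≠ 0 := fun h => by rw [h, Complex.zero_re] at hre; linarith
    have hs1 : s ≠ 1 := fun h => by rw [h, Complex.one_re] at hre; linarith
    have hre' : (1 - s).re = 1 + δ := by rw [Complex.sub_re, hre, Complex.one_re]; ring
    have h3 := h2 (1 - s) (by rw [hre']; linarith)
    have h4 : ‖(archProd K (1 - s))⁻¹ * (c * P.symm.Λ (n * (1 - s) / 2))‖ ≤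
        ∑' J : IdealsInClass I', classNorm I' J ^ (-(1 + δ)) := by
      rw [← h3.tsum_eq]
      refine tsum_of_norm_bounded hsum.hasSum fun J => ?_
      rw [Complex.norm_cpow_eq_rpow_re_of_pos (classNorm_pos I' J), Complex.neg_re, hre']
    have h5 : P.Λ (n * s / 2) = P.ε * P.symm.Λ (n * (1 - s) / 2) := by
      rw [← smul_eq_mul P.ε, ← P.functional_equation, hkn]
      congr 1; ring
    have ha : archProd K (1 - s) ≠ 0 := archProd_ne_zero (by rw [hre']; linarith)
    have h6 : H s = P.ε * ((archProd K s)⁻¹ * archProd K (1 - s)) *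
        ((archProd K (1 - s))⁻¹ * (c * P.symm.Λ (n * (1 - s) / 2))) * (s - 1) := by
      rw [hHZ s hs0 hs1, h5, hB]
      field_simp
    rw [h6, norm_mul, norm_mul, norm_mul]
    have h7 := hb t
    calc _ ≤ ‖P.ε‖ * (C₁ * (1 + |t|) ^ (Module.finrank ℚ K * (1 / 2 + δ))) *
          (∑' J : IdealsInClass I', classNorm I' J ^ (-(1 + δ))) * ‖s - 1‖ := by
            gcongr
      _ = _ := by ring

end EntireClassZeta

section EntireDedekindZeta

variable {K : Type*} [Field K] [NumberField K]

open scoped nonZeroDivisors Classical ENNReal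

theorem mem_idealsInClass_iff {J : Ideal (𝓞 K)} (hJ : J ≠ 0) (I : (FractionalIdeal (𝓞 K)⁰ K)ˣ) :
    (∃ α : K, FractionalIdeal.spanSingleton (𝓞 K)⁰ α = (J : FractionalIdeal (𝓞 K)⁰ K) * I) ↔
      ClassGroup.mk0 ⟨J, mem_nonZeroDivisors_iff_ne_zero.2 hJ⟩ * ClassGroup.mk K I = 1 := by
  rw [← ClassGroup.mk_mk0 K, ← map_mul, ClassGroup.mk_eq_one_iff, FractionalIdeal.isPrincipal_iff,
    Units.val_mul, FractionalIdeal.coe_mk0]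
  exact exists_congr fun _ => eq_comm

variable (K) in
theorem exists_sigma_idealsInClass : ∃ (I : ClassGroup (𝓞 K) → (FractionalIdeal (𝓞 K)⁰ K)ˣ)
    (e : (Σ c, IdealsInClass (I c)) ≃ {J : Ideal (𝓞 K) // J ≠ 0}), ∀ p, (e p).1 = p.2.1 := by
  have h : ∀ c : ClassGroup (𝓞 K), ∃ I : (FractionalIdeal (𝓞 K)⁰ K)ˣ, ClassGroup.mk K I = c⁻¹ :=
    fun c => by
      obtain ⟨J, hJ⟩ := ClassGroup.mk0_surjective c⁻¹
      exact ⟨FractionalIdeal.mk0 K J, by rw [ClassGroup.mk_mk0, hJ]⟩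
  choose I hI using h
  refine ⟨I, Equiv.ofBijective (fun p => ⟨p.2.1, p.2.2.1⟩) ⟨?_, ?_⟩, fun p => rfl⟩
  · rintro ⟨c, J, hJ, hJc⟩ ⟨c', J', hJ', hJc'⟩ h
    have h1 : J = J' := congrArg Subtype.val h
    subst h1
    have h2 := (mem_idealsInClass_iff hJ _).1 hJc
    have h3 := (mem_idealsInClass_iff hJ _).1 hJc'
    rw [hI, mul_inv_eq_one] at h2 h3
    have h4 : c = c' := h2.symm.trans h3
    subst h4
    rfl
  · rintro ⟨J, hJ⟩
    refine ⟨⟨ClassGroup.mk0 ⟨J, mem_nonZeroDivisors_iff_ne_zero.2 hJ⟩, J, hJ, ?_⟩, rfl⟩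
    rw [mem_idealsInClass_iff hJ, hI, mul_inv_cancel]

theorem hasSum_rK {s a : ℂ} (hs : s ≠ 0)
    (h : HasSum (fun J : {J : Ideal (𝓞 K) // J ≠ 0} => (Ideal.absNorm J.1 : ℂ) ^ (-s)) a) :
    HasSum (fun m : ℕ => (rK K m : ℂ) * (m : ℂ) ^ (-s)) a := by
  set e := Equiv.sigmaFiberEquiv fun J : {J : Ideal (𝓞 K) // J ≠ 0} => Ideal.absNorm J.1
  refine HasSum.sigma (e.hasSum_iff.2 h) fun m => ?_
  have hfin : Finite {J : {J : Ideal (𝓞 K) // J ≠ 0} // Ideal.absNorm J.1 = m} := by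
    have := (Ideal.finite_setOfPred_absNorm_eq (S := 𝓞 K) m).to_subtype
    exact Finite.of_injective (β := {I : Ideal (𝓞 K) | Ideal.absNorm I = m})
      (fun J => ⟨J.1.1, J.2⟩) fun J J' h =>
        Subtype.ext (Subtype.ext (Subtype.mk.inj h))
  have := Fintype.ofFinite {J : {J : Ideal (𝓞 K) // J ≠ 0} // Ideal.absNorm J.1 = m}
  have h1 : ∀ J : {J : {J : Ideal (𝓞 K) // J ≠ 0} // Ideal.absNorm J.1 = m},
      ((fun J : {J : Ideal (𝓞 K) // J ≠ 0} => (Ideal.absNorm J.1 : ℂ) ^ (-s)) ∘ e) ⟨m, J⟩ =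
        (m : ℂ) ^ (-s) := fun J => by
    have : e ⟨m, J⟩ = J.1 := rfl
    simp only [Function.comp_apply, this, J.2]
  simp only [h1]
  convert hasSum_fintype _ using 1
  rw [Finset.sum_const, nsmul_eq_mul, Finset.card_univ, ← Nat.card_eq_fintype_card]
  rcases eq_or_ne m 0 with rfl | hm
  · rw [Nat.cast_zero, Complex.zero_cpow (neg_ne_zero.2 hs), mul_zero, mul_zero]
  · congr 2
    refine Nat.card_congr ⟨fun J => ⟨⟨J.1, fun h => hm ?_⟩, J.2⟩, fun J => ⟨J.1.1, J.2⟩,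
      fun _ => rfl, fun _ => rfl⟩
    rw [← J.2, h, Ideal.zero_eq_bot, Ideal.absNorm_bot]

variable (K) in
theorem exists_entire_dedekind {δ : ℝ} (hδ : 0 < δ) (hδ' : δ < 1) :
    ∃ H : ℂ → ℂ, Differentiable ℂ H ∧
      (∀ s : ℂ, 1 < s.re → HasSum (fun m : ℕ => (rK K m : ℂ) * (m : ℂ) ^ (-s)) (H s / (s - 1))) ∧
      (∃ C, 0 ≤ C ∧ ∀ s : ℂ, s.re ∈ Icc (-δ) 2 → 2 ≤ |s.im| → ‖H s‖ ≤ C * Real.exp (C * |s.im|)) ∧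
      ∃ C, 0 ≤ C ∧ ∀ t : ℝ, ‖H ((-δ : ℝ) + t * Complex.I)‖ ≤
        C * (1 + |t|) ^ (Module.finrank ℚ K * (1 / 2 + δ)) *
          ‖((-δ : ℝ) + t * Complex.I : ℂ) - 1‖ := by
  obtain ⟨I, e, he⟩ := exists_sigma_idealsInClass K
  have hex := fun c => exists_entire_classNorm K (I c) hδ hδ'
  choose H hH hsum hg hl using hex
  choose C₁ hC₁ hg using hg
  choose C₂ hC₂ hl using hl
  set q : ClassGroup (𝓞 K) → ℝ := fun c =>
    (FractionalIdeal.absNorm (I c : FractionalIdeal (𝓞 K)⁰ K) : ℝ) with hq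
  have hq0 : ∀ c, 0 < q c := fun c => absNorm_units_pos (I c)
  have hqc : ∀ c, (q c : ℂ) ≠ 0 := fun c => by exact_mod_cast (hq0 c).ne'
  have hterm : ∀ c (J : IdealsInClass (I c)) (s : ℂ), (Ideal.absNorm J.1 : ℂ) ^ (-s) =
      (q c : ℂ) ^ s * (classNorm (I c) J : ℂ) ^ (-s) := fun c J s => by
    rw [classNorm, Complex.ofReal_mul, Complex.mul_cpow_ofReal_nonneg (Nat.cast_nonneg _) (hq0 c).le,
      Complex.cpow_neg (q c : ℂ), mul_left_comm, mul_inv_cancel₀, mul_one, Complex.ofReal_natCast]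
    rw [Ne, Complex.cpow_eq_zero_iff]
    exact fun h => hqc c h.1
  set Q : ClassGroup (𝓞 K) → ℝ := fun c => q c ^ (-δ) + q c ^ (2 : ℝ) with hQ
  have hQ0 : ∀ c, 0 ≤ Q c := fun c => add_nonneg (Real.rpow_nonneg (hq0 c).le _)
    (Real.rpow_nonneg (hq0 c).le _)
  have hqQ : ∀ c (s : ℂ), s.re ∈ Icc (-δ) 2 → ‖(q c : ℂ) ^ s‖ ≤ Q c := fun c s hs => by
    rw [Complex.norm_cpow_eq_rpow_re_of_pos (hq0 c)]
    rcases le_total 1 (q c) with h | h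
    · exact (Real.rpow_le_rpow_of_exponent_le h hs.2).trans
        (le_add_of_nonneg_left (Real.rpow_nonneg (hq0 c).le _))
    · exact (Real.rpow_le_rpow_of_exponent_ge (hq0 c) h hs.1).trans
        (le_add_of_nonneg_right (Real.rpow_nonneg (hq0 c).le _))
  refine ⟨fun s => ∑ c, (q c : ℂ) ^ s * H c s, ?_, fun s hs => ?_, ?_, ?_⟩
  · refine Differentiable.fun_sum fun c _ => Differentiable.mul (fun s => ?_) (hH c)
    exact DifferentiableAt.const_cpow differentiableAt_id (.inl (hqc c))
  · have hs0 : s ≠ 0 := fun h => by rw [h, Complex.zero_re] at hs; linarith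
    refine hasSum_rK hs0 (e.hasSum_iff.1 ?_)
    have h1 : ∀ c, HasSum (fun J : IdealsInClass (I c) => (Ideal.absNorm J.1 : ℂ) ^ (-s))
        ((q c : ℂ) ^ s * (H c s / (s - 1))) := fun c =>
      ((hsum c s hs).mul_left ((q c : ℂ) ^ s)).congr_fun fun J => hterm c J s
    have h2 : ∑ c, (q c : ℂ) ^ s * (H c s / (s - 1)) = (∑ c, (q c : ℂ) ^ s * H c s) / (s - 1) := by
      rw [Finset.sum_div]
      exact Finset.sum_congr rfl fun c _ => (mul_div_assoc _ _ _).symm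
    rw [← h2]
    have h3 : ∀ p : Σ c, IdealsInClass (I c),
        ((fun J : {J : Ideal (𝓞 K) // J ≠ 0} => (Ideal.absNorm J.1 : ℂ) ^ (-s)) ∘ e) p =
          (Ideal.absNorm p.2.1 : ℂ) ^ (-s) := fun p => by
      simp only [Function.comp_apply, he]
    refine HasSum.sigma_of_hasSum (hasSum_fintype _) (fun c => ?_) ?_
    · simp only [h3]
      exact h1 c
    · refine Summable.of_norm ((summable_sigma_of_nonneg fun _ => norm_nonneg _).2
        ⟨fun c => ?_, (hasSum_fintype _).summable⟩)
      simp only [h3]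
      exact (h1 c).summable.norm
  · refine ⟨∑ c, Q c * C₁ c + ∑ c, C₁ c, add_nonneg (Finset.sum_nonneg fun c _ =>
      mul_nonneg (hQ0 c) (hC₁ c)) (Finset.sum_nonneg fun c _ => hC₁ c), fun s hs hs' => ?_⟩
    have hS : 0 ≤ ∑ c, C₁ c := Finset.sum_nonneg fun c _ => hC₁ c
    have hS' : 0 ≤ ∑ c, Q c * C₁ c := Finset.sum_nonneg fun c _ => mul_nonneg (hQ0 c) (hC₁ c)
    have hle : ∀ c, C₁ c ≤ ∑ c, Q c * C₁ c + ∑ c, C₁ c := fun c =>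
      (Finset.single_le_sum (fun c _ => hC₁ c) (Finset.mem_univ c)).trans
        (le_add_of_nonneg_left hS')
    calc _ ≤ ∑ c, ‖(q c : ℂ) ^ s * H c s‖ := norm_sum_le _ _
      _ ≤ ∑ c, Q c * C₁ c * Real.exp ((∑ c, Q c * C₁ c + ∑ c, C₁ c) * |s.im|) := by
        refine Finset.sum_le_sum fun c _ => ?_
        rw [norm_mul, mul_assoc]
        refine mul_le_mul (hqQ c s hs) ((hg c s hs hs').trans ?_) (norm_nonneg _) (hQ0 c)
        exact mul_le_mul_of_nonneg_left (Real.exp_le_exp.2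
          (mul_le_mul_of_nonneg_right (hle c) (abs_nonneg _))) (hC₁ c)
      _ ≤ _ := by
        rw [← Finset.sum_mul]
        exact mul_le_mul_of_nonneg_right (le_add_of_nonneg_right hS) (Real.exp_pos _).le
  · refine ⟨∑ c, Q c * C₂ c, Finset.sum_nonneg fun c _ => mul_nonneg (hQ0 c) (hC₂ c), fun t => ?_⟩
    refine (norm_sum_le _ _).trans ?_
    rw [Finset.sum_mul, Finset.sum_mul]
    refine Finset.sum_le_sum fun c _ => ?_
    rw [norm_mul, mul_assoc, mul_assoc, ← mul_assoc (C₂ c)]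
    refine mul_le_mul (hqQ c _ ?_) (hl c t) (norm_nonneg _) (hQ0 c)
    have : ((-δ : ℝ) + t * Complex.I : ℂ).re = -δ := by simp
    rw [this]
    exact ⟨le_rfl, by linarith⟩

end EntireDedekindZeta

/-- The Gaussian probability density of variance `2 / T ^ 2`. -/
noncomputable def gaussKernel (T v : ℝ) : ℝ :=
  T / (2 * √Real.pi) * Real.exp (-(T ^ 2 / 4) * v ^ 2)

/-- The positive part `max v 0` smoothed by `gaussKernel T`. -/
noncomputable def gaussRamp (T v : ℝ) : ℝ := ∫ p, max (v - p) 0 * gaussKernel T p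

section gaussKernel
variable {T : ℝ}

lemma gaussKernel_nonneg (hT : 0 < T) (v : ℝ) : 0 ≤ gaussKernel T v := by
  unfold gaussKernel; positivity

lemma gaussKernel_neg (v : ℝ) : gaussKernel T (-v) = gaussKernel T v := by
  unfold gaussKernel; simp

lemma continuous_gaussKernel : Continuous (gaussKernel T) := by
  unfold gaussKernel; fun_prop

lemma integrable_gaussKernel (hT : 0 < T) : Integrable (gaussKernel T) := by
  unfold gaussKernel
  exact (integrable_exp_neg_mul_sq (by positivity)).const_mul _

lemma integral_gaussKernel (hT : 0 < T) : ∫ v, gaussKernel T v = 1 := by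
  unfold gaussKernel
  rw [integral_const_mul, integral_gaussian]
  have : √(Real.pi / (T ^ 2 / 4)) = 2 * √Real.pi / T := by
    rw [Real.sqrt_eq_iff_mul_self_eq (by positivity) (by positivity)]
    field_simp
    rw [Real.sq_sqrt Real.pi_pos.le]
    ring
  rw [this]
  have : 0 < √Real.pi := by positivity
  field_simp

lemma integrable_mul_gaussKernel (hT : 0 < T) : Integrable fun v => v * gaussKernel T v := by
  unfold gaussKernel
  convert (integrable_mul_exp_neg_mul_sq (b := T ^ 2 / 4) (by positivity)).const_mul
    (T / (2 * √Real.pi)) using 2 with v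
  ring

lemma integral_mul_gaussKernel : ∫ v, v * gaussKernel T v = 0 := by
  have h := integral_neg_eq_self (fun v => v * gaussKernel T v) volume
  simp only [gaussKernel_neg, neg_mul, integral_neg] at h
  linarith

lemma integrable_max_mul_gaussKernel (hT : 0 < T) (v : ℝ) :
    Integrable fun p => max (v - p) 0 * gaussKernel T p := by
  refine (((integrable_gaussKernel hT).const_mul |v|).add
    (integrable_mul_gaussKernel hT).norm).mono'
    (by have := continuous_gaussKernel (T := T); fun_prop) (Eventually.of_forall fun p => ?_)
  have h0 := gaussKernel_nonneg hT p
  simp only [Pi.add_apply, norm_mul, Real.norm_eq_abs, abs_of_nonneg h0]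
  rw [← add_mul]
  gcongr
  rw [abs_le]
  constructor <;> [have := le_max_right (v - p) 0; skip]
  · have := abs_nonneg v; have := abs_nonneg p; linarith
  · apply max_le
    · linarith [le_abs_self v, neg_abs_le p]
    · positivity

lemma gaussRamp_nonneg (hT : 0 < T) (v : ℝ) : 0 ≤ gaussRamp T v :=
  integral_nonneg fun p => mul_nonneg (le_max_right _ _) (gaussKernel_nonneg hT p)

lemma gaussRamp_sub_neg (hT : 0 < T) (v : ℝ) : gaussRamp T v = v + gaussRamp T (-v) := by
  have h1 : gaussRamp T (-v) = ∫ p, max (-v + p) 0 * gaussKernel T p := by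
    unfold gaussRamp
    rw [← integral_neg_eq_self]
    simp [gaussKernel_neg]
  have h1' : Integrable fun p => max (-v + p) 0 * gaussKernel T p := by
    convert (integrable_max_mul_gaussKernel hT (-v)).comp_neg using 2 with p
    simp [gaussKernel_neg]
  have h2 : ∫ p, (v - p) * gaussKernel T p = v := by
    simp only [sub_mul]
    rw [integral_sub ((integrable_gaussKernel hT).const_mul v) (integrable_mul_gaussKernel hT),
      integral_const_mul, integral_gaussKernel hT, integral_mul_gaussKernel]
    simp
  have h3 : Integrable fun p => (v - p) * gaussKernel T p := by
    simp only [sub_mul]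
    exact ((integrable_gaussKernel hT).const_mul v).sub (integrable_mul_gaussKernel hT)
  rw [h1]
  nth_rewrite 2 [← h2]
  rw [← integral_add h3 h1']
  unfold gaussRamp
  congr 1 with p
  rw [← add_mul]
  congr 1
  rcases le_total v p with h | h
  · rw [max_eq_right (by linarith), max_eq_left (by linarith)]; ring
  · rw [max_eq_left (by linarith), max_eq_right (by linarith)]; ring

lemma max_le_gaussRamp (hT : 0 < T) (v : ℝ) : max v 0 ≤ gaussRamp T v := by
  apply max_le _ (gaussRamp_nonneg hT v)
  rw [gaussRamp_sub_neg hT]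
  linarith [gaussRamp_nonneg hT (-v)]

lemma integral_max_mul_gaussKernel (hT : 0 < T) :
    ∫ p, max p 0 * gaussKernel T p = T⁻¹ * (√Real.pi)⁻¹ := by
  have h : ∀ p, max p 0 * gaussKernel T p =
      (Ioi (0 : ℝ)).indicator (fun p => p * gaussKernel T p) p := by
    intro p
    by_cases hp : 0 < p
    · simp [hp, hp.le]
    · simp [hp, not_lt.1 hp]
  simp_rw [h]
  rw [integral_indicator measurableSet_Ioi]
  unfold gaussKernel
  have := integral_mul_cexp_neg_mul_sq (b := ((T ^ 2 / 4 : ℝ) : ℂ))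
    (by rw [Complex.ofReal_re]; positivity)
  have h2 : ∫ r in Ioi (0 : ℝ), r * Real.exp (-(T ^ 2 / 4) * r ^ 2) = (2 * (T ^ 2 / 4))⁻¹ := by
    rw [← Complex.ofReal_inj, ← integral_complex_ofReal]
    push_cast at this ⊢
    exact this
  have h3 : ∀ p : ℝ, p * (T / (2 * √Real.pi) * Real.exp (-(T ^ 2 / 4) * p ^ 2)) =
    T / (2 * √Real.pi) * (p * Real.exp (-(T ^ 2 / 4) * p ^ 2)) := fun p => by ring
  simp_rw [h3]
  rw [integral_const_mul, h2]
  have : 0 < √Real.pi := by positivity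
  field_simp
  ring

lemma gaussRamp_neg_le (hT : 0 < T) {v : ℝ} (hv : 0 ≤ v) :
    gaussRamp T (-v) ≤ 2 / T ^ 2 * gaussKernel T v := by
  have h1 : gaussRamp T (-v) = ∫ r, max r 0 * gaussKernel T (r + v) := by
    unfold gaussRamp
    rw [← integral_sub_left_eq_self _ _ (-v)]
    congr 1 with r
    rw [← gaussKernel_neg (r + v)]
    ring_nf
  have h2 : ∫ r, max r 0 * gaussKernel T (r + v) ≤
      ∫ r, Real.exp (-(T ^ 2 / 4) * v ^ 2) * (max r 0 * gaussKernel T r) := by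
    apply integral_mono_of_nonneg
    · exact Eventually.of_forall fun r => mul_nonneg (le_max_right _ _) (gaussKernel_nonneg hT _)
    · have := (integrable_max_mul_gaussKernel hT 0).comp_neg
      simp only [gaussKernel_neg, sub_neg_eq_add, zero_add] at this
      exact this.const_mul _
    · refine Eventually.of_forall fun r => ?_
      change max r 0 * gaussKernel T (r + v) ≤ _ * (max r 0 * gaussKernel T r)
      rcases le_total r 0 with hr | hr
      · simp [hr]
      · rw [max_eq_left hr, mul_left_comm]
        gcongr
        unfold gaussKernel
        rw [mul_left_comm, ← Real.exp_add]
        gcongr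
        nlinarith [mul_nonneg (mul_nonneg hr hv) (sq_nonneg T)]
  rw [h1]
  refine h2.trans (le_of_eq ?_)
  rw [integral_const_mul, integral_max_mul_gaussKernel hT]
  unfold gaussKernel
  have : 0 < √Real.pi := by positivity
  field_simp

lemma gaussRamp_le (hT : 0 < T) (v : ℝ) :
    gaussRamp T v ≤ max v 0 + 2 / T ^ 2 * gaussKernel T v := by
  rcases le_total v 0 with h | h
  · rw [max_eq_right h, zero_add]
    have := gaussRamp_neg_le hT (neg_nonneg.2 h)
    rwa [neg_neg, gaussKernel_neg] at this
  · rw [max_eq_left h, gaussRamp_sub_neg hT]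
    gcongr
    exact gaussRamp_neg_le hT h

end gaussKernel

section gaussSmoothing
open Complex
variable {T : ℝ}

/-- The Fourier weight `exp (s z + s ^ 2 / T ^ 2)` of the Gaussian kernel. -/
noncomputable def gaussWeight (T z : ℝ) (s : ℂ) : ℂ := cexp (s * z + s ^ 2 / (T : ℂ) ^ 2)

lemma norm_gaussWeight (z c t : ℝ) :
    ‖gaussWeight T z (c + t * I)‖ = Real.exp (c * z + (c ^ 2 - t ^ 2) / T ^ 2) := by
  unfold gaussWeight
  rw [norm_exp]
  congr 1
  rw [← ofReal_pow, add_re, div_ofReal_re]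
  simp [pow_two]

lemma continuous_gaussWeight (z : ℝ) : Continuous (gaussWeight T z) := by
  unfold gaussWeight; fun_prop

lemma differentiable_gaussWeight (z : ℝ) : Differentiable ℂ (gaussWeight T z) := by
  unfold gaussWeight; fun_prop

lemma gaussWeight_sub (z u : ℝ) (s : ℂ) :
    gaussWeight T (z - u) s = cexp (-s * u) * gaussWeight T z s := by
  unfold gaussWeight
  rw [← Complex.exp_add]; push_cast; ring_nf

lemma gaussWeight_eq_quadratic (hT : 0 < T) (z c t : ℝ) :
    gaussWeight T z (c + t * I) =
      cexp ((-1 / T ^ 2 : ℂ) * t ^ 2 + (I * (z + 2 * c / T ^ 2)) * t + (c * z + c ^ 2 / T ^ 2)) := by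
  unfold gaussWeight
  have hT' : (T : ℂ) ≠ 0 := ofReal_ne_zero.2 hT.ne'
  congr 1
  field_simp
  ring_nf
  simp only [I_sq]
  ring

lemma re_neg_one_div_sq (hT : 0 < T) : ((-1 / T ^ 2 : ℂ)).re < 0 := by
  rw [← ofReal_pow, div_ofReal_re]
  simp only [neg_re, one_re]
  exact div_neg_of_neg_of_pos (by norm_num) (by positivity)

lemma integrable_gaussWeight (hT : 0 < T) (z c : ℝ) :
    Integrable fun t : ℝ => gaussWeight T z (c + t * I) := by
  simp_rw [gaussWeight_eq_quadratic hT]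
  exact integrable_cexp_quadratic' (re_neg_one_div_sq hT) _ _

lemma integral_gaussWeight (hT : 0 < T) (z c : ℝ) :
    ∫ t : ℝ, gaussWeight T z (c + t * I) = 2 * Real.pi * gaussKernel T z := by
  simp_rw [gaussWeight_eq_quadratic hT]
  rw [integral_cexp_quadratic (re_neg_one_div_sq hT)]
  have hT' : (T : ℂ) ≠ 0 := ofReal_ne_zero.2 hT.ne'
  have h1 : ((Real.pi : ℂ) / -(-1 / (T : ℂ) ^ 2)) ^ (1 / 2 : ℂ) = ((T * √Real.pi : ℝ) : ℂ) := by
    have : (Real.pi : ℂ) / -(-1 / (T : ℂ) ^ 2) = ((Real.pi * T ^ 2 : ℝ) : ℂ) := by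
      push_cast; field_simp
    rw [this, show (1 / 2 : ℂ) = ((1 / 2 : ℝ) : ℂ) by push_cast; rfl,
      ← ofReal_cpow (by positivity), ← Real.sqrt_eq_rpow, Real.sqrt_mul Real.pi_pos.le,
      Real.sqrt_sq hT.le, mul_comm]
  rw [h1]
  unfold gaussKernel
  have h2 : (c * z + c ^ 2 / (T : ℂ) ^ 2 - (I * (z + 2 * c / (T : ℂ) ^ 2)) ^ 2 /
      (4 * (-1 / (T : ℂ) ^ 2))) = ((-(T ^ 2 / 4) * z ^ 2 : ℝ) : ℂ) := by
    push_cast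
    rw [mul_pow, I_sq]
    field_simp
    ring
  rw [h2]
  push_cast
  have h3 : ((√Real.pi : ℝ) : ℂ) * (√Real.pi : ℝ) = Real.pi := by
    rw [← ofReal_mul, Real.mul_self_sqrt Real.pi_pos.le]
  have h4 : ((√Real.pi : ℝ) : ℂ) ≠ 0 := ofReal_ne_zero.2 (by positivity)
  rw [← h3]
  field_simp

variable {ν : Measure ℝ}

lemma gaussKernel_le_exp (hT : 0 < T) (v : ℝ) :
    gaussKernel T v ≤ T / (2 * √Real.pi) * Real.exp (4 / T ^ 2) * Real.exp (2 * v) := by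
  unfold gaussKernel
  rw [mul_assoc]
  gcongr
  rw [← Real.exp_add]
  gcongr
  have : 4 / T ^ 2 + 2 * v - -(T ^ 2 / 4) * v ^ 2 = (T * v / 2 + 2 / T) ^ 2 := by
    field_simp; ring
  nlinarith [sq_nonneg (T * v / 2 + 2 / T)]

lemma integrable_gaussKernel_sub (hT : 0 < T)
    (hν : Integrable (fun u => Real.exp (-2 * u)) ν) (z : ℝ) :
    Integrable (fun u => gaussKernel T (z - u)) ν := by
  refine (hν.const_mul (T / (2 * √Real.pi) * Real.exp (4 / T ^ 2) * Real.exp (2 * z))).mono'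
    (by have := continuous_gaussKernel (T := T); fun_prop) (Eventually.of_forall fun u => ?_)
  rw [Real.norm_of_nonneg (gaussKernel_nonneg hT _), mul_assoc, ← Real.exp_add]
  convert gaussKernel_le_exp hT (z - u) using 3
  ring

lemma max_le_exp (v : ℝ) : max v 0 ≤ Real.exp (2 * v) := by
  apply max_le _ (Real.exp_pos _).le
  by_cases hv : 0 ≤ v
  · linarith [Real.add_one_le_exp (2 * v)]
  · linarith [Real.exp_pos (2 * v)]

lemma integrable_max_sub (hν : Integrable (fun u => Real.exp (-2 * u)) ν) (z : ℝ) :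
    Integrable (fun u => max (z - u) 0) ν := by
  refine (hν.const_mul (Real.exp (2 * z))).mono' (by fun_prop) (Eventually.of_forall fun u => ?_)
  rw [Real.norm_of_nonneg (le_max_right _ _), ← Real.exp_add]
  convert max_le_exp (z - u) using 2
  ring

lemma measurable_gaussRamp : Measurable (gaussRamp T) := by
  unfold gaussRamp
  apply StronglyMeasurable.measurable
  apply StronglyMeasurable.integral_prod_right (f := fun v p => max (v - p) 0 * gaussKernel T p)
  apply Continuous.stronglyMeasurable
  have := continuous_gaussKernel (T := T)
  unfold Function.uncurry
  fun_prop

lemma integrable_gaussRamp_sub (hT : 0 < T)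
    (hν : Integrable (fun u => Real.exp (-2 * u)) ν) (z : ℝ) :
    Integrable (fun u => gaussRamp T (z - u)) ν := by
  refine ((integrable_max_sub hν z).add
    ((integrable_gaussKernel_sub hT hν z).const_mul (2 / T ^ 2))).mono'
    ((measurable_gaussRamp (T := T)).comp (measurable_const.sub measurable_id)).aestronglyMeasurable
    (Eventually.of_forall fun u => ?_)
  rw [Real.norm_of_nonneg (gaussRamp_nonneg hT _)]
  exact gaussRamp_le hT _

lemma integrable_laplace_mul_gaussWeight_prod (hT : 0 < T) [SFinite ν]
    (hν : Integrable (fun u => Real.exp (-2 * u)) ν) (z : ℝ) :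
    Integrable (Function.uncurry fun (t u : ℝ) =>
      cexp (-((2 : ℝ) + t * I) * u) * gaussWeight T z ((2 : ℝ) + t * I)) (volume.prod ν) := by
  have h := (integrable_gaussWeight hT z 2).norm.mul_prod hν
  refine h.mono' ?_ (Eventually.of_forall fun ⟨t, u⟩ => ?_)
  · apply Continuous.aestronglyMeasurable
    have := continuous_gaussWeight (T := T) z
    unfold Function.uncurry
    fun_prop
  · simp only [Function.uncurry_apply_pair, norm_mul]
    rw [mul_comm]
    gcongr
    rw [norm_exp]
    simp

lemma integrable_laplace_mul_gaussWeight (hT : 0 < T) [SFinite ν]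
    (hν : Integrable (fun u => Real.exp (-2 * u)) ν) (z : ℝ) :
    Integrable fun t : ℝ =>
      (∫ u : ℝ, cexp (-((2 : ℝ) + t * I) * u) ∂ν) * gaussWeight T z ((2 : ℝ) + t * I) := by
  simp_rw [← integral_mul_const]
  exact (integrable_laplace_mul_gaussWeight_prod hT hν z).integral_prod_left

/-- The Fourier inversion formula for the Gaussian smoothing of a measure. -/
lemma integral_laplace_mul_gaussWeight (hT : 0 < T) [SFinite ν]
    (hν : Integrable (fun u => Real.exp (-2 * u)) ν) (z : ℝ) :
    ∫ t : ℝ, (∫ u : ℝ, cexp (-((2 : ℝ) + t * I) * u) ∂ν) * gaussWeight T z ((2 : ℝ) + t * I) =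
      2 * Real.pi * (∫ u, gaussKernel T (z - u) ∂ν : ℝ) := by
  simp_rw [← integral_mul_const]
  rw [integral_integral_swap (integrable_laplace_mul_gaussWeight_prod hT hν z)]
  simp_rw [← gaussWeight_sub]
  simp_rw [integral_gaussWeight hT]
  rw [integral_const_mul, integral_complex_ofReal]

end gaussSmoothing

section contourShift
open Complex

lemma integrable_exp_neg_abs : Integrable fun t : ℝ => Real.exp (-|t|) := by
  have := integrable_one_add_norm (E := ℝ) (μ := volume) (r := 2) (by simp)
  refine (this.const_mul 2).mono' (by fun_prop) (Eventually.of_forall fun t => ?_)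
  rw [Real.norm_of_nonneg (Real.exp_pos _).le, Real.exp_neg, Real.norm_eq_abs,
    Real.rpow_neg (by positivity), ← one_div, ← div_eq_mul_inv, div_le_div_iff₀ (by positivity)
    (by positivity), Real.rpow_two]
  nlinarith [Real.quadratic_le_exp_of_nonneg (abs_nonneg t), abs_nonneg t]

/-- A continuous function decaying exponentially in a vertical strip does so uniformly. -/
lemma exists_norm_le_exp_neg_abs_im {f : ℂ → ℂ} (hf : Continuous f) {a b M t₀ : ℝ}
    (hM : ∀ s : ℂ, s.re ∈ Icc a b → t₀ ≤ |s.im| → ‖f s‖ ≤ M * Real.exp (-|s.im|)) :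
    ∃ C, ∀ s : ℂ, s.re ∈ Icc a b → ‖f s‖ ≤ C * Real.exp (-|s.im|) := by
  have hK : IsCompact (Icc a b ×ℂ Icc (-t₀) t₀) := isCompact_Icc.reProdIm isCompact_Icc
  obtain ⟨C, hC⟩ := hK.exists_bound_of_continuousOn hf.continuousOn
  refine ⟨max M (C * Real.exp t₀), fun s hs => ?_⟩
  by_cases h : t₀ ≤ |s.im|
  · exact (hM s hs h).trans (by gcongr; exact le_max_left _ _)
  · push Not at h
    have h1 := hC s ⟨hs, abs_le.1 h.le⟩
    have hC0 : 0 ≤ C := (norm_nonneg _).trans h1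
    calc ‖f s‖ ≤ C := h1
      _ = C * Real.exp t₀ * Real.exp (-t₀) := by rw [mul_assoc, ← Real.exp_add]; simp
      _ ≤ C * Real.exp t₀ * Real.exp (-|s.im|) := by gcongr
      _ ≤ _ := by gcongr; exact le_max_right _ _

lemma integrable_vertical {f : ℂ → ℂ} (hf : Continuous f) {a b C c : ℝ} (hc : c ∈ Icc a b)
    (hC : ∀ s : ℂ, s.re ∈ Icc a b → ‖f s‖ ≤ C * Real.exp (-|s.im|)) :
    Integrable fun t : ℝ => f (c + t * I) := by
  refine (integrable_exp_neg_abs.const_mul C).mono' (by fun_prop) (Eventually.of_forall fun t => ?_)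
  simpa using hC (c + t * I) (by simpa using hc)

/-- Vertical line integrals of an entire function decaying in a strip agree. -/
lemma integral_vertical_eq {f : ℂ → ℂ} (hf : Differentiable ℂ f) {a b C : ℝ} (hab : a ≤ b)
    (hC : ∀ s : ℂ, s.re ∈ Icc a b → ‖f s‖ ≤ C * Real.exp (-|s.im|)) :
    ∫ t : ℝ, f (b + t * I) = ∫ t : ℝ, f (a + t * I) := by
  have hb := intervalIntegral_tendsto_integral
    (integrable_vertical hf.continuous (right_mem_Icc.2 hab) hC)
    tendsto_neg_atTop_atBot tendsto_id
  have ha := intervalIntegral_tendsto_integral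
    (integrable_vertical hf.continuous (left_mem_Icc.2 hab) hC)
    tendsto_neg_atTop_atBot tendsto_id
  have key : ∀ R : ℝ, 0 ≤ R → ‖(∫ t in (-R)..R, f (b + t * I)) - ∫ t in (-R)..R, f (a + t * I)‖ ≤
      2 * (C * Real.exp (-R) * |b - a|) := by
    intro R hR
    have h := integral_boundary_rect_eq_zero_of_differentiableOn f (a + (-R : ℝ) * I) (b + R * I)
      hf.differentiableOn
    simp only [add_re, ofReal_re, mul_re, I_re, mul_zero, ofReal_im, I_im, mul_one, sub_self,
      add_zero, add_im, mul_im, zero_add, smul_eq_mul] at h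
    have hbd : ∀ y : ℝ, |y| = R → ‖∫ x in a..b, f (x + y * I)‖ ≤ C * Real.exp (-R) * |b - a| := by
      intro y hy
      apply intervalIntegral.norm_integral_le_of_norm_le_const
      intro x hx
      rw [uIoc_of_le hab] at hx
      have := hC (x + y * I) (by simpa using ⟨hx.1.le, hx.2⟩)
      simpa [hy] using this
    have h1 := hbd (-R) (by rw [abs_neg, abs_of_nonneg hR])
    have h2 := hbd R (abs_of_nonneg hR)
    have h3 : I * ((∫ t in (-R)..R, f (b + t * I)) - ∫ t in (-R)..R, f (a + t * I)) =
        (∫ x in a..b, f (x + R * I)) - ∫ x in a..b, f (x + (-R : ℝ) * I) := by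
      linear_combination h
    have h4 := congrArg norm h3
    rw [norm_mul, norm_I, one_mul] at h4
    rw [h4]
    refine (norm_sub_le _ _).trans ?_
    linarith
  have h0 : Tendsto (fun R : ℝ => 2 * (C * Real.exp (-R) * |b - a|)) atTop (nhds 0) := by
    have : Tendsto (fun R : ℝ => Real.exp (-R)) atTop (nhds 0) :=
      Real.tendsto_exp_neg_atTop_nhds_zero
    simpa using ((this.const_mul C).mul_const |b - a|).const_mul 2
  have h5 : Tendsto (fun R : ℝ => (∫ t in (-R)..R, f (b + t * I)) - ∫ t in (-R)..R, f (a + t * I))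
      atTop (nhds 0) := by
    apply squeeze_zero_norm' _ h0
    filter_upwards [eventually_ge_atTop 0] with R hR using key R hR
  have h6 := tendsto_nhds_unique (hb.sub ha) h5
  exact sub_eq_zero.1 h6

lemma one_add_abs_rpow_mul_exp_le {p T : ℝ} (hp : 0 ≤ p) (hT : 1 ≤ T) (t : ℝ) :
    (1 + |t|) ^ p * Real.exp (-t ^ 2 / T ^ 2) ≤ Real.exp (p ^ 2 / 4) * T ^ p := by
  have hT0 : 0 < T := by linarith
  set x := |t| / T with hx
  have hx0 : 0 ≤ x := by positivity
  have h1 : 1 + |t| ≤ T * Real.exp x := by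
    have : |t| = T * x := by rw [hx]; field_simp
    rw [this]
    nlinarith [Real.add_one_le_exp x]
  have h2 : -t ^ 2 / T ^ 2 = -x ^ 2 := by rw [hx, div_pow, sq_abs]; ring
  rw [h2]
  calc (1 + |t|) ^ p * Real.exp (-x ^ 2) ≤ (T * Real.exp x) ^ p * Real.exp (-x ^ 2) := by gcongr
    _ = Real.exp (x * p - x ^ 2) * T ^ p := by
      rw [Real.mul_rpow hT0.le (Real.exp_pos _).le, ← Real.exp_mul, mul_assoc, ← Real.exp_add,
        mul_comm]
      ring_nf
    _ ≤ _ := by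
      gcongr
      nlinarith [sq_nonneg (x - p / 2)]

lemma exists_integral_rpow_mul_exp_le {p δ : ℝ} (hp : 0 ≤ p) (hδ : 0 < δ) :
    ∃ C > 0, ∀ T : ℝ, 1 ≤ T →
      Integrable (fun t : ℝ => (1 + |t|) ^ (p - 1 - δ) * Real.exp (-t ^ 2 / T ^ 2)) ∧
      ∫ t : ℝ, (1 + |t|) ^ (p - 1 - δ) * Real.exp (-t ^ 2 / T ^ 2) ≤ C * T ^ p := by
  have hi : Integrable fun t : ℝ => (1 + |t|) ^ (-(1 + δ)) :=
    integrable_one_add_norm (E := ℝ) (μ := volume) (r := 1 + δ) (by simpa using hδ)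
  have hpos : 0 ≤ ∫ t : ℝ, (1 + |t|) ^ (-(1 + δ)) := integral_nonneg fun t => by positivity
  refine ⟨Real.exp (p ^ 2 / 4) * ((∫ t : ℝ, (1 + |t|) ^ (-(1 + δ))) + 1), by positivity,
    fun T hT => ?_⟩
  have hbd : ∀ t : ℝ, (1 + |t|) ^ (p - 1 - δ) * Real.exp (-t ^ 2 / T ^ 2) ≤
      Real.exp (p ^ 2 / 4) * T ^ p * (1 + |t|) ^ (-(1 + δ)) := by
    intro t
    have := one_add_abs_rpow_mul_exp_le hp hT t
    rw [show p - 1 - δ = p + -(1 + δ) by ring, Real.rpow_add (by positivity)]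
    calc _ = (1 + |t|) ^ p * Real.exp (-t ^ 2 / T ^ 2) * (1 + |t|) ^ (-(1 + δ)) := by ring
      _ ≤ _ := by gcongr
  have hint : Integrable (fun t : ℝ => (1 + |t|) ^ (p - 1 - δ) * Real.exp (-t ^ 2 / T ^ 2)) := by
    refine (hi.const_mul (Real.exp (p ^ 2 / 4) * T ^ p)).mono' ?_ (Eventually.of_forall fun t => ?_)
    · apply Continuous.aestronglyMeasurable
      refine Continuous.mul (Continuous.rpow_const (by fun_prop) fun t => Or.inl ?_) (by fun_prop)
      positivity
    · rw [Real.norm_of_nonneg (by positivity)]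
      exact hbd t
  refine ⟨hint, ?_⟩
  refine (integral_mono hint (hi.const_mul _) hbd).trans ?_
  rw [integral_const_mul]
  have : 0 < T ^ p := by positivity
  have : 0 < Real.exp (p ^ 2 / 4) * T ^ p := by positivity
  nlinarith

end contourShift

/-- The kernel representing `f y - (1 - y) * f 0 - y * f 1` in terms of the second derivative. -/
noncomputable def chordKernel (y z : ℝ) : ℝ :=
  max (y - z) 0 - (1 - y) * max (0 - z) 0 - y * max (1 - z) 0

section chordKernel
open Complex
variable {y : ℝ}

lemma continuous_chordKernel : Continuous (chordKernel y) := by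
  unfold chordKernel; fun_prop

lemma chordKernel_of_nonpos {z : ℝ} (hy : 1 ≤ y) (hz : z ≤ 0) : chordKernel y z = 0 := by
  unfold chordKernel
  rw [max_eq_left (by linarith), max_eq_left (by linarith), max_eq_left (by linarith)]
  ring

lemma chordKernel_of_le_one {z : ℝ} (hy : 1 ≤ y) (hz : 0 ≤ z) (hz1 : z ≤ 1) :
    chordKernel y z = z * (y - 1) := by
  unfold chordKernel
  rw [max_eq_left (by linarith), max_eq_right (by linarith), max_eq_left (by linarith)]
  ring

lemma chordKernel_of_one_le {z : ℝ} (hz : 1 ≤ z) (hzy : z ≤ y) : chordKernel y z = y - z := by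
  unfold chordKernel
  rw [max_eq_left (by linarith), max_eq_right (by linarith), max_eq_right (by linarith)]
  ring

lemma chordKernel_of_le {z : ℝ} (hy : 1 ≤ y) (hzy : y ≤ z) : chordKernel y z = 0 := by
  unfold chordKernel
  rw [max_eq_right (by linarith), max_eq_right (by linarith), max_eq_right (by linarith)]
  ring

lemma hasCompactSupport_chordKernel (hy : 1 ≤ y) : HasCompactSupport (chordKernel y) := by
  apply HasCompactSupport.intro (isCompact_Icc (a := (0 : ℝ)) (b := y))
  intro z hz
  rcases le_total z 0 with h | h
  · exact chordKernel_of_nonpos hy h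
  · exact chordKernel_of_le hy (by by_contra h'; exact hz ⟨h, by linarith⟩)

lemma integral_chordKernel_mul {f : ℝ → ℂ} (hy : 1 ≤ y) :
    ∫ z, (chordKernel y z : ℂ) * f z = ∫ z in 0..y, (chordKernel y z : ℂ) * f z := by
  rw [intervalIntegral.integral_of_le (by linarith), setIntegral_eq_integral_of_forall_compl_eq_zero]
  intro z hz
  rcases le_or_gt z 0 with h | h
  · rw [chordKernel_of_nonpos hy h]; simp
  · rw [chordKernel_of_le hy (by by_contra h'; exact hz ⟨h, by linarith⟩)]; simp

lemma integral_chordKernel_mul_cexp (hy : 1 ≤ y) {s : ℂ} (hs : s ≠ 0) :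
    ∫ z, (chordKernel y z : ℂ) * cexp (s * z) = (cexp (s * y) - y * cexp s + (y - 1)) / s ^ 2 := by
  rw [integral_chordKernel_mul hy]
  have hcont : Continuous fun z : ℝ => (chordKernel y z : ℂ) * cexp (s * z) := by
    have := continuous_chordKernel (y := y)
    fun_prop
  rw [← intervalIntegral.integral_add_adjacent_intervals (b := 1)
    (hcont.intervalIntegrable _ _) (hcont.intervalIntegrable _ _)]
  have hid : ∀ z : ℝ, HasDerivAt (fun z : ℝ => (z : ℂ)) 1 z := fun z => ofRealCLM.hasDerivAt
  have h1 : ∫ z in (0 : ℝ)..1, (chordKernel y z : ℂ) * cexp (s * z) =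
      (y - 1) * ((1 : ℝ) / s - 1 / s ^ 2) * cexp (s * (1 : ℝ)) -
      (y - 1) * ((0 : ℝ) / s - 1 / s ^ 2) * cexp (s * (0 : ℝ)) := by
    apply intervalIntegral.integral_eq_sub_of_hasDerivAt
      (f := fun z : ℝ => (y - 1) * ((z : ℂ) / s - 1 / s ^ 2) * cexp (s * z)) _
      (hcont.intervalIntegrable _ _)
    intro z hz
    rw [uIcc_of_le zero_le_one] at hz
    rw [chordKernel_of_le_one hy hz.1 hz.2]
    convert! ((((hid z).div_const s).sub_const (1 / s ^ 2)).const_mul ((y : ℂ) - 1)).mul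
      ((hid z).const_mul s).cexp using 1
    push_cast
    field_simp
    ring
  have h2 : ∫ z in (1 : ℝ)..y, (chordKernel y z : ℂ) * cexp (s * z) =
      ((y - (y : ℝ)) / s + 1 / s ^ 2) * cexp (s * (y : ℝ)) -
      ((y - (1 : ℝ)) / s + 1 / s ^ 2) * cexp (s * (1 : ℝ)) := by
    apply intervalIntegral.integral_eq_sub_of_hasDerivAt
      (f := fun z : ℝ => ((y - (z : ℂ)) / s + 1 / s ^ 2) * cexp (s * z)) _
      (hcont.intervalIntegrable _ _)
    intro z hz
    rw [uIcc_of_le hy] at hz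
    rw [chordKernel_of_one_le hz.1 hz.2]
    convert! ((((hid z).const_sub (y : ℂ)).div_const s).add_const (1 / s ^ 2)).mul
      ((hid z).const_mul s).cexp using 1
    push_cast
    field_simp
    ring
  rw [h1, h2]
  push_cast
  simp only [mul_zero, Complex.exp_zero, mul_one]
  field_simp
  ring

lemma norm_integral_chordKernel_mul_cexp_le (hy : 1 ≤ y) {s : ℂ} (hs : s.re < 0) :
    ‖∫ z, (chordKernel y z : ℂ) * cexp (s * z)‖ ≤ 2 * y / ‖s‖ ^ 2 := by
  have hs0 : s ≠ 0 := by rintro rfl; simp at hs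
  rw [integral_chordKernel_mul_cexp hy hs0, norm_div, norm_pow]
  gcongr
  have h1 : ‖cexp (s * y)‖ ≤ 1 := by
    rw [norm_exp, Real.exp_le_one_iff]
    simp only [mul_re, ofReal_re, ofReal_im, mul_zero, sub_zero]
    nlinarith
  have h2 : ‖(y : ℂ) * cexp s‖ ≤ y := by
    rw [norm_mul, norm_exp, norm_real, Real.norm_of_nonneg (by linarith)]
    exact mul_le_of_le_one_right (by linarith) (Real.exp_le_one_iff.2 hs.le)
  have h3 : ‖(y : ℂ) - 1‖ = y - 1 := by
    rw [show (y : ℂ) - 1 = ((y - 1 : ℝ) : ℂ) by push_cast; rfl, norm_real,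
      Real.norm_of_nonneg (by linarith)]
  calc _ ≤ ‖cexp (s * y)‖ + ‖(y : ℂ) * cexp s‖ + ‖(y : ℂ) - 1‖ :=
        (norm_add_le _ _).trans (by gcongr; exact norm_sub_le _ _)
    _ ≤ _ := by rw [h3]; linarith

variable {T : ℝ} {ν : Measure ℝ}

lemma gaussRamp_sub_eq (v u : ℝ) :
    gaussRamp T (v - u) = ∫ z, max (v - z) 0 * gaussKernel T (z - u) := by
  unfold gaussRamp
  rw [← integral_sub_right_eq_self _ u]
  congr 1 with z
  ring_nf

lemma integral_chordKernel_mul_gaussKernel (hT : 0 < T) (u : ℝ) :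
    ∫ z, chordKernel y z * gaussKernel T (z - u) =
      gaussRamp T (y - u) - (1 - y) * gaussRamp T (0 - u) - y * gaussRamp T (1 - u) := by
  have hi : ∀ v, Integrable fun z => max (v - z) 0 * gaussKernel T (z - u) := by
    intro v
    simpa using (integrable_max_mul_gaussKernel hT (v - u)).comp_sub_right u
  simp_rw [gaussRamp_sub_eq, ← integral_const_mul]
  rw [← integral_sub (hi y) ((hi 0).const_mul _), ← integral_sub]
  · congr 1 with z
    unfold chordKernel
    ring
  · exact (hi y).sub ((hi 0).const_mul _)
  · exact (hi 1).const_mul _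

lemma integrable_chordKernel_mul_gaussKernel_prod (hT : 0 < T) [SFinite ν]
    (hν : Integrable (fun u => Real.exp (-2 * u)) ν) (hy : 1 ≤ y) :
    Integrable (Function.uncurry fun u z => chordKernel y z * gaussKernel T (z - u))
      (ν.prod volume) := by
  have hkc := continuous_chordKernel (y := y)
  have hgc := continuous_gaussKernel (T := T)
  have hk : Integrable fun z => chordKernel y z * (T / (2 * √Real.pi) * Real.exp (4 / T ^ 2) *
      Real.exp (2 * z)) :=
    Continuous.integrable_of_hasCompactSupport (by fun_prop)
      (hasCompactSupport_chordKernel hy).mul_right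
  refine (hν.mul_prod hk.norm).mono' ?_ (Eventually.of_forall fun ⟨u, z⟩ => ?_)
  · apply Continuous.aestronglyMeasurable
    unfold Function.uncurry
    fun_prop
  · simp only [Function.uncurry_apply_pair, norm_mul, Real.norm_eq_abs,
      abs_of_nonneg (gaussKernel_nonneg hT _), Real.abs_exp]
    rw [mul_left_comm]
    gcongr
    refine (gaussKernel_le_exp hT (z - u)).trans ?_
    rw [abs_of_nonneg (by positivity : 0 ≤ T / (2 * √Real.pi)), mul_left_comm, ← Real.exp_add]
    apply le_of_eq
    ring_nf

lemma integral_gaussRamp_chord (hT : 0 < T) [SFinite ν]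
    (hν : Integrable (fun u => Real.exp (-2 * u)) ν) (hy : 1 ≤ y) :
    (∫ u, gaussRamp T (y - u) ∂ν) - (1 - y) * (∫ u, gaussRamp T (0 - u) ∂ν) -
      y * (∫ u, gaussRamp T (1 - u) ∂ν) =
      ∫ z, chordKernel y z * ∫ u, gaussKernel T (z - u) ∂ν := by
  have hi := fun z => integrable_gaussRamp_sub hT hν z
  have hi2 : Integrable (fun u => gaussRamp T (y - u) - (1 - y) * gaussRamp T (0 - u)) ν :=
    (hi y).sub ((hi 0).const_mul _)
  rw [← integral_const_mul, ← integral_const_mul, ← integral_sub (hi y) ((hi 0).const_mul _),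
    ← integral_sub hi2 ((hi 1).const_mul _)]
  simp_rw [← integral_chordKernel_mul_gaussKernel hT, ← integral_const_mul]
  exact integral_integral_swap (integrable_chordKernel_mul_gaussKernel_prod hT hν hy)

end chordKernel

section tauberian
open Complex
variable {T : ℝ} {D : ℂ → ℂ} {ν ρ : Measure ℝ} {κ A δ : ℝ}

lemma exists_norm_mul_gaussWeight_le (hT : 0 < T) (hδ : 0 < δ) (hδ' : δ < 1) (hD : Continuous D)
    (hgrow : ∃ C t₀ : ℝ, ∀ s : ℂ, s.re ∈ Icc (-δ) 2 → t₀ ≤ |s.im| →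
      ‖D s‖ ≤ C * Real.exp (C * |s.im|)) (z : ℝ) :
    ∃ C, ∀ s : ℂ, s.re ∈ Icc (-δ) 2 → ‖D s * gaussWeight T z s‖ ≤ C * Real.exp (-|s.im|) := by
  obtain ⟨C, t₀, h⟩ := hgrow
  apply exists_norm_le_exp_neg_abs_im (t₀ := t₀) (hD.mul (continuous_gaussWeight z))
    (M := |C| * Real.exp (2 * |z| + 4 / T ^ 2 + (C + 1) ^ 2 * T ^ 2 / 4))
  intro s hs hst
  rw [Pi.mul_apply, norm_mul]
  have h1 : ‖gaussWeight T z s‖ = Real.exp (s.re * z + (s.re ^ 2 - s.im ^ 2) / T ^ 2) := by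
    conv_lhs => rw [← re_add_im s]
    exact norm_gaussWeight z s.re s.im
  have h2 : ‖D s‖ ≤ |C| * Real.exp (C * |s.im|) :=
    (h s hs hst).trans (by gcongr; exact le_abs_self C)
  rw [h1]
  refine (mul_le_mul_of_nonneg_right h2 (Real.exp_pos _).le).trans ?_
  rw [mul_assoc, mul_assoc, ← Real.exp_add, ← Real.exp_add]
  refine mul_le_mul_of_nonneg_left (Real.exp_le_exp.2 ?_) (abs_nonneg C)
  have h3 : s.re * z ≤ 2 * |z| := by
    have := abs_mul s.re z ▸ le_abs_self (s.re * z)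
    have h4 : |s.re| ≤ 2 := abs_le.2 ⟨by linarith [hs.1], hs.2⟩
    nlinarith [abs_nonneg z]
  have h5 : s.re ^ 2 / T ^ 2 ≤ 4 / T ^ 2 := by
    gcongr
    nlinarith [hs.1, hs.2]
  have h6 : (C + 1) * |s.im| ≤ |s.im| ^ 2 / T ^ 2 + (C + 1) ^ 2 * T ^ 2 / 4 := by
    have : |s.im| ^ 2 / T ^ 2 + (C + 1) ^ 2 * T ^ 2 / 4 - (C + 1) * |s.im| =
      (|s.im| / T - (C + 1) * T / 2) ^ 2 := by field_simp; ring
    nlinarith [sq_nonneg (|s.im| / T - (C + 1) * T / 2)]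
  rw [sq_abs] at h6
  rw [sub_div]
  linarith

lemma two_pi_mul_gaussSmoothing_sub (hT : 0 < T) (hδ : 0 < δ) (hδ' : δ < 1) [SFinite ν] [SFinite ρ]
    (hν : Integrable (fun u => Real.exp (-2 * u)) ν)
    (hρ : Integrable (fun u => Real.exp (-2 * u)) ρ) (hD : Differentiable ℂ D)
    (hDL : ∀ t : ℝ, D ((2 : ℝ) + t * I) = (∫ u : ℝ, cexp (-((2 : ℝ) + t * I) * u) ∂ν) -
      κ * ∫ u : ℝ, cexp (-((2 : ℝ) + t * I) * u) ∂ρ)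
    (hgrow : ∃ C t₀ : ℝ, ∀ s : ℂ, s.re ∈ Icc (-δ) 2 → t₀ ≤ |s.im| →
      ‖D s‖ ≤ C * Real.exp (C * |s.im|)) (z : ℝ) :
    2 * Real.pi * (((∫ u, gaussKernel T (z - u) ∂ν) - κ * ∫ u, gaussKernel T (z - u) ∂ρ : ℝ) : ℂ) =
      ∫ t : ℝ, D ((-δ : ℝ) + t * I) * gaussWeight T z ((-δ : ℝ) + t * I) := by
  obtain ⟨C, hC⟩ := exists_norm_mul_gaussWeight_le hT hδ hδ' hD.continuous hgrow z
  have h := integral_vertical_eq (hD.mul (differentiable_gaussWeight z)) (by linarith) hC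
  simp only [Pi.mul_apply] at h
  rw [← h]
  simp only [hDL, sub_mul, mul_assoc]
  rw [integral_sub (integrable_laplace_mul_gaussWeight hT hν z)
    ((integrable_laplace_mul_gaussWeight hT hρ z).const_mul _), integral_const_mul,
    integral_laplace_mul_gaussWeight hT hν, integral_laplace_mul_gaussWeight hT hρ]
  push_cast
  ring

lemma norm_line_mul_gaussWeight_le {C : ℝ} (hδ' : δ ^ 2 ≤ 1) (hC : 0 ≤ C) (hT : 1 ≤ T) {t : ℝ}
    (hline : ‖D ((-δ : ℝ) + t * I)‖ ≤ C * (1 + |t|) ^ A) (z : ℝ) :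
    ‖D ((-δ : ℝ) + t * I) * gaussWeight T z ((-δ : ℝ) + t * I)‖ ≤
      C * Real.exp 1 * Real.exp (-δ * z) * ((1 + |t|) ^ A * Real.exp (-t ^ 2 / T ^ 2)) := by
  rw [norm_mul, norm_gaussWeight]
  calc _ ≤ C * (1 + |t|) ^ A * (Real.exp 1 * Real.exp (-δ * z) * Real.exp (-t ^ 2 / T ^ 2)) := by
        refine mul_le_mul hline ?_ (Real.exp_pos _).le (by positivity)
        rw [← Real.exp_add, ← Real.exp_add]
        rw [Real.exp_le_exp]
        have : (-δ) ^ 2 / T ^ 2 ≤ 1 := by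
          rw [div_le_one (by positivity)]
          nlinarith
        rw [sub_div, neg_div]
        linarith
    _ = _ := by ring

lemma exists_abs_gaussSmoothing_sub_le (hδ : 0 < δ) (hδ' : δ < 1) [SFinite ν] [SFinite ρ]
    (hA : 0 ≤ A - 1 + δ)
    (hν : Integrable (fun u => Real.exp (-2 * u)) ν)
    (hρ : Integrable (fun u => Real.exp (-2 * u)) ρ) (hD : Differentiable ℂ D)
    (hDL : ∀ t : ℝ, D ((2 : ℝ) + t * I) = (∫ u : ℝ, cexp (-((2 : ℝ) + t * I) * u) ∂ν) -
      κ * ∫ u : ℝ, cexp (-((2 : ℝ) + t * I) * u) ∂ρ)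
    (hgrow : ∃ C t₀ : ℝ, ∀ s : ℂ, s.re ∈ Icc (-δ) 2 → t₀ ≤ |s.im| →
      ‖D s‖ ≤ C * Real.exp (C * |s.im|))
    (hline : ∃ C, ∀ t : ℝ, ‖D ((-δ : ℝ) + t * I)‖ ≤ C * (1 + |t|) ^ A) :
    ∃ C > 0, ∀ T : ℝ, 1 ≤ T → ∀ z : ℝ, 0 ≤ z →
      |(∫ u, gaussKernel T (z - u) ∂ν) - κ * ∫ u, gaussKernel T (z - u) ∂ρ| ≤
        C * T ^ (A + 1 + δ) := by
  obtain ⟨C₁, hC₁⟩ := hline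
  have hC₁' : 0 ≤ C₁ := by have := (norm_nonneg _).trans (hC₁ 0); simpa using this
  obtain ⟨C₂, hC₂, h⟩ := exists_integral_rpow_mul_exp_le (p := A + 1 + δ) (δ := δ)
    (by linarith) hδ
  refine ⟨(C₁ + 1) * Real.exp 1 * C₂, by positivity, fun T hT z hz => ?_⟩
  have hT0 : 0 < T := by linarith
  obtain ⟨hi, hle⟩ := h T hT
  rw [show A + 1 + δ - 1 - δ = A by ring] at hi hle
  have key := two_pi_mul_gaussSmoothing_sub hT0 hδ hδ' hν hρ hD hDL hgrow z
  have h2 : ‖∫ t : ℝ, D ((-δ : ℝ) + t * I) * gaussWeight T z ((-δ : ℝ) + t * I)‖ ≤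
      (C₁ + 1) * Real.exp 1 * ∫ t : ℝ, (1 + |t|) ^ A * Real.exp (-t ^ 2 / T ^ 2) := by
    rw [← integral_const_mul]
    refine norm_integral_le_of_norm_le (hi.const_mul _) (Eventually.of_forall fun t => ?_)
    refine (norm_line_mul_gaussWeight_le (by nlinarith) hC₁' hT (hC₁ t) z).trans ?_
    gcongr ?_ * _
    calc C₁ * Real.exp 1 * Real.exp (-δ * z) ≤ C₁ * Real.exp 1 * 1 := by
          gcongr
          rw [Real.exp_le_one_iff]
          nlinarith
      _ ≤ _ := by nlinarith [Real.exp_pos 1]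
  rw [← key, norm_mul, norm_real, Real.norm_eq_abs] at h2
  have h3 : ‖(2 * Real.pi : ℂ)‖ = 2 * Real.pi := by
    simp [abs_of_pos Real.pi_pos]
  rw [h3] at h2
  set X := |(∫ u, gaussKernel T (z - u) ∂ν) - κ * ∫ u, gaussKernel T (z - u) ∂ρ|
  have hX : 0 ≤ X := abs_nonneg _
  calc X ≤ 2 * Real.pi * X := by nlinarith [Real.pi_gt_three]
    _ ≤ _ := h2
    _ ≤ _ := by rw [mul_assoc ((C₁ + 1) * Real.exp 1)]; gcongr

lemma exists_abs_integral_chordKernel_le (hδ : 0 < δ) (hδ' : δ < 1) [SFinite ν] [SFinite ρ]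
    (hA : 0 ≤ A - 1 + δ)
    (hν : Integrable (fun u => Real.exp (-2 * u)) ν)
    (hρ : Integrable (fun u => Real.exp (-2 * u)) ρ) (hD : Differentiable ℂ D)
    (hDL : ∀ t : ℝ, D ((2 : ℝ) + t * I) = (∫ u : ℝ, cexp (-((2 : ℝ) + t * I) * u) ∂ν) -
      κ * ∫ u : ℝ, cexp (-((2 : ℝ) + t * I) * u) ∂ρ)
    (hgrow : ∃ C t₀ : ℝ, ∀ s : ℂ, s.re ∈ Icc (-δ) 2 → t₀ ≤ |s.im| →
      ‖D s‖ ≤ C * Real.exp (C * |s.im|))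
    (hline : ∃ C, ∀ t : ℝ, ‖D ((-δ : ℝ) + t * I)‖ ≤ C * (1 + |t|) ^ A) :
    ∃ C > 0, ∀ T : ℝ, 1 ≤ T → ∀ y : ℝ, 1 ≤ y →
      |∫ z, chordKernel y z *
        ((∫ u, gaussKernel T (z - u) ∂ν) - κ * ∫ u, gaussKernel T (z - u) ∂ρ)| ≤
        C * y * T ^ (A - 1 + δ) := by
  obtain ⟨C₁, hC₁⟩ := hline
  have hC₁' : 0 ≤ C₁ := by have := (norm_nonneg _).trans (hC₁ 0); simpa using this
  obtain ⟨C₂, hC₂, h⟩ := exists_integral_rpow_mul_exp_le (p := A - 1 + δ) (δ := δ) hA hδ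
  refine ⟨(C₁ + 1) * Real.exp 1 * (4 / δ ^ 2) * C₂, by positivity, fun T hT y hy => ?_⟩
  have hT0 : 0 < T := by linarith
  obtain ⟨hi, hle⟩ := h T hT
  rw [show A - 1 + δ - 1 - δ = A - 2 by ring] at hi hle
  have hkc := continuous_chordKernel (y := y)
  set s : ℝ → ℂ := fun t => (-δ : ℝ) + t * I with hs
  have hsc : Continuous s := by fun_prop
  obtain ⟨C₃, hC₃⟩ := exists_norm_mul_gaussWeight_le hT0 hδ hδ' hD.continuous hgrow 0
  obtain ⟨g, hg⟩ : ∃ g : ℝ → ℂ, ∀ t, g t = D (s t) * gaussWeight T 0 (s t) := ⟨_, fun _ => rfl⟩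
  have hgc : Continuous g := by
    simp_rw [funext hg]
    exact (hD.continuous.comp hsc).mul ((continuous_gaussWeight 0).comp hsc)
  have hw : ∀ z t, D (s t) * gaussWeight T z (s t) = g t * cexp (s t * z) := by
    intro z t
    rw [hg]
    unfold gaussWeight
    rw [mul_assoc, ← Complex.exp_add]
    congr 2
    push_cast
    ring
  have hDi : Integrable g := by
    simp_rw [funext hg]
    exact integrable_vertical (hD.continuous.mul (continuous_gaussWeight 0))
      (left_mem_Icc.2 (by linarith)) hC₃
  have hswap : ∫ z, ∫ t, (chordKernel y z : ℂ) * (D (s t) * gaussWeight T z (s t)) =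
      ∫ t, g t * ∫ z, (chordKernel y z : ℂ) * cexp (s t * z) := by
    rw [integral_integral_swap]
    · congr 1 with t
      rw [← integral_const_mul]
      congr 1 with z
      rw [hw]
      ring
    · have hk : Integrable fun z => chordKernel y z * Real.exp (-δ * z) :=
        Continuous.integrable_of_hasCompactSupport (by fun_prop)
          (hasCompactSupport_chordKernel hy).mul_right
      refine (hk.norm.mul_prod hDi.norm).mono' ?_ (Eventually.of_forall fun ⟨z, t⟩ => ?_)
      · apply Continuous.aestronglyMeasurable
        unfold Function.uncurry
        simp only [hw]
        fun_prop
      · simp only [Function.uncurry_apply_pair, norm_mul, hw, norm_exp, norm_real, Real.norm_eq_abs,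
          Real.abs_exp]
        have : (s t * z).re = -δ * z := by simp [hs]
        rw [this]
        apply le_of_eq
        ring
  have hkey : 2 * Real.pi * ((∫ z, chordKernel y z *
      ((∫ u, gaussKernel T (z - u) ∂ν) - κ * ∫ u, gaussKernel T (z - u) ∂ρ) : ℝ) : ℂ) =
      ∫ t, g t * ∫ z, (chordKernel y z : ℂ) * cexp (s t * z) := by
    rw [← hswap, ← integral_complex_ofReal, ← integral_const_mul]
    congr 1 with z
    rw [integral_const_mul, ← two_pi_mul_gaussSmoothing_sub hT0 hδ hδ' hν hρ hD hDL hgrow z]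
    push_cast
    ring
  have hbd : ‖∫ t, g t * ∫ z, (chordKernel y z : ℂ) * cexp (s t * z)‖ ≤
      (C₁ + 1) * Real.exp 1 * (4 / δ ^ 2) * y *
        ∫ t : ℝ, (1 + |t|) ^ (A - 2) * Real.exp (-t ^ 2 / T ^ 2) := by
    rw [← integral_const_mul]
    refine norm_integral_le_of_norm_le (hi.const_mul _) (Eventually.of_forall fun t => ?_)
    have h1 := norm_line_mul_gaussWeight_le (by nlinarith) hC₁' hT (hC₁ t) 0
    have hre : (s t).re < 0 := by simp [hs, hδ]
    have h2 := norm_integral_chordKernel_mul_cexp_le hy hre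
    have h3 : ‖s t‖ ^ 2 = δ ^ 2 + t ^ 2 := by
      rw [← normSq_eq_norm_sq, hs]
      simp [normSq_apply]
      ring
    have h4 : 2 * y / ‖s t‖ ^ 2 ≤ 4 / δ ^ 2 * y * (1 + |t|) ^ (-2 : ℝ) := by
      rw [h3, Real.rpow_neg (by positivity), Real.rpow_two, ← div_eq_mul_inv, div_le_div_iff₀
        (by positivity) (by positivity), div_mul_eq_mul_div, div_mul_eq_mul_div,
        le_div_iff₀ (by positivity)]
      have e1 : (1 + |t|) ^ 2 ≤ 2 + 2 * t ^ 2 := by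
        rw [← sq_abs t]; nlinarith [sq_nonneg (1 - |t|)]
      have e2 : δ ^ 2 * t ^ 2 ≤ t ^ 2 := by
        apply mul_le_of_le_one_left (sq_nonneg t); nlinarith
      have e3 : (1 + |t|) ^ 2 * δ ^ 2 ≤ 2 * (δ ^ 2 + t ^ 2) := by
        nlinarith [mul_le_mul_of_nonneg_right e1 (sq_nonneg δ)]
      nlinarith
    rw [norm_mul, hg]
    simp only [mul_zero, Real.exp_zero, mul_one] at h1
    calc _ ≤ C₁ * Real.exp 1 * ((1 + |t|) ^ A * Real.exp (-t ^ 2 / T ^ 2)) *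
          (4 / δ ^ 2 * y * (1 + |t|) ^ (-2 : ℝ)) :=
          mul_le_mul h1 (h2.trans h4) (norm_nonneg _) (by positivity)
      _ = C₁ * (Real.exp 1 * (4 / δ ^ 2) * y *
          ((1 + |t|) ^ (A - 2) * Real.exp (-t ^ 2 / T ^ 2))) := by
          rw [sub_eq_add_neg A 2, Real.rpow_add (by positivity)]; ring
      _ ≤ (C₁ + 1) * (Real.exp 1 * (4 / δ ^ 2) * y *
          ((1 + |t|) ^ (A - 2) * Real.exp (-t ^ 2 / T ^ 2))) := by
          gcongr; linarith
      _ = _ := by ring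
  rw [← hkey, norm_mul, norm_real, Real.norm_eq_abs] at hbd
  have h3 : ‖(2 * Real.pi : ℂ)‖ = 2 * Real.pi := by
    simp [abs_of_pos Real.pi_pos]
  rw [h3] at hbd
  set X := |∫ z, chordKernel y z *
        ((∫ u, gaussKernel T (z - u) ∂ν) - κ * ∫ u, gaussKernel T (z - u) ∂ρ)|
  have hX : 0 ≤ X := abs_nonneg _
  calc X ≤ 2 * Real.pi * X := by nlinarith [Real.pi_gt_three]
    _ ≤ _ := hbd
    _ ≤ (C₁ + 1) * Real.exp 1 * (4 / δ ^ 2) * y * (C₂ * T ^ (A - 1 + δ)) := by gcongr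
    _ = _ := by ring

end tauberian

section tauberian
open Complex
variable {T : ℝ} {D : ℂ → ℂ} {ν ρ : Measure ℝ} {κ A δ : ℝ}

lemma integral_max_le_integral_gaussRamp (hT : 0 < T)
    (hν : Integrable (fun u => Real.exp (-2 * u)) ν) (y : ℝ) :
    |(∫ u, max (y - u) 0 ∂ν) - ∫ u, gaussRamp T (y - u) ∂ν| ≤
      2 / T ^ 2 * ∫ u, gaussKernel T (y - u) ∂ν := by
  have h1 := integral_mono (integrable_max_sub hν y) (integrable_gaussRamp_sub hT hν y)
    fun u => max_le_gaussRamp hT (y - u)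
  have hk := (integrable_gaussKernel_sub hT hν y).const_mul (2 / T ^ 2)
  have h2 : ∫ u, gaussRamp T (y - u) ∂ν ≤
      ∫ u, (max (y - u) 0 + 2 / T ^ 2 * gaussKernel T (y - u)) ∂ν :=
    integral_mono (integrable_gaussRamp_sub hT hν y) ((integrable_max_sub hν y).add hk)
      fun u => gaussRamp_le hT (y - u)
  rw [integral_add (integrable_max_sub hν y) hk, integral_const_mul] at h2
  rw [abs_le]
  constructor <;> linarith

lemma gaussRamp_le_of_one_le (hT : 1 ≤ T) (v : ℝ) :
    gaussRamp T v ≤ max v 0 + 2 * gaussKernel 1 v := by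
  refine (gaussRamp_le (by linarith) v).trans ?_
  refine add_le_add le_rfl ?_
  unfold gaussKernel
  have hT0 : 0 < T := by linarith
  have : 2 / T ^ 2 * (T / (2 * √Real.pi) * Real.exp (-(T ^ 2 / 4) * v ^ 2)) =
    2 * (T⁻¹ / (2 * √Real.pi) * Real.exp (-(T ^ 2 / 4) * v ^ 2)) := by
    field_simp
  rw [this]
  gcongr
  · exact inv_le_one_of_one_le₀ hT

lemma exists_integral_gaussRamp_le (hν : Integrable (fun u => Real.exp (-2 * u)) ν) (y : ℝ) :
    ∃ C ≥ 0, ∀ T : ℝ, 1 ≤ T → |∫ u, gaussRamp T (y - u) ∂ν| ≤ C := by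
  have hi := (integrable_max_sub hν y).add
    ((integrable_gaussKernel_sub one_pos hν y).const_mul 2)
  refine ⟨∫ u, (max (y - u) 0 + 2 * gaussKernel 1 (y - u)) ∂ν, ?_, fun T hT => ?_⟩
  · exact integral_nonneg fun u => add_nonneg (le_max_right _ _)
      (mul_nonneg zero_le_two (gaussKernel_nonneg one_pos _))
  · have hT0 : 0 < T := by linarith
    rw [abs_of_nonneg (integral_nonneg fun u => gaussRamp_nonneg hT0 _)]
    exact integral_mono (integrable_gaussRamp_sub hT0 hν y) hi
      fun u => gaussRamp_le_of_one_le hT _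

lemma rieszMean_combine {κ C₁ C₂ C₃ a₀ a₁ b₀ b₁ y X Q Y Sν Sρ Pν Pρ Pν₀ Pρ₀ Pν₁ Pρ₁ Gν Gρ : ℝ}
    (hC₁ : 0 ≤ C₁) (hC₂ : 0 ≤ C₂) (ha₀ : 0 ≤ a₀) (ha₁ : 0 ≤ a₁) (hb₀ : 0 ≤ b₀) (hb₁ : 0 ≤ b₁)
    (hy : 1 ≤ y) (hTp : 1 ≤ X) (hT2 : 0 < Q) (hGρ0 : 0 ≤ Gρ)
    (e₁ : |Gν - κ * Gρ| ≤ C₁ * (X * Q))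
    (e₂ : |Pν - (1 - y) * Pν₀ - y * Pν₁ - κ * (Pρ - (1 - y) * Pρ₀ - y * Pρ₁)| ≤ C₂ * y * X)
    (e₃ : Gρ ≤ C₃ * Real.exp Y) (f₁ : |Sν - Pν| ≤ 2 / Q * Gν) (f₂ : |Sρ - Pρ| ≤ 2 / Q * Gρ)
    (g₁ : |Pν₀| ≤ a₀) (g₂ : |Pν₁| ≤ a₁) (g₃ : |Pρ₀| ≤ b₀) (g₄ : |Pρ₁| ≤ b₁) :
    |Sν - κ * Sρ| ≤ (2 * C₁ + C₂ + (a₀ + a₁ + |κ| * (b₀ + b₁)) + 4 * |κ| * |C₃|) *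
      (y * X + Real.exp Y / Q) := by
  set M := a₀ + a₁ + |κ| * (b₀ + b₁) with hM
  have hM0 : 0 ≤ M := by positivity
  have r1 : Gν ≤ C₁ * (X * Q) + |κ| * Gρ := by
    have := le_abs_self (Gν - κ * Gρ)
    have : κ * Gρ ≤ |κ| * Gρ := by gcongr; exact le_abs_self κ
    linarith
  have r2 : |κ| * |Sρ - Pρ| ≤ |κ| * (2 / Q * Gρ) := by gcongr
  have r3 : Gρ ≤ |C₃| * Real.exp Y := e₃.trans (by gcongr; exact le_abs_self _)
  have r4 : 2 / Q * Gν ≤ 2 * C₁ * X + 2 / Q * (|κ| * Gρ) := by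
    calc _ ≤ 2 / Q * (C₁ * (X * Q) + |κ| * Gρ) := by gcongr
      _ = _ := by field_simp
  have r5 : 2 / Q * (|κ| * Gρ) ≤ 2 * |κ| * |C₃| * (Real.exp Y / Q) := by
    calc _ ≤ 2 / Q * (|κ| * (|C₃| * Real.exp Y)) := by gcongr
      _ = _ := by ring
  have r6 : |(1 - y) * Pν₀| ≤ y * a₀ := by
    rw [abs_mul]
    apply mul_le_mul _ g₁ (abs_nonneg _) (by linarith)
    rw [abs_le]; constructor <;> linarith
  have r6' : |κ * ((1 - y) * Pρ₀)| ≤ |κ| * (y * b₀) := by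
    rw [abs_mul, abs_mul (1 - y)]
    gcongr
    rw [abs_le]; constructor <;> linarith
  have r7 : |y * Pν₁| ≤ y * a₁ := by
    rw [abs_mul, abs_of_nonneg (by linarith : 0 ≤ y)]
    gcongr
  have r7' : |κ * (y * Pρ₁)| ≤ |κ| * (y * b₁) := by
    rw [abs_mul, abs_mul y, abs_of_nonneg (by linarith : 0 ≤ y)]
    gcongr
  have r8 : Sν - κ * Sρ = (Sν - Pν) - κ * (Sρ - Pρ) +
      (Pν - (1 - y) * Pν₀ - y * Pν₁ - κ * (Pρ - (1 - y) * Pρ₀ - y * Pρ₁)) +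
      ((1 - y) * Pν₀ - κ * ((1 - y) * Pρ₀)) + (y * Pν₁ - κ * (y * Pρ₁)) := by ring
  have r9 : |Sν - κ * Sρ| ≤ |Sν - Pν| + |κ| * |Sρ - Pρ| +
      |Pν - (1 - y) * Pν₀ - y * Pν₁ - κ * (Pρ - (1 - y) * Pρ₀ - y * Pρ₁)| +
      (|(1 - y) * Pν₀| + |κ * ((1 - y) * Pρ₀)|) + (|y * Pν₁| + |κ * (y * Pρ₁)|) := by
    rw [r8, ← abs_mul]
    refine (abs_add_le _ _).trans (add_le_add ((abs_add_le _ _).trans (add_le_add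
      ((abs_add_le _ _).trans (add_le_add (abs_sub _ _) le_rfl)) (abs_sub _ _))) (abs_sub _ _))
  have r10 : y * a₀ + y * a₁ + |κ| * (y * b₀) + |κ| * (y * b₁) = M * y := by rw [hM]; ring
  have r11 : 2 * C₁ * X ≤ 2 * C₁ * (y * X) := by
    have : X ≤ y * X := le_mul_of_one_le_left (by linarith only [hTp]) hy
    gcongr
  have r12 : M * y ≤ M * (y * X) := by
    have : y ≤ y * X := le_mul_of_one_le_right (by linarith only [hy]) hTp
    gcongr
  have hE : 0 ≤ Real.exp Y / Q := by positivity
  have hyX : 0 ≤ y * X := mul_nonneg (by linarith only [hy]) (by linarith only [hTp])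
  have r13 : 0 ≤ (2 * C₁ + C₂ + M) * (Real.exp Y / Q) := by positivity
  have r14 : 0 ≤ 4 * |κ| * |C₃| * (y * X) := by positivity
  have r15 : C₂ * y * X = C₂ * (y * X) := by ring
  have r16 : |κ| * (2 / Q * Gρ) = 2 / Q * (|κ| * Gρ) := by ring
  have t1 : |Sν - Pν| ≤ 2 * C₁ * (y * X) + 2 * |κ| * |C₃| * (Real.exp Y / Q) := by
    linarith only [f₁, r4, r5, r11]
  have t2 : |κ| * |Sρ - Pρ| ≤ 2 * |κ| * |C₃| * (Real.exp Y / Q) := by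
    linarith only [r2, r16, r5]
  have t3 : (|(1 - y) * Pν₀| + |κ * ((1 - y) * Pρ₀)|) + (|y * Pν₁| + |κ * (y * Pρ₁)|) ≤
      M * (y * X) := by
    linarith only [r6, r6', r7, r7', r10, r12]
  have t4 : (2 * C₁ + C₂ + M + 4 * |κ| * |C₃|) * (y * X + Real.exp Y / Q) =
      2 * C₁ * (y * X) + C₂ * (y * X) + M * (y * X) + 4 * |κ| * |C₃| * (y * X) +
      (2 * C₁ + C₂ + M) * (Real.exp Y / Q) + 4 * |κ| * |C₃| * (Real.exp Y / Q) := by ring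
  linarith only [t1, t2, t3, t4, r9, r13, r14, r15, e₂]

/-- A Tauberian estimate for first Riesz means: if the difference `D` of the Laplace transforms of
two positive measures is entire and of polynomial growth on a line to the left of the origin, then
the Riesz means of the measures are close. -/
theorem exists_abs_rieszMean_sub_le (hδ : 0 < δ) (hδ' : δ < 1) [SFinite ν] [SFinite ρ]
    (hA : 0 ≤ A - 1 + δ)
    (hν : Integrable (fun u => Real.exp (-2 * u)) ν)
    (hρ : Integrable (fun u => Real.exp (-2 * u)) ρ) (hD : Differentiable ℂ D)
    (hDL : ∀ t : ℝ, D ((2 : ℝ) + t * I) = (∫ u : ℝ, cexp (-((2 : ℝ) + t * I) * u) ∂ν) -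
      κ * ∫ u : ℝ, cexp (-((2 : ℝ) + t * I) * u) ∂ρ)
    (hgrow : ∃ C t₀ : ℝ, ∀ s : ℂ, s.re ∈ Icc (-δ) 2 → t₀ ≤ |s.im| →
      ‖D s‖ ≤ C * Real.exp (C * |s.im|))
    (hline : ∃ C, ∀ t : ℝ, ‖D ((-δ : ℝ) + t * I)‖ ≤ C * (1 + |t|) ^ A)
    (hGρ : ∃ C, ∀ T : ℝ, 1 ≤ T → ∀ y : ℝ, 1 ≤ y →
      ∫ u, gaussKernel T (y - u) ∂ρ ≤ C * Real.exp y) :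
    ∃ C > 0, ∀ T : ℝ, 1 ≤ T → ∀ y : ℝ, 1 ≤ y →
      |(∫ u, max (y - u) 0 ∂ν) - κ * ∫ u, max (y - u) 0 ∂ρ| ≤
        C * (y * T ^ (A - 1 + δ) + Real.exp y / T ^ 2) := by
  obtain ⟨C₁, hC₁, h₁⟩ := exists_abs_gaussSmoothing_sub_le hδ hδ' hA hν hρ hD hDL hgrow hline
  obtain ⟨C₂, hC₂, h₂⟩ := exists_abs_integral_chordKernel_le hδ hδ' hA hν hρ hD hDL hgrow hline
  obtain ⟨C₃, h₃⟩ := hGρ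
  obtain ⟨a₀, ha₀, hν₀⟩ := exists_integral_gaussRamp_le hν 0
  obtain ⟨a₁, ha₁, hν₁⟩ := exists_integral_gaussRamp_le hν 1
  obtain ⟨b₀, hb₀, hρ₀⟩ := exists_integral_gaussRamp_le hρ 0
  obtain ⟨b₁, hb₁, hρ₁⟩ := exists_integral_gaussRamp_le hρ 1
  set M := a₀ + a₁ + |κ| * (b₀ + b₁) with hM
  have hM0 : 0 ≤ M := by positivity
  refine ⟨2 * C₁ + C₂ + M + 4 * |κ| * |C₃|, by positivity, fun T hT y hy => ?_⟩
  have hT0 : 0 < T := by linarith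
  have e₁ := h₁ T hT y (by linarith)
  have e₂ := h₂ T hT y hy
  have e₃ := h₃ T hT y hy
  have f₁ := integral_max_le_integral_gaussRamp hT0 hν y
  have f₂ := integral_max_le_integral_gaussRamp hT0 hρ y
  have k₁ := integral_gaussRamp_chord hT0 hν hy
  have k₂ := integral_gaussRamp_chord hT0 hρ hy
  have hchord : ∀ {μ : Measure ℝ} [SFinite μ], Integrable (fun u => Real.exp (-2 * u)) μ →
      Integrable fun z => chordKernel y z * ∫ u, gaussKernel T (z - u) ∂μ := by
    intro μ _ hμ
    simp_rw [← integral_const_mul]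
    exact (integrable_chordKernel_mul_gaussKernel_prod hT0 hμ hy).integral_prod_right
  have k₃ : ∫ z, chordKernel y z *
        ((∫ u, gaussKernel T (z - u) ∂ν) - κ * ∫ u, gaussKernel T (z - u) ∂ρ) =
      (∫ z, chordKernel y z * ∫ u, gaussKernel T (z - u) ∂ν) -
        κ * ∫ z, chordKernel y z * ∫ u, gaussKernel T (z - u) ∂ρ := by
    rw [← integral_const_mul, ← integral_sub (hchord hν) ((hchord hρ).const_mul κ)]
    congr 1 with z
    ring
  rw [k₃, ← k₁, ← k₂] at e₂
  have g₁ := hν₀ T hT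
  have g₂ := hν₁ T hT
  have g₃ := hρ₀ T hT
  have g₄ := hρ₁ T hT
  have hGρ0 : 0 ≤ ∫ u, gaussKernel T (y - u) ∂ρ :=
    integral_nonneg fun u => gaussKernel_nonneg hT0 _
  have hTe : T ^ (A + 1 + δ) = T ^ (A - 1 + δ) * T ^ 2 := by
    rw [← Real.rpow_two, ← Real.rpow_add hT0]; ring_nf
  rw [hTe] at e₁
  exact rieszMean_combine hC₁.le hC₂.le ha₀ ha₁ hb₀ hb₁ hy (Real.one_le_rpow hT hA)
    (by positivity) hGρ0 e₁ e₂ e₃ f₁ f₂ g₁ g₂ g₃ g₄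

end tauberian

section DirichletMeasure

open scoped ENNReal

/-- The measure `∑ a m • δ_{log m}`, over `m ≥ 1`, attached to the Dirichlet series `∑ a m m⁻ˢ`. -/
noncomputable def dirichletMeasure (a : ℕ → ℕ) : Measure ℝ :=
  Measure.sum fun m : ℕ => (if m = 0 then 0 else (a m : ℝ≥0∞)) • Measure.dirac (Real.log m)

instance (a : ℕ → ℕ) : SFinite (dirichletMeasure a) := by
  unfold dirichletMeasure
  infer_instance

lemma dirichletMeasure_weight_ne_top (a : ℕ → ℕ) (m : ℕ) :
    (if m = 0 then 0 else (a m : ℝ≥0∞)) ≠ ∞ := by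
  split_ifs <;> simp

lemma integral_dirichletMeasure {E : Type*} [NormedAddCommGroup E] [NormedSpace ℝ E]
    [FiniteDimensional ℝ E] (a : ℕ → ℕ) (f : ℝ → E) :
    ∫ u, f u ∂dirichletMeasure a =
      ∑' m : ℕ, (if m = 0 then 0 else (a m : ℝ)) • f (Real.log m) := by
  rw [dirichletMeasure, integral_sum_dirac (dirichletMeasure_weight_ne_top a)]
  congr 1 with m
  split_ifs <;> simp

lemma integrable_dirichletMeasure {a : ℕ → ℕ}
    (h : Summable fun m : ℕ => (a m : ℂ) * (m : ℂ) ^ (-2 : ℂ)) :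
    Integrable (fun u => Real.exp (-2 * u)) (dirichletMeasure a) := by
  refine integrable_sum_dirac (dirichletMeasure_weight_ne_top a) (h.norm.congr fun m => ?_)
  rcases eq_or_ne m 0 with rfl | hm
  · simp
  · have hm' : (0 : ℝ) < m := by exact_mod_cast Nat.pos_of_ne_zero hm
    rw [if_neg hm, ENNReal.toReal_natCast, norm_mul, Complex.norm_natCast,
      ← Complex.ofReal_natCast m, Complex.norm_cpow_eq_rpow_re_of_pos hm',
      Real.rpow_def_of_pos hm', Real.norm_of_nonneg (Real.exp_pos _).le]
    norm_num [mul_comm]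

lemma integral_cexp_dirichletMeasure (a : ℕ → ℕ) {s : ℂ} (hs : s ≠ 0) :
    ∫ u : ℝ, Complex.exp (-s * u) ∂dirichletMeasure a = ∑' m : ℕ, (a m : ℂ) * (m : ℂ) ^ (-s) := by
  rw [integral_dirichletMeasure]
  congr 1 with m
  rcases eq_or_ne m 0 with rfl | hm
  · simp [Complex.zero_cpow (neg_ne_zero.2 hs)]
  · have hm' : (m : ℂ) ≠ 0 := by exact_mod_cast hm
    rw [if_neg hm, Complex.cpow_def_of_ne_zero hm', ← Complex.natCast_log, mul_comm (-s),
      Complex.real_smul, Complex.ofReal_natCast]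

lemma integral_max_dirichletMeasure (a : ℕ → ℕ) {x : ℝ} (hx : 1 ≤ x) :
    ∫ u, max (Real.log x - u) 0 ∂dirichletMeasure a =
      ∑ m ∈ Finset.Icc 1 ⌊x⌋₊, (a m : ℝ) * Real.log (x / m) := by
  rw [integral_dirichletMeasure, tsum_eq_sum (s := Finset.Icc 1 ⌊x⌋₊)]
  · refine Finset.sum_congr rfl fun m hm => ?_
    have hm1 := (Finset.mem_Icc.1 hm).1
    have hm2 : (m : ℝ) ≤ x := (Nat.le_floor_iff (by linarith)).1 (Finset.mem_Icc.1 hm).2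
    have hm' : (0 : ℝ) < m := by exact_mod_cast hm1
    rw [if_neg (by lia), Real.log_div (by linarith) hm'.ne', smul_eq_mul,
      max_eq_left (sub_nonneg.2 (Real.log_le_log hm' hm2))]
  · intro m hm
    rcases eq_or_ne m 0 with rfl | hm0
    · simp
    · have hm2 : x < m := by
        by_contra! h
        exact hm (Finset.mem_Icc.2 ⟨Nat.pos_of_ne_zero hm0, Nat.le_floor h⟩)
      rw [max_eq_right (sub_nonpos.2 (Real.log_le_log (by linarith) hm2.le)), smul_zero]

/-- The measure `eᵘ du` on `(0, ∞)`, whose Laplace transform is `1 / (s - 1)`. -/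
noncomputable def expMeasure : Measure ℝ :=
  (volume.restrict (Ioi 0)).withDensity fun u => ENNReal.ofReal (Real.exp u)

instance : SFinite expMeasure := by
  unfold expMeasure
  infer_instance

lemma integral_expMeasure {E : Type*} [NormedAddCommGroup E] [NormedSpace ℝ E] (f : ℝ → E) :
    ∫ u, f u ∂expMeasure = ∫ u in Ioi 0, Real.exp u • f u := by
  rw [expMeasure, integral_withDensity_eq_integral_toReal_smul (by fun_prop) (by simp)]
  simp only [ENNReal.toReal_ofReal (Real.exp_pos _).le]

lemma integrable_expMeasure : Integrable (fun u => Real.exp (-2 * u)) expMeasure := by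
  rw [expMeasure, integrable_withDensity_iff_integrable_smul' (by fun_prop) (by simp)]
  have h := integrableOn_exp_mul_Ioi (a := -1) (by norm_num) 0
  refine h.congr_fun (fun u _ => ?_) measurableSet_Ioi
  simp only [ENNReal.toReal_ofReal (Real.exp_pos _).le, smul_eq_mul, ← Real.exp_add]
  ring_nf

lemma integral_cexp_expMeasure {s : ℂ} (hs : 1 < s.re) :
    ∫ u : ℝ, Complex.exp (-s * u) ∂expMeasure = 1 / (s - 1) := by
  rw [integral_expMeasure]
  have h := integral_exp_mul_complex_Ioi (a := 1 - s) (by simpa using hs) 0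
  rw [Complex.ofReal_zero, mul_zero, Complex.exp_zero] at h
  have h1 : ∀ u : ℝ, Real.exp u • Complex.exp (-s * u) = Complex.exp ((1 - s) * u) := fun u => by
    rw [Complex.real_smul, Complex.ofReal_exp, ← Complex.exp_add]
    ring_nf
  simp only [h1, h]
  rw [neg_div, ← div_neg, neg_sub]

lemma integral_max_expMeasure {y : ℝ} (hy : 0 ≤ y) :
    ∫ u, max (y - u) 0 ∂expMeasure = Real.exp y - 1 - y := by
  have h1 : ∫ u in Ioi (0 : ℝ), Real.exp u • max (y - u) 0 =
      ∫ u in Ioc 0 y, Real.exp u • max (y - u) 0 := by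
    refine (setIntegral_eq_of_subset_of_forall_sdiff_eq_zero measurableSet_Ioi Ioc_subset_Ioi_self
      fun u hu => ?_)
    have : y ≤ u := le_of_not_ge fun h => hu.2 ⟨hu.1, h⟩
    rw [max_eq_right (by linarith), smul_zero]
  have h2 : ∫ u in Ioc 0 y, Real.exp u • max (y - u) 0 = ∫ u in (0 : ℝ)..y, (y - u) * Real.exp u := by
    rw [intervalIntegral.integral_of_le hy]
    refine setIntegral_congr_fun measurableSet_Ioc fun u hu => ?_
    simp only [smul_eq_mul]
    rw [max_eq_left (by linarith [hu.2]), mul_comm]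
  have h3 : ∫ u in (0 : ℝ)..y, (y - u) * Real.exp u =
      (y - y + 1) * Real.exp y - (y - 0 + 1) * Real.exp 0 := by
    refine intervalIntegral.integral_eq_sub_of_hasDerivAt
      (f := fun u => (y - u + 1) * Real.exp u) (fun u _ => ?_)
      ((by fun_prop : Continuous fun u => (y - u) * Real.exp u).intervalIntegrable _ _)
    have := (((hasDerivAt_id u).const_sub y).add_const 1).mul (Real.hasDerivAt_exp u)
    refine this.congr_deriv ?_
    simp only [id]
    ring
  rw [integral_expMeasure, h1, h2, h3, Real.exp_zero]
  ring

lemma gaussKernel_mul_exp_le {T : ℝ} (hT : 1 ≤ T) (v : ℝ) :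
    gaussKernel T v * Real.exp (-v) ≤ Real.exp 2 * √2 * gaussKernel (T / √2) v := by
  have h2 : (0 : ℝ) < √2 := by positivity
  have hs : √2 ^ 2 = (2 : ℝ) := Real.sq_sqrt (by norm_num)
  unfold gaussKernel
  have h3 : Real.exp 2 * √2 * (T / √2 / (2 * √Real.pi) *
      Real.exp (-((T / √2) ^ 2 / 4) * v ^ 2)) =
      T / (2 * √Real.pi) * Real.exp (2 + -((T / √2) ^ 2 / 4) * v ^ 2) := by
    rw [Real.exp_add]
    field_simp
  rw [h3, mul_assoc, ← Real.exp_add, div_pow, hs]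
  refine mul_le_mul_of_nonneg_left (Real.exp_le_exp.2 ?_) (by positivity)
  have h4 : v ^ 2 ≤ T ^ 2 * v ^ 2 := le_mul_of_one_le_left (sq_nonneg _) (one_le_pow₀ hT)
  nlinarith [sq_nonneg (v + 4)]

lemma integral_gaussKernel_expMeasure_le {T : ℝ} (hT : 1 ≤ T) (y : ℝ) :
    ∫ u, gaussKernel T (y - u) ∂expMeasure ≤ Real.exp 2 * √2 * Real.exp y := by
  have hT' : 0 < T / √2 := by positivity
  rw [integral_expMeasure]
  set g : ℝ → ℝ := fun u => Real.exp y * (Real.exp 2 * √2) * gaussKernel (T / √2) (y - u) with hg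
  have hgi : Integrable g := ((integrable_gaussKernel hT').comp_sub_left y).const_mul _
  have hg0 : ∀ u, 0 ≤ g u := fun u => mul_nonneg (by positivity) (gaussKernel_nonneg hT' _)
  have hle : ∀ u, Real.exp u • gaussKernel T (y - u) ≤ g u := fun u => by
    have h := mul_le_mul_of_nonneg_left (gaussKernel_mul_exp_le hT (y - u)) (Real.exp_pos y).le
    have h1 : Real.exp u = Real.exp y * Real.exp (-(y - u)) := by
      rw [← Real.exp_add]; ring_nf
    rw [smul_eq_mul, h1, hg]
    calc _ = Real.exp y * (gaussKernel T (y - u) * Real.exp (-(y - u))) := by ring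
      _ ≤ _ := h
      _ = _ := by ring
  calc ∫ u in Ioi (0 : ℝ), Real.exp u • gaussKernel T (y - u)
      ≤ ∫ u in Ioi (0 : ℝ), g u := by
        refine integral_mono_of_nonneg (ae_of_all _ fun u => ?_) hgi.integrableOn
          (ae_of_all _ hle)
        exact mul_nonneg (Real.exp_pos _).le (gaussKernel_nonneg (by linarith) _)
    _ ≤ ∫ u, g u := setIntegral_le_integral hgi (ae_of_all _ hg0)
    _ = _ := by
      rw [hg, integral_const_mul, integral_sub_left_eq_self (gaussKernel (T / √2)) volume y,
        integral_gaussKernel hT']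
      ring

end DirichletMeasure

section IdealTheorem

open scoped Topology

lemma exponents_le {n : ℕ} (hn : 2 ≤ n) {lam : ℝ}
    (hlam : lam = if n ≤ 6 then (3 : ℝ) / 4 - 3 / (2 * (n : ℝ)) else (1 : ℝ) - 3 / (n : ℝ)) :
    0 ≤ lam ∧ (3 : ℝ) / 4 - 3 / (2 * (n : ℝ)) ≤ lam ∧ (1 : ℝ) - 3 / (n : ℝ) ≤ lam := by
  have hn' : (2 : ℝ) ≤ n := by exact_mod_cast hn
  have hn0 : (0 : ℝ) < n := by linarith
  have h1 : (3 : ℝ) / (2 * (n : ℝ)) = 3 / 2 * (n : ℝ)⁻¹ := by field_simp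
  have h2 : (3 : ℝ) / (n : ℝ) = 3 * (n : ℝ)⁻¹ := by field_simp
  rw [h1, h2] at hlam ⊢
  have h3 : (n : ℝ)⁻¹ ≤ 1 / 2 := by
    rw [inv_le_comm₀ hn0 (by norm_num)]; linarith
  split_ifs at hlam with h
  · have h4 : (1 : ℝ) / 6 ≤ (n : ℝ)⁻¹ := by
      rw [le_inv_comm₀ (by norm_num) hn0]
      norm_num
      exact_mod_cast h
    refine ⟨?_, ?_, ?_⟩ <;> linarith
  · have h4 : (n : ℝ)⁻¹ ≤ 1 / 6 := by
      rw [inv_le_comm₀ hn0 (by norm_num)]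
      norm_num
      exact_mod_cast (not_le.1 h).le
    refine ⟨?_, ?_, ?_⟩ <;> linarith

lemma rieszMean_exponent_bound {n : ℕ} (hn : 2 ≤ n) {lam ε x : ℝ}
    (hlam : lam = if n ≤ 6 then (3 : ℝ) / 4 - 3 / (2 * (n : ℝ)) else (1 : ℝ) - 3 / (n : ℝ))
    (hε : 0 < ε) (hx : 1 ≤ x) :
    Real.log x * (x ^ (3 / (2 * (n : ℝ)))) ^ (n * (1 / 2 + ε / 8) - 1 + ε / 8) ≤
      2 / ε * x ^ (lam + ε) ∧
    x / (x ^ (3 / (2 * (n : ℝ)))) ^ 2 ≤ x ^ (lam + ε) ∧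
    1 ≤ x ^ (lam + ε) ∧ Real.log x ≤ 2 / ε * x ^ (lam + ε) := by
  obtain ⟨h0, h1, h2⟩ := exponents_le hn hlam
  have hn' : (2 : ℝ) ≤ n := by exact_mod_cast hn
  have hn0 : (0 : ℝ) < n := by linarith
  have hx0 : 0 < x := by linarith
  have hlog : Real.log x ≤ 2 / ε * x ^ (ε / 2) := by
    have := Real.log_le_rpow_div hx0.le (half_pos hε)
    refine this.trans (le_of_eq ?_)
    field_simp
  refine ⟨?_, ?_, Real.one_le_rpow hx (by linarith), ?_⟩
  · rw [← Real.rpow_mul hx0.le]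
    refine (mul_le_mul_of_nonneg_right hlog (Real.rpow_nonneg hx0.le _)).trans ?_
    rw [mul_assoc, ← Real.rpow_add hx0]
    refine mul_le_mul_of_nonneg_left (Real.rpow_le_rpow_of_exponent_le hx ?_) (by positivity)
    have h3 : 3 / (2 * (n : ℝ)) * (n * (1 / 2 + ε / 8) - 1 + ε / 8) =
        (3 / 4 - 3 / (2 * (n : ℝ))) + 3 / 16 * ε + 3 / 16 * ε * (n : ℝ)⁻¹ := by
      field_simp
      ring
    have h4 : (n : ℝ)⁻¹ ≤ 1 := inv_le_one_of_one_le₀ (by linarith)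
    have h5 : 3 / 16 * ε * (n : ℝ)⁻¹ ≤ 3 / 16 * ε := mul_le_of_le_one_right (by positivity) h4
    rw [h3]
    linarith
  · have h3 : x / (x ^ (3 / (2 * (n : ℝ)))) ^ 2 = x ^ (1 - 3 / (n : ℝ)) := by
      rw [← Real.rpow_natCast, ← Real.rpow_mul hx0.le, Real.rpow_sub hx0, Real.rpow_one]
      congr 2
      push_cast
      field_simp
    rw [h3]
    exact Real.rpow_le_rpow_of_exponent_le hx (by linarith)
  · exact hlog.trans (mul_le_mul_of_nonneg_left
      (Real.rpow_le_rpow_of_exponent_le hx (by linarith)) (by positivity))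

variable {K : Type*} [Field K] [NumberField K]

lemma eq_of_tendsto_residue {H : ℂ → ℂ} (hH : Differentiable ℂ H)
    (hsum : ∀ s : ℂ, 1 < s.re →
      HasSum (fun m : ℕ => (rK K m : ℂ) * (m : ℂ) ^ (-s)) (H s / (s - 1))) {κ : ℝ}
    (hκ : Tendsto (fun s : ℝ => (s - 1) * ∑' m : ℕ, (rK K m : ℝ) / (m : ℝ) ^ s)
      (nhdsWithin 1 (Ioi 1)) (nhds κ)) : H 1 = κ := by
  have h1 : Tendsto (fun s : ℝ => H s) (𝓝[>] 1) (𝓝 (H 1)) := by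
    have := (hH.continuous.comp Complex.continuous_ofReal).tendsto 1
    simp only [Function.comp_apply, Complex.ofReal_one] at this
    exact this.mono_left nhdsWithin_le_nhds
  have h2 : Tendsto (fun s : ℝ => (((s - 1) * ∑' m : ℕ, (rK K m : ℝ) / (m : ℝ) ^ s : ℝ) : ℂ))
      (𝓝[>] 1) (𝓝 (κ : ℂ)) := (Complex.continuous_ofReal.tendsto κ).comp hκ
  refine tendsto_nhds_unique (h1.congr' ?_) h2
  filter_upwards [self_mem_nhdsWithin] with s hs
  have hs' : 1 < s := hs
  have hs1 : (s : ℂ) - 1 ≠ 0 := by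
    rw [Ne, sub_eq_zero]
    exact_mod_cast hs'.ne'
  have h3 := (hsum s (by simpa using hs')).tsum_eq
  rw [eq_div_iff hs1, mul_comm] at h3
  rw [← h3]
  push_cast
  congr 2 with m
  rw [Complex.ofReal_cpow (Nat.cast_nonneg _), Complex.cpow_neg, div_eq_mul_inv,
    Complex.ofReal_natCast]

lemma norm_dslope_one_le (H : ℂ → ℂ) {s : ℂ} {b : ℝ} (hb : 0 < b) (hs : b ≤ ‖s - 1‖) :
    ‖dslope H 1 s‖ ≤ ‖H s‖ / ‖s - 1‖ + ‖H 1‖ / b := by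
  have hs1 : s ≠ 1 := fun h => by
    rw [h, sub_self, norm_zero] at hs
    linarith
  rw [dslope_of_ne _ hs1, slope_def_field, norm_div]
  refine (div_le_div_of_nonneg_right (norm_sub_le _ _) (norm_nonneg _)).trans ?_
  rw [add_div]
  exact add_le_add le_rfl (div_le_div_of_nonneg_left (norm_nonneg _) hb hs)

variable (K) in
lemma exists_abs_rieszMean_rK_sub_le (hn : 2 ≤ Module.finrank ℚ K) {κ δ : ℝ}
    (hκ : Tendsto (fun s : ℝ => (s - 1) * ∑' m : ℕ, (rK K m : ℝ) / (m : ℝ) ^ s)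
      (nhdsWithin 1 (Ioi 1)) (nhds κ)) (hδ : 0 < δ) (hδ' : δ < 1) :
    ∃ C > 0, ∀ T : ℝ, 1 ≤ T → ∀ y : ℝ, 1 ≤ y →
      |(∫ u, max (y - u) 0 ∂dirichletMeasure (rK K)) - κ * ∫ u, max (y - u) 0 ∂expMeasure| ≤
        C * (y * T ^ (Module.finrank ℚ K * (1 / 2 + δ) - 1 + δ) + Real.exp y / T ^ 2) := by
  obtain ⟨H, hH, hsum, ⟨C₁, hC₁, hg⟩, C₂, hC₂, hl⟩ := exists_entire_dedekind K hδ hδ'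
  have hH1 := eq_of_tendsto_residue hH hsum hκ
  have hn' : (2 : ℝ) ≤ Module.finrank ℚ K := by exact_mod_cast hn
  have hA : 0 ≤ Module.finrank ℚ K * (1 / 2 + δ) := by positivity
  refine exists_abs_rieszMean_sub_le (D := dslope H 1) hδ hδ' (by nlinarith) ?_
    integrable_expMeasure (differentiable_dslope hH 1) (fun t => ?_) ?_ ?_
    ⟨_, fun T hT y _ => integral_gaussKernel_expMeasure_le hT y⟩
  · exact integrable_dirichletMeasure (hsum 2 (by norm_num)).summable
  · set s : ℂ := (2 : ℝ) + t * Complex.I with hs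
    have hre : s.re = 2 := by simp [hs]
    have hs0 : s ≠ 0 := fun h => by rw [h, Complex.zero_re] at hre; norm_num at hre
    have hs1 : s ≠ 1 := fun h => by rw [h, Complex.one_re] at hre; norm_num at hre
    rw [integral_cexp_dirichletMeasure _ hs0, integral_cexp_expMeasure (by rw [hre]; norm_num),
      (hsum s (by rw [hre]; norm_num)).tsum_eq, dslope_of_ne _ hs1, slope_def_field, hH1, sub_div,
      mul_one_div]
  · refine ⟨C₁ + ‖H 1‖ / 2, 2, fun s hs hs' => ?_⟩
    have h2 : 2 ≤ ‖s - 1‖ := by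
      have := Complex.abs_im_le_norm (s - 1)
      rw [Complex.sub_im, Complex.one_im, sub_zero] at this
      exact hs'.trans this
    refine (norm_dslope_one_le H two_pos h2).trans ?_
    have h3 : ‖H s‖ / ‖s - 1‖ ≤ C₁ * Real.exp (C₁ * |s.im|) :=
      (div_le_self (norm_nonneg _) (by linarith)).trans (hg s hs hs')
    have hb : 0 ≤ ‖H 1‖ / 2 := by positivity
    have h4 : Real.exp (C₁ * |s.im|) ≤ Real.exp ((C₁ + ‖H 1‖ / 2) * |s.im|) :=
      Real.exp_le_exp.2 (mul_le_mul_of_nonneg_right (by linarith) (abs_nonneg _))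
    have h5 : 1 ≤ Real.exp ((C₁ + ‖H 1‖ / 2) * |s.im|) := Real.one_le_exp (by positivity)
    rw [add_mul]
    exact add_le_add (h3.trans (mul_le_mul_of_nonneg_left h4 hC₁)) (le_mul_of_one_le_right hb h5)
  · refine ⟨C₂ + ‖H 1‖ / 1, fun t => ?_⟩
    set s : ℂ := (-δ : ℝ) + t * Complex.I with hs
    have h1 : 1 ≤ ‖s - 1‖ := by
      have := Complex.abs_re_le_norm (s - 1)
      have hre : (s - 1).re = -δ - 1 := by simp [hs]
      rw [hre, abs_of_neg (by linarith)] at this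
      linarith
    refine (norm_dslope_one_le H one_pos h1).trans ?_
    have h2 : 1 ≤ (1 + |t|) ^ (Module.finrank ℚ K * (1 / 2 + δ)) :=
      Real.one_le_rpow (by linarith [abs_nonneg t]) hA
    rw [add_mul]
    refine add_le_add ?_ (le_mul_of_one_le_right (by positivity) h2)
    rw [div_le_iff₀ (by linarith)]
    exact hl t

end IdealTheorem

/-- Logarithmically weighted ideal theorem:
`∑_{m ≤ x} r_K(m) log(x/m) = κ_K x + O(x^{λ_n+ε})` where `λ_n = 3/4 - 3/(2n)` for
`2 ≤ n ≤ 6` and `λ_n = 1 - 3/n` for `n ≥ 6` (the two values agree at `n = 6`). -/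
theorem stmt3 (K : Type*) [Field K] [NumberField K]
    (hn : 2 ≤ Module.finrank ℚ K)
    (κ : ℝ)
    (hκ : Filter.Tendsto
      (fun s : ℝ => (s - 1) * ∑' m : ℕ, (rK K m : ℝ) / (m : ℝ) ^ s)
      (nhdsWithin 1 (Set.Ioi 1)) (nhds κ))
    (lam : ℝ)
    (hlam : lam = if Module.finrank ℚ K ≤ 6
      then (3 : ℝ)/4 - 3 / (2 * (Module.finrank ℚ K : ℝ))
      else (1 : ℝ) - 3 / (Module.finrank ℚ K : ℝ))
    (ε : ℝ) (hε : ε ∈ Set.Ioo (0 : ℝ) (1/2)) :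
    ∃ C > 0, ∀ᶠ x : ℝ in atTop,
      |(∑ m ∈ Finset.Icc 1 ⌊x⌋₊, (rK K m : ℝ) * Real.log (x / m)) - κ * x|
        ≤ C * x ^ (lam + ε) := by
  obtain ⟨hε0, hε1⟩ := hε
  obtain ⟨C, hC, h⟩ := exists_abs_rieszMean_rK_sub_le K hn hκ (δ := ε / 8) (by linarith)
    (by linarith)
  refine ⟨C * (2 / ε + 1) + |κ| * (1 + 2 / ε), by positivity, ?_⟩
  filter_upwards [eventually_ge_atTop (Real.exp 1)] with x hx
  have hx1 : 1 ≤ x := (Real.one_le_exp zero_le_one).trans hx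
  have hx0 : 0 < x := by linarith
  have hy : 1 ≤ Real.log x := (Real.le_log_iff_exp_le hx0).2 hx
  have h1 := h (x ^ (3 / (2 * (Module.finrank ℚ K : ℝ))))
    (Real.one_le_rpow hx1 (by positivity)) (Real.log x) hy
  rw [integral_max_dirichletMeasure _ hx1, integral_max_expMeasure (by linarith),
    Real.exp_log hx0] at h1
  obtain ⟨b₁, b₂, b₃, b₄⟩ := rieszMean_exponent_bound hn hlam hε0 hx1
  set S := ∑ m ∈ Finset.Icc 1 ⌊x⌋₊, (rK K m : ℝ) * Real.log (x / m)
  set X := x ^ (lam + ε)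
  calc |S - κ * x| = |(S - κ * (x - 1 - Real.log x)) + -(κ * (1 + Real.log x))| := by ring_nf
    _ ≤ |S - κ * (x - 1 - Real.log x)| + |κ| * (1 + Real.log x) := by
      refine (abs_add_le _ _).trans (le_of_eq ?_)
      rw [abs_neg, abs_mul, abs_of_pos (by linarith : 0 < 1 + Real.log x)]
    _ ≤ C * (2 / ε * X + X) + |κ| * (X + 2 / ε * X) :=
      add_le_add (h1.trans (mul_le_mul_of_nonneg_left (add_le_add b₁ b₂) hC.le))
        (mul_le_mul_of_nonneg_left (add_le_add b₃ b₄) (abs_nonneg _))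
    _ = _ := by ring
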